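/- arXiv:2511.04863 — 4 statements merged into one kernel-verified Lean document; each statement's English description precedes it below -/
import Mathlib

section
/- Let H be a 3-partite 3-uniform hypergraph with vertex classes A_1, A_2, A_3, let A = A_1 and B = A_2 ∪ A_3, and let τ(H) denote the minimum size of a vertex cover of H. If k is an integer with 2k < τ(H), then the reconfiguration graph RG_Mat(H, A; k) on matchings of size k is connected. -/
/-- `M` is a matching of the 3-partite 3-uniform hypergraph with edge set
`E ⊆ α × β × γ`: distinct edges are disjoint, i.e. differ in every coordinate. -/
def TriMatching {α β γ : Type*} (E M : Finset (α × β × γ)) : Prop :=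
  M ⊆ E ∧ ∀ e ∈ M, ∀ f ∈ M, e ≠ f →
    e.1 ≠ f.1 ∧ e.2.1 ≠ f.2.1 ∧ e.2.2 ≠ f.2.2

/-- Adjacency in the reconfiguration graph `RG_Mat(H, A; k)` where `A` is the first
vertex class and `B` the union of the other two: two matchings of size `k` are adjacent
if their symmetric difference consists of exactly two edges whose parts on the `B`-side
are disjoint. -/
def TriMatAdj {α β γ : Type*} [DecidableEq α] [DecidableEq β] [DecidableEq γ]
    (E : Finset (α × β × γ)) (k : ℕ) (M M' : Finset (α × β × γ)) : Prop :=
  TriMatching E M ∧ TriMatching E M' ∧ M.card = k ∧ M'.card = k ∧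
    ∃ e f : α × β × γ, M \ M' = {e} ∧ M' \ M = {f} ∧
      e.2.1 ≠ f.2.1 ∧ e.2.2 ≠ f.2.2

set_option linter.unusedSectionVars false

namespace TriRec

section chains

variable {V : Type*} [DecidableEq V]

/-- Boundary operator mod 2 on chains of finite sets. -/
noncomputable def bd : (Finset V →₀ ZMod 2) →ₗ[ZMod 2] (Finset V →₀ ZMod 2) :=
  Finsupp.linearCombination (ZMod 2) (fun D => ∑ x ∈ D, Finsupp.single (D.erase x) (1 : ZMod 2))

/-- Cone operator. -/
noncomputable def cone (f : V) : (Finset V →₀ ZMod 2) →ₗ[ZMod 2] (Finset V →₀ ZMod 2) :=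
  Finsupp.linearCombination (ZMod 2)
    (fun X => if f ∈ X then 0 else Finsupp.single (insert f X) (1 : ZMod 2))

lemma bd_single (D : Finset V) :
    bd (Finsupp.single D (1 : ZMod 2)) = ∑ x ∈ D, Finsupp.single (D.erase x) (1 : ZMod 2) := by
  simp [bd]

lemma cone_single (f : V) (D : Finset V) :
    cone f (Finsupp.single D (1 : ZMod 2)) =
      if f ∈ D then 0 else Finsupp.single (insert f D) (1 : ZMod 2) := by
  simp [cone]

lemma add_self_chain {W : Type*} (z : W →₀ ZMod 2) : z + z = 0 := by
  ext a
  simp [CharTwo.add_self_eq_zero]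

lemma double_sum {A W : Type*} [DecidableEq A] (g : Finset A → (W →₀ ZMod 2)) (D : Finset A) :
    ∑ x ∈ D, ∑ y ∈ D.erase x, g ((D.erase x).erase y) = 0 := by
  rw [Finset.sum_sigma']
  refine Finset.sum_involution (fun p _ => ⟨p.2, p.1⟩) ?_ ?_ ?_ ?_
  · rintro ⟨x, y⟩ h
    simp only
    rw [Finset.erase_right_comm]
    exact add_self_chain _
  · rintro ⟨x, y⟩ h _ heq
    simp only [Finset.mem_sigma, Finset.mem_erase] at h
    simp only [Sigma.mk.injEq] at heq
    exact h.2.1 heq.1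
  · rintro ⟨x, y⟩ h
    simp only [Finset.mem_sigma, Finset.mem_erase] at h ⊢
    tauto
  · rintro ⟨x, y⟩ h
    rfl

lemma bd_bd (D : Finset V) : bd (bd (Finsupp.single D (1 : ZMod 2))) = 0 := by
  rw [bd_single, map_sum]
  simp only [bd_single]
  exact double_sum (fun X => Finsupp.single X (1 : ZMod 2)) D

lemma bd_cone_single (f : V) (X : Finset V) :
    bd (cone f (Finsupp.single X (1 : ZMod 2))) =
      Finsupp.single X 1 + cone f (bd (Finsupp.single X 1)) := by
  by_cases hf : f ∈ X
  · rw [cone_single, if_pos hf, map_zero, bd_single, map_sum, ← Finset.add_sum_erase _ _ hf,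
      cone_single, if_neg (Finset.notMem_erase f X), Finset.insert_erase hf, Finset.sum_eq_zero,
      add_zero, add_self_chain]
    intro x hx
    rw [cone_single, if_pos]
    simp only [Finset.mem_erase] at hx ⊢
    exact ⟨fun h => hx.1 h.symm, hf⟩
  · rw [cone_single, if_neg hf, bd_single, bd_single, map_sum, Finset.sum_insert hf,
      Finset.erase_insert hf]
    congr 1
    refine Finset.sum_congr rfl fun x hx => ?_
    have hne : f ≠ x := fun h => hf (h ▸ hx)
    rw [cone_single, if_neg (by simp [hf]), Finset.erase_insert_of_ne hne]

lemma bd_cone (f : V) (z : Finset V →₀ ZMod 2) :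
    bd (cone f z) = z + cone f (bd z) := by
  have : (bd ∘ₗ cone f) = LinearMap.id + cone f ∘ₗ bd (V := V) := by
    ext1 X
    ext1
    simpa using bd_cone_single f X
  exact LinearMap.congr_fun this z

/-- The contraction. -/
noncomputable def ctr (f : Finset V → V) (D : Finset V) : Finset V →₀ ZMod 2 :=
  cone (f D) (Finsupp.single D 1 + ∑ x ∈ D.attach, ctr f (D.erase x.1))
termination_by D.card
decreasing_by exact Finset.card_erase_lt_of_mem x.2

/-- Linear extension of the contraction. -/
noncomputable def ctrl (f : Finset V → V) :
    (Finset V →₀ ZMod 2) →ₗ[ZMod 2] (Finset V →₀ ZMod 2) :=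
  Finsupp.linearCombination (ZMod 2) (ctr f)

lemma ctrl_single (f : Finset V → V) (D : Finset V) :
    ctrl f (Finsupp.single D 1) = ctr f D := by
  simp [ctrl]

lemma ctr_eq (f : Finset V → V) (D : Finset V) :
    ctr f D = cone (f D) (Finsupp.single D 1 + ∑ x ∈ D, ctr f (D.erase x)) := by
  rw [ctr, Finset.sum_attach D (fun x => ctr f (D.erase x))]

lemma bd_ctr (f : Finset V → V) (D : Finset V) :
    bd (ctr f D) = Finsupp.single D 1 + ∑ x ∈ D, ctr f (D.erase x) := by
  induction hn : D.card using Nat.strong_induction_on generalizing D with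
  | _ n ih =>
    rw [ctr_eq, bd_cone]
    have : bd (Finsupp.single D 1 + ∑ x ∈ D, ctr f (D.erase x)) = 0 := by
      rw [map_add, map_sum, bd_single]
      have h2 : ∑ x ∈ D, bd (ctr f (D.erase x)) =
          ∑ x ∈ D, (Finsupp.single (D.erase x) 1 +
            ∑ y ∈ D.erase x, ctr f ((D.erase x).erase y)) := by
        refine Finset.sum_congr rfl fun x hx => ?_
        exact ih _ (hn ▸ Finset.card_erase_lt_of_mem hx) _ rfl
      rw [h2, Finset.sum_add_distrib, double_sum, add_zero, add_self_chain]
    rw [this, map_zero, add_zero]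

lemma bd_ctrl (f : Finset V → V) (z : Finset V →₀ ZMod 2) :
    bd (ctrl f z) = z + ctrl f (bd z) := by
  have : (bd ∘ₗ ctrl f) = LinearMap.id + ctrl f ∘ₗ bd (V := V) := by
    ext1 X
    ext1
    simp only [LinearMap.comp_apply, LinearMap.add_apply, LinearMap.id_apply,
      Finsupp.lsingle_apply]
    rw [ctrl_single, bd_ctr, bd_single, map_sum]
    simp only [ctrl_single]
  exact LinearMap.congr_fun this z

lemma lc_mem {W W' : Type*} (g : W → (W' →₀ ZMod 2)) (P : Set W) (Q : Set W')
    (hg : ∀ w ∈ P, g w ∈ Finsupp.supported (ZMod 2) (ZMod 2) Q) (z : W →₀ ZMod 2)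
    (hz : z ∈ Finsupp.supported (ZMod 2) (ZMod 2) P) :
    Finsupp.linearCombination (ZMod 2) g z ∈ Finsupp.supported (ZMod 2) (ZMod 2) Q := by
  rw [Finsupp.linearCombination_apply, Finsupp.sum]
  exact Submodule.sum_mem _ fun w hw => Submodule.smul_mem _ _ (hg w (hz hw))

/-- Independent sets of vertices with colours in `σ`. -/
def In {A : Type*} (G : Set V) (c : V → A) (R : V → V → Prop) (σ : Finset A) (W : Finset V) :
    Prop :=
  (∀ x ∈ W, x ∈ G ∧ c x ∈ σ) ∧ ∀ x ∈ W, ∀ y ∈ W, x ≠ y → ¬ R x y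

lemma In.mono {A : Type*} {G : Set V} {c : V → A} {R : V → V → Prop} {σ : Finset A}
    {W W' : Finset V} (h : In G c R σ W) (hs : W' ⊆ W) : In G c R σ W' :=
  ⟨fun x hx => h.1 x (hs hx), fun x hx y hy => h.2 x (hs hx) y (hs hy)⟩

lemma In.mono_col {A : Type*} {G : Set V} {c : V → A} {R : V → V → Prop} {σ τ : Finset A}
    {W : Finset V} (h : In G c R σ W) (hs : σ ⊆ τ) : In G c R τ W :=
  ⟨fun x hx => ⟨(h.1 x hx).1, hs (h.1 x hx).2⟩, h.2⟩

lemma ctr_mem {A : Type*} {G : Set V} {c : V → A} {R : V → V → Prop} (hR : ∀ x y, R x y → R y x)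
    {σ : Finset A} (F : Finset V) (hF : In G c R σ F) (s : ℕ) (f : Finset V → V)
    (hf : ∀ D, In G c R σ D → D.card ≤ s → f D ∈ F ∧ ∀ x ∈ D, ¬ R x (f D))
    (D : Finset V) (hD : In G c R σ D) (hs : D.card ≤ s) :
    ctr f D ∈ Finsupp.supported (ZMod 2) (ZMod 2)
      {W | In G c R σ W ∧ W ⊆ D ∪ F ∧ W.card = D.card + 1} := by
  induction hn : D.card using Nat.strong_induction_on generalizing D with
  | _ n ih =>
    obtain ⟨h1, h2⟩ := hf D hD hs
    rw [ctr_eq]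
    refine lc_mem _ {W | In G c R σ W ∧ W ⊆ D ∪ F ∧ W.card = n} _ ?_ _ ?_
    · rintro W ⟨hW, hWs, hWc⟩
      split_ifs with hfW
      · exact Submodule.zero_mem _
      · refine Finsupp.single_mem_supported _ _ ?_
        have key : ∀ w ∈ W, ¬ R w (f D) := by
          intro w hw
          rcases Finset.mem_union.1 (hWs hw) with h | h
          · exact h2 w h
          · exact hF.2 w h _ h1 (fun e => hfW (e ▸ hw))
        refine ⟨⟨?_, ?_⟩, ?_, ?_⟩
        · intro x hx
          rcases Finset.mem_insert.1 hx with rfl | hx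
          · exact hF.1 _ h1
          · exact hW.1 x hx
        · intro x hx y hy hxy
          rcases Finset.mem_insert.1 hx with rfl | hx <;>
            rcases Finset.mem_insert.1 hy with rfl | hy
          · exact absurd rfl hxy
          · exact fun h => key y hy (hR _ _ h)
          · exact key x hx
          · exact hW.2 x hx y hy hxy
        · exact Finset.insert_subset (Finset.mem_union_right _ h1) hWs
        · rw [Finset.card_insert_of_notMem hfW, hWc]
    · refine Submodule.add_mem _ ?_ (Submodule.sum_mem _ fun x hx => ?_)
      · exact Finsupp.single_mem_supported _ _ ⟨hD, Finset.subset_union_left, hn⟩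
      · have hc := Finset.card_erase_of_mem hx
        have hp := Finset.card_pos.2 ⟨x, hx⟩
        have := ih (D.erase x).card (by omega) (D.erase x)
          (hD.mono (Finset.erase_subset _ _)) (by omega) rfl
        refine Finsupp.supported_mono ?_ this
        rintro W ⟨a, b, e⟩
        exact ⟨a, b.trans (Finset.union_subset_union_left (Finset.erase_subset _ _)), by omega⟩

/-- The homotopy between two full rainbow sets. -/
noncomputable def hom {A : Type*} [DecidableEq A] (c : V → A) (f : Finset A → Finset V → V)
    (M M' : Finset V) (σ : Finset A) : Finset V →₀ ZMod 2 :=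
  ctrl (f σ) (Finsupp.single (M.filter (c · ∈ σ)) 1 + Finsupp.single (M'.filter (c · ∈ σ)) 1 +
    ∑ a ∈ σ.attach, hom c f M M' (σ.erase a.1))
termination_by σ.card
decreasing_by exact Finset.card_erase_lt_of_mem a.2

lemma hom_eq {A : Type*} [DecidableEq A] (c : V → A) (f : Finset A → Finset V → V)
    (M M' : Finset V) (σ : Finset A) :
    hom c f M M' σ = ctrl (f σ) (Finsupp.single (M.filter (c · ∈ σ)) 1 +
      Finsupp.single (M'.filter (c · ∈ σ)) 1 + ∑ a ∈ σ, hom c f M M' (σ.erase a)) := by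
  rw [hom, Finset.sum_attach σ (fun a => hom c f M M' (σ.erase a))]

lemma bd_restrict {A : Type*} [DecidableEq A] (c : V → A) (M : Finset V)
    (hi : Set.InjOn c M) (hs : ∀ a, ∃ x ∈ M, c x = a) (σ : Finset A) :
    bd (Finsupp.single (M.filter (c · ∈ σ)) (1 : ZMod 2)) =
      ∑ a ∈ σ, Finsupp.single (M.filter (c · ∈ σ.erase a)) 1 := by
  rw [bd_single]
  refine Finset.sum_bij (fun x _ => c x) ?_ ?_ ?_ ?_
  · intro x hx
    exact (Finset.mem_filter.1 hx).2
  · intro x hx y hy h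
    exact hi (Finset.mem_filter.1 hx).1 (Finset.mem_filter.1 hy).1 h
  · intro a ha
    obtain ⟨x, hx, rfl⟩ := hs a
    exact ⟨x, Finset.mem_filter.2 ⟨hx, ha⟩, rfl⟩
  · intro x hx
    congr 1
    ext y
    simp only [Finset.mem_erase, Finset.mem_filter] at hx ⊢
    constructor
    · rintro ⟨h1, h2, h3⟩
      exact ⟨h2, fun h => h1 (hi h2 hx.1 h), h3⟩
    · rintro ⟨h1, h2, h3⟩
      exact ⟨fun h => h2 (h ▸ rfl), h1, h3⟩

lemma bd_hom {A : Type*} [DecidableEq A] (c : V → A) (f : Finset A → Finset V → V)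
    (M M' : Finset V) (hi : Set.InjOn c M) (hs : ∀ a, ∃ x ∈ M, c x = a)
    (hi' : Set.InjOn c M') (hs' : ∀ a, ∃ x ∈ M', c x = a) (σ : Finset A) :
    bd (hom c f M M' σ) = Finsupp.single (M.filter (c · ∈ σ)) 1 +
      Finsupp.single (M'.filter (c · ∈ σ)) 1 + ∑ a ∈ σ, hom c f M M' (σ.erase a) := by
  induction hn : σ.card using Nat.strong_induction_on generalizing σ with
  | _ n ih =>
    rw [hom_eq, bd_ctrl, map_add bd, map_add bd, bd_restrict c M hi hs, bd_restrict c M' hi' hs',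
      map_sum]
    have h2 : ∑ a ∈ σ, bd (hom c f M M' (σ.erase a)) = ∑ a ∈ σ,
        (Finsupp.single (M.filter (c · ∈ σ.erase a)) 1 +
      Finsupp.single (M'.filter (c · ∈ σ.erase a)) 1 +
        ∑ b ∈ σ.erase a, hom c f M M' ((σ.erase a).erase b)) := by
      refine Finset.sum_congr rfl fun x hx => ?_
      exact ih _ (hn ▸ Finset.card_erase_lt_of_mem hx) _ rfl
    rw [h2, Finset.sum_add_distrib, Finset.sum_add_distrib, double_sum, add_zero, add_self_chain,
      map_zero, add_zero]

lemma card_restrict {A : Type*} [DecidableEq A] (c : V → A) (M : Finset V)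
    (hi : Set.InjOn c M) (σ : Finset A) : (M.filter (c · ∈ σ)).card ≤ σ.card := by
  refine Finset.card_le_card_of_injOn c (fun x hx => (Finset.mem_filter.1 hx).2) ?_
  exact hi.mono (by intro x hx; exact (Finset.mem_filter.1 hx).1)

lemma card_restrict_eq {A : Type*} [DecidableEq A] (c : V → A) (M : Finset V)
    (hi : Set.InjOn c M) (hs : ∀ a, ∃ x ∈ M, c x = a) (σ : Finset A) :
    (M.filter (c · ∈ σ)).card = σ.card := by
  refine le_antisymm (card_restrict c M hi σ) ?_
  refine Finset.card_le_card_of_surjOn c ?_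
  intro a ha
  obtain ⟨x, hx, rfl⟩ := hs a
  exact ⟨x, Finset.mem_coe.2 (Finset.mem_filter.2 ⟨hx, ha⟩), rfl⟩

lemma hom_mem {A : Type*} [DecidableEq A] {G : Set V} {c : V → A} {R : V → V → Prop}
    (hR : ∀ x y, R x y → R y x) (F : Finset A → Finset V) (f : Finset A → Finset V → V)
    (hF : ∀ σ : Finset A, σ.Nonempty → In G c R σ (F σ))
    (hf : ∀ σ : Finset A, σ.Nonempty → ∀ D, In G c R σ D → D.card ≤ σ.card →
      f σ D ∈ F σ ∧ ∀ x ∈ D, ¬ R x (f σ D))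
    (M M' : Finset V) (hi : Set.InjOn c M) (hs : ∀ a, ∃ x ∈ M, c x = a)
    (hi' : Set.InjOn c M') (hs' : ∀ a, ∃ x ∈ M', c x = a)
    (hM : ∀ σ, In G c R σ (M.filter (c · ∈ σ))) (hM' : ∀ σ, In G c R σ (M'.filter (c · ∈ σ)))
    (σ : Finset A) :
    hom c f M M' σ ∈ Finsupp.supported (ZMod 2) (ZMod 2)
      {W | In G c R σ W ∧ W.card = σ.card + 1} := by
  induction hn : σ.card using Nat.strong_induction_on generalizing σ with
  | _ n ih =>
    rcases σ.eq_empty_or_nonempty with rfl | hne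
    · rw [hom_eq]
      simp [add_self_chain]
    rw [hom_eq]
    refine lc_mem _ {W | In G c R σ W ∧ W.card = σ.card} _ ?_ _ ?_
    · rintro W ⟨hW, hWc⟩
      refine Finsupp.supported_mono ?_ (ctr_mem hR (F σ) (hF σ hne) σ.card (f σ) (hf σ hne) W hW
        hWc.le)
      rintro X ⟨a, -, b⟩
      exact ⟨a, by omega⟩
    · refine Submodule.add_mem _ (Submodule.add_mem _ ?_ ?_) (Submodule.sum_mem _ fun a ha => ?_)
      · exact Finsupp.single_mem_supported _ _ ⟨hM σ, card_restrict_eq c M hi hs σ⟩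
      · exact Finsupp.single_mem_supported _ _ ⟨hM' σ, card_restrict_eq c M' hi' hs' σ⟩
      · have hc := Finset.card_erase_of_mem ha
        have hp := Finset.card_pos.2 ⟨a, ha⟩
        refine Finsupp.supported_mono ?_ (ih (σ.erase a).card (by omega) (σ.erase a) rfl)
        rintro X ⟨h, b⟩
        exact ⟨h.mono_col (Finset.erase_subset _ _), by omega⟩

open Classical in
/-- The parity functional. -/
noncomputable def par (Q : Finset V → Prop) : (Finset V →₀ ZMod 2) →ₗ[ZMod 2] ZMod 2 :=
  Finsupp.linearCombination (ZMod 2) (fun X => if Q X then (1 : ZMod 2) else 0)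

open Classical in
lemma par_single (Q : Finset V → Prop) (X : Finset V) :
    par Q (Finsupp.single X 1) = if Q X then 1 else 0 := by
  simp [par]

lemma lc_zero {W N : Type*} [AddCommGroup N] [Module (ZMod 2) N] (φ : (W →₀ ZMod 2) →ₗ[ZMod 2] N)
    (P : Set W) (h : ∀ w ∈ P, φ (Finsupp.single w 1) = 0) (z : W →₀ ZMod 2)
    (hz : z ∈ Finsupp.supported (ZMod 2) (ZMod 2) P) : φ z = 0 := by
  rw [Finsupp.supported_eq_span_single] at hz
  induction hz using Submodule.span_induction with
  | mem x hx => obtain ⟨w, hw, rfl⟩ := hx; exact h w hw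
  | zero => simp
  | add x y _ _ hx hy => rw [map_add, hx, hy, add_zero]
  | smul a x _ hx => rw [map_smul, hx, smul_zero]

theorem general {A : Type*} [DecidableEq A] [Fintype A] {G : Set V} {c : V → A}
    {R : V → V → Prop} (hR : ∀ x y, R x y → R y x)
    (hF : ∀ σ : Finset A, σ.Nonempty → ∃ F, In G c R σ F ∧ ∀ D, In G c R σ D → D.card ≤ σ.card →
      ∃ f ∈ F, ∀ x ∈ D, ¬ R x f)
    (S : Finset V → Prop)
    (hS : ∀ W x y, In G c R Finset.univ W → W.card = Fintype.card A + 1 → x ∈ W → y ∈ W → x ≠ y →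
      c x = c y → Set.InjOn c (W.erase x : Finset V) → Set.InjOn c (W.erase y : Finset V) →
      S (W.erase x) → S (W.erase y))
    (M M' : Finset V) (hM : In G c R Finset.univ M) (hM' : In G c R Finset.univ M')
    (hi : Set.InjOn c M) (hs : ∀ a, ∃ x ∈ M, c x = a)
    (hi' : Set.InjOn c M') (hs' : ∀ a, ∃ x ∈ M', c x = a) (hSM : S M) : S M' := by
  classical
  have hF2 : ∀ σ : Finset A, ∃ F : Finset V, σ.Nonempty → In G c R σ F ∧
      ∀ D, In G c R σ D → D.card ≤ σ.card → ∃ f ∈ F, ∀ x ∈ D, ¬ R x f := by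
    intro σ
    by_cases h : σ.Nonempty
    · obtain ⟨F, hF⟩ := hF σ h
      exact ⟨F, fun _ => hF⟩
    · exact ⟨∅, fun h' => absurd h' h⟩
  choose F hF2 using hF2
  rcases isEmpty_or_nonempty A with hA | ⟨⟨a0⟩⟩
  · have : IsEmpty V := ⟨fun v => hA.elim (c v)⟩
    have : M = M' := by ext v; exact this.elim v
    exact this ▸ hSM
  obtain ⟨v0, -, -⟩ := hs a0
  have hf : ∀ (σ : Finset A) (D : Finset V), ∃ f : V, σ.Nonempty → In G c R σ D →
      D.card ≤ σ.card → f ∈ F σ ∧ ∀ x ∈ D, ¬ R x f := by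
    intro σ D
    by_cases h : σ.Nonempty ∧ In G c R σ D ∧ D.card ≤ σ.card
    · obtain ⟨f, hf⟩ := (hF2 σ h.1).2 D h.2.1 h.2.2
      exact ⟨f, fun _ _ _ => hf⟩
    · exact ⟨v0, fun h1 h2 h3 => absurd ⟨h1, h2, h3⟩ h⟩
  choose f hf using hf
  have restr : ∀ M : Finset V, In G c R Finset.univ M → ∀ σ, In G c R σ (M.filter (c · ∈ σ)) := by
    intro M hM σ
    refine ⟨fun x hx => ?_, ?_⟩
    · rw [Finset.mem_filter] at hx
      exact ⟨(hM.1 x hx.1).1, hx.2⟩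
    · intro x hx y hy
      exact hM.2 x (Finset.mem_filter.1 hx).1 y (Finset.mem_filter.1 hy).1
  have hmem := hom_mem hR F f (fun σ h => (hF2 σ h).1) (fun σ h D h1 h2 => hf σ D h h1 h2)
    M M' hi hs hi' hs' (restr M hM) (restr M' hM')
  have hbd := bd_hom c f M M' hi hs hi' hs' Finset.univ
  set Q : Finset V → Prop := fun X => (Set.InjOn c X ∧ ∀ a, ∃ x ∈ X, c x = a) ∧ S X with hQ
  have h1 : par Q (bd (hom c f M M' Finset.univ)) = 0 := by
    refine lc_zero (par Q ∘ₗ bd) _ ?_ _ (hmem Finset.univ)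
    rintro W ⟨hW, hWc⟩
    rw [Finset.card_univ] at hWc
    rw [LinearMap.comp_apply, bd_single, map_sum]
    simp only [par_single]
    by_cases hex : ∃ x ∈ W, Q (W.erase x)
    · obtain ⟨x, hx, hQx⟩ := hex
      obtain ⟨y, hy, hyx⟩ := hQx.1.2 (c x)
      have hyW := Finset.mem_of_mem_erase hy
      have hne : y ≠ x := Finset.ne_of_mem_erase hy
      have hinj : Set.InjOn c (W.erase y : Finset V) := by
        intro u hu w hw huw
        simp only [Finset.coe_erase, Set.mem_sdiff, Finset.mem_coe, Set.mem_singleton_iff] at hu hw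
        have key : ∀ w, w ∈ W → w ≠ y → c w = c x → w = x := by
          intro w hw hwy h
          by_contra hwx
          exact hwy (hQx.1.1 (Finset.mem_coe.2 (Finset.mem_erase.2 ⟨hwx, hw⟩))
            (Finset.mem_coe.2 hy) (h.trans hyx.symm))
        by_cases hux : u = x
        · subst hux
          exact (key w hw.1 hw.2 huw.symm).symm
        · by_cases hwx : w = x
          · subst hwx
            exact key u hu.1 hu.2 huw
          · exact hQx.1.1 (Finset.mem_coe.2 (Finset.mem_erase.2 ⟨hux, hu.1⟩))
              (Finset.mem_coe.2 (Finset.mem_erase.2 ⟨hwx, hw.1⟩)) huw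
      have hQy : Q (W.erase y) := by
        refine ⟨⟨hinj, ?_⟩, hS W x y hW hWc hx hyW hne.symm hyx.symm hQx.1.1 hinj hQx.2⟩
        intro a
        obtain ⟨w, hw, hwa⟩ := hQx.1.2 a
        by_cases hwy : w = y
        · exact ⟨x, Finset.mem_erase.2 ⟨hne.symm, hx⟩, by rw [← hyx, ← hwy, hwa]⟩
        · exact ⟨w, Finset.mem_erase.2 ⟨hwy, Finset.mem_of_mem_erase hw⟩, hwa⟩
      rw [← Finset.add_sum_erase _ _ hx, ← Finset.add_sum_erase _ _ hy, if_pos hQx, if_pos hQy,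
        Finset.sum_eq_zero, add_zero]
      · exact CharTwo.add_self_eq_zero _
      · intro z hz
        simp only [Finset.mem_erase] at hz
        rw [if_neg]
        intro hQz
        refine hne (hQz.1.1 ?_ ?_ hyx)
        · exact Finset.mem_coe.2 (Finset.mem_erase.2 ⟨fun h => hz.1 h.symm, hyW⟩)
        · exact Finset.mem_coe.2 (Finset.mem_erase.2 ⟨fun h => hz.2.1 h.symm, hx⟩)
    · push Not at hex
      exact Finset.sum_eq_zero fun x hx => if_neg (hex x hx)
  rw [hbd, map_add, map_add, map_sum, Finset.sum_eq_zero (s := Finset.univ)] at h1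
  · simp only [Finset.mem_univ, Finset.filter_true, add_zero] at h1
    rw [par_single, par_single, if_pos ⟨⟨hi, hs⟩, hSM⟩] at h1
    by_contra hcon
    rw [if_neg (fun h => hcon h.2)] at h1
    simp at h1
  · intro a _
    refine lc_zero (par Q) _ ?_ _ (hmem (Finset.univ.erase a))
    rintro W ⟨hW, -⟩
    rw [par_single, if_neg]
    intro hQW
    obtain ⟨x, hx, hxa⟩ := hQW.1.2 a
    exact Finset.ne_of_mem_erase (hW.1 x hx).2 hxa

end chains

section konig

lemma half {X β γ : Type*} [DecidableEq β] [DecidableEq γ] (L : Finset X) (p : X → β) (q : X → γ)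
    (Cb : Finset β) (Cc : Finset γ) (hcov : ∀ e ∈ L, p e ∈ Cb ∨ q e ∈ Cc)
    (hmin : ∀ (Db : Finset β) (Dc : Finset γ), (∀ e ∈ L, p e ∈ Db ∨ q e ∈ Dc) →
      Cb.card + Cc.card ≤ Db.card + Dc.card) :
    ∃ h : Cb → X, (∀ b, h b ∈ L ∧ p (h b) = b.1 ∧ q (h b) ∉ Cc) ∧
      Function.Injective (fun b => q (h b)) := by
  classical
  let t : Cb → Finset γ := fun b => (L.filter (fun e => p e = b.1 ∧ q e ∉ Cc)).image q
  have hall : ∀ s : Finset Cb, s.card ≤ (s.biUnion t).card := by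
    intro s
    have hs : (s.image Subtype.val).card = s.card :=
      Finset.card_image_of_injective _ Subtype.val_injective
    have hsub : s.image Subtype.val ⊆ Cb := by
      intro b hb
      obtain ⟨b, -, rfl⟩ := Finset.mem_image.1 hb
      exact b.2
    have h1 := hmin (Cb \ s.image Subtype.val) (Cc ∪ s.biUnion t) (by
      intro e he
      by_cases hc : q e ∈ Cc
      · exact Or.inr (Finset.mem_union_left _ hc)
      have hb := (hcov e he).resolve_right hc
      by_cases hbs : p e ∈ s.image Subtype.val
      · right
        obtain ⟨b, hb, hbe⟩ := Finset.mem_image.1 hbs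
        refine Finset.mem_union_right _ (Finset.mem_biUnion.2 ⟨b, hb, ?_⟩)
        exact Finset.mem_image.2 ⟨e, Finset.mem_filter.2 ⟨he, hbe.symm, hc⟩, rfl⟩
      · exact Or.inl (Finset.mem_sdiff.2 ⟨hb, hbs⟩))
    have h2 := Finset.card_sdiff_of_subset hsub
    have h3 := Finset.card_le_card hsub
    have h4 := Finset.card_union_le Cc (s.biUnion t)
    omega
  obtain ⟨g, hg, hgt⟩ := (Finset.all_card_le_biUnion_card_iff_exists_injective t).1 hall
  have : ∀ b, ∃ e, (e ∈ L ∧ p e = b.1 ∧ q e ∉ Cc) ∧ q e = g b := by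
    intro b
    obtain ⟨e, he, heq⟩ := Finset.mem_image.1 (hgt b)
    exact ⟨e, Finset.mem_filter.1 he, heq⟩
  choose h hh using this
  refine ⟨h, fun b => (hh b).1, fun b b' hb => hg ?_⟩
  simpa [(hh b).2, (hh b').2] using hb

lemma konig {X β γ : Type*} [DecidableEq β] [DecidableEq γ] (L : Finset X)
    (p : X → β) (q : X → γ) :
    ∃ F ⊆ L, (∀ e ∈ F, ∀ f ∈ F, e ≠ f → p e ≠ p f ∧ q e ≠ q f) ∧
      ∃ (Cb : Finset β) (Cc : Finset γ), (∀ e ∈ L, p e ∈ Cb ∨ q e ∈ Cc) ∧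
        Cb.card + Cc.card ≤ F.card := by
  classical
  have hex : ∃ n, ∃ (Cb : Finset β) (Cc : Finset γ), (∀ e ∈ L, p e ∈ Cb ∨ q e ∈ Cc) ∧
      Cb.card + Cc.card = n :=
    ⟨_, L.image p, ∅, fun e he => Or.inl (Finset.mem_image_of_mem _ he), rfl⟩
  obtain ⟨Cb, Cc, hcov, hn⟩ := Nat.find_spec hex
  have hmin : ∀ (Db : Finset β) (Dc : Finset γ), (∀ e ∈ L, p e ∈ Db ∨ q e ∈ Dc) →
      Cb.card + Cc.card ≤ Db.card + Dc.card := by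
    intro Db Dc h
    rw [hn]
    exact Nat.find_min' hex ⟨Db, Dc, h, rfl⟩
  obtain ⟨h1, h1p, h1i⟩ := half L p q Cb Cc hcov hmin
  obtain ⟨h2, h2p, h2i⟩ := half L q p Cc Cb (fun e he => (hcov e he).symm)
    (fun Db Dc h => by have := hmin Dc Db (fun e he => (h e he).symm); omega)
  have i1 : Function.Injective h1 := fun a b h => h1i (by simp [h])
  have i2 : Function.Injective h2 := fun a b h => h2i (by simp [h])
  refine ⟨Finset.univ.image h1 ∪ Finset.univ.image h2, ?_, ?_, Cb, Cc, hcov, ?_⟩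
  · intro e he
    simp only [Finset.mem_union, Finset.mem_image, Finset.mem_univ, true_and] at he
    rcases he with ⟨b, rfl⟩ | ⟨b, rfl⟩
    · exact (h1p b).1
    · exact (h2p b).1
  · intro e he f hf hne
    simp only [Finset.mem_union, Finset.mem_image, Finset.mem_univ, true_and] at he hf
    rcases he with ⟨b, rfl⟩ | ⟨b, rfl⟩ <;> rcases hf with ⟨b', rfl⟩ | ⟨b', rfl⟩
    · have hb : b ≠ b' := fun h => hne (h ▸ rfl)
      refine ⟨?_, fun h => hb (h1i h)⟩
      rw [(h1p b).2.1, (h1p b').2.1]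
      exact fun h => hb (Subtype.ext h)
    · refine ⟨fun h => (h2p b').2.2 ?_, fun h => (h1p b).2.2 ?_⟩
      · rw [← h, (h1p b).2.1]; exact b.2
      · rw [h, (h2p b').2.1]; exact b'.2
    · refine ⟨fun h => (h2p b).2.2 ?_, fun h => (h1p b').2.2 ?_⟩
      · rw [h, (h1p b').2.1]; exact b'.2
      · rw [← h, (h2p b).2.1]; exact b.2
    · have hb : b ≠ b' := fun h => hne (h ▸ rfl)
      refine ⟨fun h => hb (h2i h), ?_⟩
      rw [(h2p b).2.1, (h2p b').2.1]
      exact fun h => hb (Subtype.ext h)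
  · rw [Finset.card_union_of_disjoint, Finset.card_image_of_injective _ i1,
      Finset.card_image_of_injective _ i2]
    · simp
    · rw [Finset.disjoint_left]
      intro e he hf
      simp only [Finset.mem_image, Finset.mem_univ, true_and] at he hf
      obtain ⟨b, rfl⟩ := he
      obtain ⟨b', hb'⟩ := hf
      apply (h1p b).2.2
      rw [← hb', (h2p b').2.1]
      exact b'.2

end konig

section final

variable {α β γ : Type*} [DecidableEq α] [DecidableEq β] [DecidableEq γ]

lemma TriMatching.mono {E P Y : Finset (α × β × γ)} (h : TriMatching E P) (hs : Y ⊆ P) :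
    TriMatching E Y :=
  ⟨hs.trans h.1, fun e he f hf => h.2 e (hs he) f (hs hf)⟩

lemma subsets_connected {E P : Finset (α × β × γ)} {k : ℕ} (hP : TriMatching E P)
    (Y Y' : Finset (α × β × γ)) (hY : Y ⊆ P) (hY' : Y' ⊆ P) (hc : Y.card = k) (hc' : Y'.card = k) :
    Relation.ReflTransGen (TriMatAdj E k) Y Y' := by
  induction hn : (Y \ Y').card generalizing Y with
  | zero =>
    have h1 : Y ⊆ Y' := Finset.sdiff_eq_empty_iff_subset.1 (Finset.card_eq_zero.1 hn)
    rw [Finset.eq_of_subset_of_card_le h1 (by omega)]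
  | succ n ih =>
    obtain ⟨e, he⟩ := Finset.card_pos.1 (by omega : 0 < (Y \ Y').card)
    have hcomm : (Y \ Y').card = (Y' \ Y).card := Finset.card_sdiff_comm (hc.trans hc'.symm)
    obtain ⟨f, hf⟩ := Finset.card_pos.1 (by omega : 0 < (Y' \ Y).card)
    rw [Finset.mem_sdiff] at he hf
    have hef : e ≠ f := fun h => hf.2 (h ▸ he.1)
    have hsub : insert f (Y.erase e) ⊆ P :=
      Finset.insert_subset (hY' hf.1) ((Finset.erase_subset _ _).trans hY)
    have hcard : (insert f (Y.erase e)).card = k := by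
      have hp := Finset.card_pos.2 ⟨e, he.1⟩
      rw [Finset.card_insert_of_notMem (by simp [hf.2]), Finset.card_erase_of_mem he.1]
      omega
    refine Relation.ReflTransGen.head (b := insert f (Y.erase e)) ?_ (ih _ hsub hcard ?_)
    · refine ⟨TriMatching.mono hP hY, TriMatching.mono hP hsub, hc, hcard, e, f, ?_, ?_,
        (hP.2 e (hY he.1) f (hY' hf.1) hef).2⟩
      · ext x
        simp only [Finset.mem_sdiff, Finset.mem_insert, Finset.mem_erase, Finset.mem_singleton]
        constructor
        · rintro ⟨h1, h2⟩
          by_contra h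
          exact h2 (Or.inr ⟨h, h1⟩)
        · rintro rfl
          exact ⟨he.1, by simp [hef]⟩
      · ext x
        simp only [Finset.mem_sdiff, Finset.mem_insert, Finset.mem_erase, Finset.mem_singleton]
        constructor
        · rintro ⟨h1, h2⟩
          rcases h1 with h1 | h1
          · exact h1
          · exact absurd h1.2 h2
        · rintro rfl
          exact ⟨Or.inl rfl, hf.2⟩
    · have : insert f (Y.erase e) \ Y' = (Y \ Y').erase e := by
        ext x
        simp only [Finset.mem_sdiff, Finset.mem_insert, Finset.mem_erase]
        constructor
        · rintro ⟨rfl | h1, h2⟩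
          · exact absurd hf.1 h2
          · exact ⟨h1.1, h1.2, h2⟩
        · rintro ⟨h1, h2, h3⟩
          exact ⟨Or.inr ⟨h1, h2⟩, h3⟩
      rw [this, Finset.card_erase_of_mem (Finset.mem_sdiff.2 he)]
      omega

/-- Colour of an edge or dummy. -/
def col {d : ℕ} : (α × β × γ) ⊕ (Fin d × α) → α
  | Sum.inl e => e.1
  | Sum.inr p => p.2

/-- Conflict relation. -/
def conf {d : ℕ} : (α × β × γ) ⊕ (Fin d × α) → (α × β × γ) ⊕ (Fin d × α) → Prop
  | Sum.inl e, Sum.inl f => e.2.1 = f.2.1 ∨ e.2.2 = f.2.2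
  | Sum.inr p, Sum.inr q => p.1 = q.1
  | _, _ => False

/-- Ground set. -/
def grd (d : ℕ) (E : Finset (α × β × γ)) : Set ((α × β × γ) ⊕ (Fin d × α)) :=
  {x | ∀ e, x = Sum.inl e → e ∈ E}

lemma conf_symm {d : ℕ} (x y : (α × β × γ) ⊕ (Fin d × α)) (h : conf x y) : conf y x := by
  rcases x with e | p <;> rcases y with f | q <;> simp only [conf] at h ⊢
  · rcases h with h | h
    · exact Or.inl h.symm
    · exact Or.inr h.symm
  · exact h.symm

lemma right_card {d : ℕ} {E : Finset (α × β × γ)} {σ : Finset α}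
    {W : Finset ((α × β × γ) ⊕ (Fin d × α))} (hW : In (grd d E) col conf σ W) :
    W.toRight.card ≤ d := by
  have : W.toRight.card ≤ (Finset.univ : Finset (Fin d)).card := by
    refine Finset.card_le_card_of_injOn Prod.fst (fun _ _ => Finset.mem_univ _) ?_
    intro p hp q hq h
    rw [Finset.mem_coe, Finset.mem_toRight] at hp hq
    by_contra hne
    exact hW.2 _ hp _ hq (fun h => hne (Sum.inr_injective h)) h
  simpa using this

lemma left_matching {d : ℕ} {E : Finset (α × β × γ)} {σ : Finset α}
    {W : Finset ((α × β × γ) ⊕ (Fin d × α))} (hW : In (grd d E) col conf σ W)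
    (hi : Set.InjOn col (W : Set ((α × β × γ) ⊕ (Fin d × α)))) : TriMatching E W.toLeft := by
  refine ⟨fun e he => ?_, fun e he f hf hne => ?_⟩
  · exact (hW.1 _ (Finset.mem_toLeft.1 he)).1 e rfl
  · rw [Finset.mem_toLeft] at he hf
    have hne' : (Sum.inl e : (α × β × γ) ⊕ (Fin d × α)) ≠ Sum.inl f :=
      fun h => hne (Sum.inl_injective h)
    refine ⟨fun h => hne' (hi he hf h), ?_⟩
    have := hW.2 _ he _ hf hne'
    simp only [conf, not_or] at this
    exact this

lemma swap_step {d k : ℕ} {E : Finset (α × β × γ)} {σ : Finset α}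
    {W : Finset ((α × β × γ) ⊕ (Fin d × α))} (hW : In (grd d E) col conf σ W)
    (hWc : W.card = d + k + 1) {x y : (α × β × γ) ⊕ (Fin d × α)} (hx : x ∈ W) (hy : y ∈ W)
    (hxy : x ≠ y)
    (hix : Set.InjOn col (↑(W.erase x) : Set ((α × β × γ) ⊕ (Fin d × α))))
    (hiy : Set.InjOn col (↑(W.erase y) : Set ((α × β × γ) ⊕ (Fin d × α))))
    (M : Finset (α × β × γ))
    (hS : ∃ Y ⊆ (W.erase x).toLeft, Y.card = k ∧ Relation.ReflTransGen (TriMatAdj E k) M Y) :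
    ∃ Y ⊆ (W.erase y).toLeft, Y.card = k ∧ Relation.ReflTransGen (TriMatAdj E k) M Y := by
  obtain ⟨Y, hY, hYc, hMY⟩ := hS
  have hmx := left_matching (hW.mono (Finset.erase_subset x W)) hix
  have hmy := left_matching (hW.mono (Finset.erase_subset y W)) hiy
  set Z := (W.erase x).erase y with hZ
  have hZc : Z.card + 2 = W.card := by
    have h1 := Finset.card_erase_of_mem hx
    have h2 := Finset.card_erase_of_mem (Finset.mem_erase.2 ⟨hxy.symm, hy⟩)
    have h3 := Finset.card_pos.2 ⟨y, Finset.mem_erase.2 ⟨hxy.symm, hy⟩⟩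
    rw [← hZ] at h2
    omega
  have hZx : Z ⊆ W.erase x := Finset.erase_subset _ _
  have hZy : Z ⊆ W.erase y := by rw [hZ, Finset.erase_right_comm]; exact Finset.erase_subset _ _
  have hZW : Z ⊆ W := hZx.trans (Finset.erase_subset _ _)
  have hsum := Z.card_toLeft_add_card_toRight
  have hWsum := W.card_toLeft_add_card_toRight
  have hr := right_card (hW.mono hZW)
  have hrW := right_card hW
  by_cases hk : k ≤ Z.toLeft.card
  · obtain ⟨Y', hY', hc'⟩ := Finset.exists_subset_card_eq hk
    refine ⟨Y', hY'.trans (Finset.toLeft_subset_toLeft hZy), hc', hMY.trans ?_⟩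
    exact subsets_connected hmx Y Y' hY (hY'.trans (Finset.toLeft_subset_toLeft hZx)) hYc hc'
  have hZr : Z.toRight = W.toRight :=
    Finset.eq_of_subset_of_card_le (Finset.toRight_subset_toRight hZW) (by omega)
  have hleft : ∀ w ∈ W, w ∉ Z → ∃ e, w = Sum.inl e := by
    rintro (e | p) hw hwZ
    · exact ⟨e, rfl⟩
    · exact absurd (Finset.mem_toRight.1 (hZr ▸ Finset.mem_toRight.2 hw)) hwZ
  obtain ⟨e, rfl⟩ := hleft x hx (fun h => (Finset.mem_erase.1 (hZx h)).1 rfl)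
  obtain ⟨f, rfl⟩ := hleft y hy (fun h => (Finset.mem_erase.1 (hZy h)).1 rfl)
  have hef : e ≠ f := fun h => hxy (h ▸ rfl)
  have hlx : (W.erase (Sum.inl e)).toLeft = W.toLeft.erase e := by
    ext u; simp
  have hly : (W.erase (Sum.inl f)).toLeft = W.toLeft.erase f := by
    ext u; simp
  rw [hlx] at hY hmx
  rw [hly] at hmy ⊢
  have heW : e ∈ W.toLeft := Finset.mem_toLeft.2 hx
  have hfW : f ∈ W.toLeft := Finset.mem_toLeft.2 hy
  have hWl : W.toLeft.card = k + 1 := by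
    rw [hZr] at hsum
    omega
  have hcx : (W.toLeft.erase e).card = k := by rw [Finset.card_erase_of_mem heW]; omega
  have hcy : (W.toLeft.erase f).card = k := by rw [Finset.card_erase_of_mem hfW]; omega
  have hYe : Y = W.toLeft.erase e := Finset.eq_of_subset_of_card_le hY (by omega)
  refine ⟨_, subset_rfl, hcy, hMY.tail ?_⟩
  subst hYe
  have hcf := hW.2 _ hx _ hy hxy
  simp only [conf, not_or] at hcf
  refine ⟨hmx, hmy, hcx, hcy, f, e, ?_, ?_, fun h => hcf.1 h.symm, fun h => hcf.2 h.symm⟩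
  · ext u
    simp only [Finset.mem_sdiff, Finset.mem_erase, Finset.mem_singleton]
    constructor
    · rintro ⟨⟨h1, h2⟩, h3⟩
      by_contra h
      exact h3 ⟨h, h2⟩
    · rintro rfl
      exact ⟨⟨hef.symm, hfW⟩, fun h => h.1 rfl⟩
  · ext u
    simp only [Finset.mem_sdiff, Finset.mem_erase, Finset.mem_singleton]
    constructor
    · rintro ⟨⟨h1, h2⟩, h3⟩
      by_contra h
      exact h3 ⟨h, h2⟩
    · rintro rfl
      exact ⟨⟨hef, heW⟩, fun h => h.1 rfl⟩

lemma extend [Fintype α] {d k : ℕ} {E : Finset (α × β × γ)} (hd : Fintype.card α = d + k)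
    (M : Finset (α × β × γ)) (hM : TriMatching E M) (hMc : M.card = k) :
    ∃ X : Finset ((α × β × γ) ⊕ (Fin d × α)), X.toLeft = M ∧ In (grd d E) col conf Finset.univ X ∧
      Set.InjOn col (X : Set ((α × β × γ) ⊕ (Fin d × α))) ∧ ∀ a, ∃ x ∈ X, col x = a := by
  have hinj : Set.InjOn Prod.fst (M : Set (α × β × γ)) := by
    intro e he f hf h
    by_contra hne
    exact (hM.2 e he f hf hne).1 h
  have hc : ((M.image Prod.fst)ᶜ).card = d := by
    rw [Finset.card_compl, Finset.card_image_of_injOn hinj]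
    omega
  let φ := (Finset.equivFinOfCardEq hc).symm
  refine ⟨M.disjSum (Finset.univ.image (fun i => (i, (φ i).1))), by simp, ⟨?_, ?_⟩, ?_, ?_⟩
  · intro x hx
    refine ⟨?_, Finset.mem_univ _⟩
    rintro e rfl
    exact hM.1 (Finset.inl_mem_disjSum.1 hx)
  · rintro (e | p) hx (f | q) hy hne
    · rw [Finset.inl_mem_disjSum] at hx hy
      have := hM.2 e hx f hy (fun h => hne (h ▸ rfl))
      simp only [conf, not_or]
      exact this.2
    · simp [conf]
    · simp [conf]
    · simp only [Finset.inr_mem_disjSum, Finset.mem_image, Finset.mem_univ, true_and] at hx hy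
      obtain ⟨i, rfl⟩ := hx
      obtain ⟨j, rfl⟩ := hy
      simp only [conf]
      rintro rfl
      exact hne rfl
  · have hno : ∀ e ∈ M, ∀ i, e.1 ≠ (φ i).1 := by
      intro e he i h
      exact Finset.mem_compl.1 (φ i).2 (Finset.mem_image.2 ⟨e, he, h⟩)
    rintro (e | p) hx (f | q) hy h
    · rw [Finset.mem_coe, Finset.inl_mem_disjSum] at hx hy
      rw [hinj hx hy h]
    · simp only [Finset.mem_coe, Finset.inl_mem_disjSum, Finset.inr_mem_disjSum, Finset.mem_image,
        Finset.mem_univ, true_and] at hx hy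
      obtain ⟨j, rfl⟩ := hy
      exact absurd h (hno e hx j)
    · simp only [Finset.mem_coe, Finset.inl_mem_disjSum, Finset.inr_mem_disjSum, Finset.mem_image,
        Finset.mem_univ, true_and] at hx hy
      obtain ⟨j, rfl⟩ := hx
      exact absurd h.symm (hno f hy j)
    · simp only [Finset.mem_coe, Finset.inr_mem_disjSum, Finset.mem_image,
        Finset.mem_univ, true_and] at hx hy
      obtain ⟨i, rfl⟩ := hx
      obtain ⟨j, rfl⟩ := hy
      have : i = j := φ.injective (Subtype.ext h)
      rw [this]
  · intro a
    by_cases ha : a ∈ M.image Prod.fst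
    · obtain ⟨e, he, rfl⟩ := Finset.mem_image.1 ha
      exact ⟨Sum.inl e, Finset.inl_mem_disjSum.2 he, rfl⟩
    · refine ⟨Sum.inr (φ.symm ⟨a, Finset.mem_compl.2 ha⟩, a), ?_, rfl⟩
      rw [Finset.inr_mem_disjSum, Finset.mem_image]
      exact ⟨φ.symm ⟨a, Finset.mem_compl.2 ha⟩, Finset.mem_univ _, by simp⟩

lemma hall_cond [Fintype α] {d k : ℕ} {E : Finset (α × β × γ)} (hd : Fintype.card α = d + k)
    (hτ : ∀ (Ca : Finset α) (Cb : Finset β) (Cc : Finset γ),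
      (∀ e ∈ E, e.1 ∈ Ca ∨ e.2.1 ∈ Cb ∨ e.2.2 ∈ Cc) →
      2 * k < Ca.card + Cb.card + Cc.card)
    (σ : Finset α) (hσ : σ.Nonempty) :
    ∃ F : Finset ((α × β × γ) ⊕ (Fin d × α)), In (grd d E) col conf σ F ∧
      ∀ D, In (grd d E) col conf σ D → D.card ≤ σ.card → ∃ f ∈ F, ∀ x ∈ D, ¬ conf x f := by
  obtain ⟨a0, ha0⟩ := hσ
  obtain ⟨F0, hF0, hF0i, Cb, Cc, hcov, hcard⟩ :=
    konig (E.filter (fun e => e.1 ∈ σ)) (fun e => e.2.1) (fun e => e.2.2)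
  have h1 := hτ σᶜ Cb Cc (by
    intro e he
    by_cases h : e.1 ∈ σ
    · exact Or.inr (hcov e (Finset.mem_filter.2 ⟨he, h⟩))
    · exact Or.inl (Finset.mem_compl.2 h))
  rw [Finset.card_compl] at h1
  have hσc : σ.card ≤ Fintype.card α := Finset.card_le_univ σ
  refine ⟨F0.disjSum (Finset.univ.image (fun i => (i, a0))), ⟨?_, ?_⟩, ?_⟩
  · rintro (e | p) hx
    · have := Finset.mem_filter.1 (hF0 (Finset.inl_mem_disjSum.1 hx))
      refine ⟨?_, this.2⟩
      intro e' h
      rw [← Sum.inl_injective h]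
      exact this.1
    · simp only [Finset.inr_mem_disjSum, Finset.mem_image, Finset.mem_univ, true_and] at hx
      obtain ⟨i, rfl⟩ := hx
      exact ⟨fun e h => by simp at h, ha0⟩
  · rintro (e | p) hx (f | q) hy hne
    · rw [Finset.inl_mem_disjSum] at hx hy
      have := hF0i e hx f hy (fun h => hne (h ▸ rfl))
      simp only [conf, not_or]
      exact this
    · simp [conf]
    · simp [conf]
    · simp only [Finset.inr_mem_disjSum, Finset.mem_image, Finset.mem_univ, true_and] at hx hy
      obtain ⟨i, rfl⟩ := hx
      obtain ⟨j, rfl⟩ := hy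
      simp only [conf]
      rintro rfl
      exact hne rfl
  · intro D hD hDc
    by_contra hcon
    push Not at hcon
    have hDsum := D.card_toLeft_add_card_toRight
    have hright : d ≤ D.toRight.card := by
      have : (Finset.univ : Finset (Fin d)).card ≤ D.toRight.card := by
        refine Finset.card_le_card_of_surjOn Prod.fst ?_
        intro i _
        obtain ⟨x, hx, hc⟩ := hcon (Sum.inr (i, a0)) (by simp)
        rcases x with e | p
        · simp [conf] at hc
        · exact ⟨p, Finset.mem_coe.2 (Finset.mem_toRight.2 hx), hc⟩
      simpa using this
    have hleft : F0.card ≤ 2 * D.toLeft.card := by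
      have hsub : F0 ⊆ D.toLeft.biUnion
          (fun x => F0.filter (fun f => x.2.1 = f.2.1 ∨ x.2.2 = f.2.2)) := by
        intro f hf
        obtain ⟨x, hx, hc⟩ := hcon (Sum.inl f) (by simpa using hf)
        rcases x with e | p
        · exact Finset.mem_biUnion.2 ⟨e, Finset.mem_toLeft.2 hx, Finset.mem_filter.2 ⟨hf, hc⟩⟩
        · simp [conf] at hc
      have h2 := Finset.card_biUnion_le_card_mul D.toLeft
          (fun x => F0.filter (fun f => x.2.1 = f.2.1 ∨ x.2.2 = f.2.2)) 2 (by
        intro x _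
        rw [Finset.filter_or]
        refine (Finset.card_union_le _ _).trans ?_
        have a1 : (F0.filter (fun f => x.2.1 = f.2.1)).card ≤ 1 := by
          rw [Finset.card_le_one]
          intro e he f hf
          rw [Finset.mem_filter] at he hf
          by_contra hne
          exact (hF0i e he.1 f hf.1 hne).1 (he.2.symm.trans hf.2)
        have a2 : (F0.filter (fun f => x.2.2 = f.2.2)).card ≤ 1 := by
          rw [Finset.card_le_one]
          intro e he f hf
          rw [Finset.mem_filter] at he hf
          by_contra hne
          exact (hF0i e he.1 f hf.1 hne).2 (he.2.symm.trans hf.2)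
        omega)
      have := Finset.card_le_card hsub
      omega
    omega

end final

end TriRec

/-- Reconfiguration version of Aharoni's theorem on Ryser's conjecture for 3-partite
3-graphs: if `2k < τ(H)`, i.e. every vertex cover of `H` has size more than `2k`, then
the reconfiguration graph on matchings of size `k` is connected. -/
theorem stmt_14 {α β γ : Type*} [Fintype α] [DecidableEq α] [Fintype β] [DecidableEq β]
    [Fintype γ] [DecidableEq γ]
    (E : Finset (α × β × γ)) (k : ℕ)
    (hτ : ∀ (Ca : Finset α) (Cb : Finset β) (Cc : Finset γ),
      (∀ e ∈ E, e.1 ∈ Ca ∨ e.2.1 ∈ Cb ∨ e.2.2 ∈ Cc) →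
      2 * k < Ca.card + Cb.card + Cc.card)
    (M M' : Finset (α × β × γ))
    (hM : TriMatching E M) (hMcard : M.card = k)
    (hM' : TriMatching E M') (hM'card : M'.card = k) :
    Relation.ReflTransGen (TriMatAdj E k) M M' := by
  have hk : k ≤ Fintype.card α := by
    rw [← hMcard, ← Finset.card_univ]
    refine Finset.card_le_card_of_injOn Prod.fst (fun _ _ => Finset.mem_univ _) ?_
    intro e he f hf h
    by_contra hne
    exact (hM.2 e he f hf hne).1 h
  obtain ⟨d, hd⟩ : ∃ d, Fintype.card α = d + k := ⟨Fintype.card α - k, by omega⟩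
  obtain ⟨X, hXl, hX, hXi, hXs⟩ := TriRec.extend hd M hM hMcard
  obtain ⟨X', hXl', hX', hXi', hXs'⟩ := TriRec.extend hd M' hM' hM'card
  obtain ⟨Y, hY, hYc, hr⟩ := TriRec.general TriRec.conf_symm (TriRec.hall_cond hd hτ)
    (fun X => ∃ Y ⊆ X.toLeft, Y.card = k ∧ Relation.ReflTransGen (TriMatAdj E k) M Y)
    (fun W x y hW hWc hx hy hxy _ hix hiy hS =>
      TriRec.swap_step hW (by omega) hx hy hxy hix hiy M hS)
    X X' hX hX' hXi hXs hXi' hXs' ⟨M, hXl.ge, hMcard, Relation.ReflTransGen.refl⟩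
  rw [hXl'] at hY
  rwa [Finset.eq_of_subset_of_card_le hY (by omega)] at hr
end

section
/- Let k ≥ 1 be an integer, and let G be a finite simple graph with maximum degree Δ that contains no induced copy of the star K_{1,k+1} (i.e., no vertex has k+1 pairwise nonadjacent neighbors). If 𝒱 = {V_1, …, V_n} is a partition of V(G) with |V_i| > ((2k − 1)Δ + k)/k for all i, then the reconfiguration graph RG(G, 𝒱) is connected. -/
/-- `S` is an independent set of the graph `G`. -/
def IndepSet {V : Type*} (G : SimpleGraph V) (S : Finset V) : Prop :=
  ∀ u ∈ S, ∀ v ∈ S, ¬ G.Adj u v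

/-- `S` is an independent transversal of `G` with respect to the vertex partition
`P : Fin n → Finset V`: an independent set meeting each class in exactly one vertex. -/
def IsIndepTransversal {V : Type*} [DecidableEq V] (G : SimpleGraph V) {n : ℕ}
    (P : Fin n → Finset V) (S : Finset V) : Prop :=
  IndepSet G S ∧ ∀ i, (S ∩ P i).card = 1

/-- Adjacency in the reconfiguration graph `RG(G, 𝒱)`: two independent transversals
are adjacent if their union is an independent set of cardinality `n + 1`. -/
def ITAdj {V : Type*} [DecidableEq V] (G : SimpleGraph V) {n : ℕ}
    (P : Fin n → Finset V) (S T : Finset V) : Prop :=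
  IsIndepTransversal G P S ∧ IsIndepTransversal G P T ∧
    IndepSet G (S ∪ T) ∧ (S ∪ T).card = n + 1

namespace RGaux

set_option linter.unusedSectionVars false

variable {V ι : Type*} [DecidableEq V] [DecidableEq ι]

/-- `f` picks for each colour in `J` a vertex of `W` of that colour, independently w.r.t. `H`. -/
def Valid (H : V → V → Prop) (W : Finset V) (c : V → ι) (J : Finset ι) (f : ι → V) : Prop :=
  (∀ j ∈ J, f j ∈ W ∧ c (f j) = j) ∧ ∀ a ∈ J, ∀ b ∈ J, ¬ H (f a) (f b)

/-- one reconfiguration step (possibly trivial) -/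
def Step (H : V → V → Prop) (W : Finset V) (c : V → ι) (J : Finset ι) (f g : ι → V) : Prop :=
  Valid H W c J f ∧ Valid H W c J g ∧ (∃ i, ∀ j ∈ J, j ≠ i → f j = g j) ∧
    ∀ a ∈ J, ∀ b ∈ J, ¬ H (f a) (g b)

/-- being linked by steps -/
def Conn (H : V → V → Prop) (W : Finset V) (c : V → ι) (J : Finset ι) (f g : ι → V) : Prop :=
  Relation.ReflTransGen (Step H W c J) f g

theorem Step.symm {H : V → V → Prop} (hH : ∀ u v, H u v → H v u) {W : Finset V} {c : V → ι}
    {J : Finset ι} {f g : ι → V} (h : Step H W c J f g) : Step H W c J g f := by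
  obtain ⟨h1, h2, ⟨i, h3⟩, h4⟩ := h
  exact ⟨h2, h1, ⟨i, fun j hj hji => (h3 j hj hji).symm⟩,
    fun a ha b hb hab => h4 b hb a ha (hH _ _ hab)⟩

theorem Conn.symm {H : V → V → Prop} (hH : ∀ u v, H u v → H v u) {W : Finset V} {c : V → ι}
    {J : Finset ι} {f g : ι → V} (h : Conn H W c J f g) : Conn H W c J g f := by
  induction h with
  | refl => exact Relation.ReflTransGen.refl
  | tail _ h2 ih => exact Relation.ReflTransGen.head (h2.symm hH) ih

theorem Conn.trans {H : V → V → Prop} {W : Finset V} {c : V → ι}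
    {J : Finset ι} {f g h : ι → V} (h1 : Conn H W c J f g) (h2 : Conn H W c J g h) :
    Conn H W c J f h := Relation.ReflTransGen.trans h1 h2

theorem Step.conn {H : V → V → Prop} {W : Finset V} {c : V → ι}
    {J : Finset ι} {f g : ι → V} (h1 : Step H W c J f g) : Conn H W c J f g :=
  Relation.ReflTransGen.single h1

theorem conn_map {H H' : V → V → Prop} {W W' : Finset V} {c c' : V → ι}
    {J J' : Finset ι} (φ : (ι → V) → (ι → V))
    (hφ : ∀ f g, Step H W c J f g → Conn H' W' c' J' (φ f) (φ g)) {f g : ι → V}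
    (h : Conn H W c J f g) : Conn H' W' c' J' (φ f) (φ g) := by
  induction h with
  | refl => exact Relation.ReflTransGen.refl
  | tail _ h2 ih => exact ih.trans (hφ _ _ h2)

theorem Conn.valid {H : V → V → Prop} {W : Finset V} {c : V → ι} {J : Finset ι} {f g : ι → V}
    (h : Conn H W c J f g) (hf : Valid H W c J f) : Valid H W c J g := by
  rcases Relation.ReflTransGen.cases_tail h with h | ⟨_, _, h⟩
  · rw [h]; exact hf
  · exact h.2.1

theorem conn_of_agree {H : V → V → Prop} {W : Finset V} {c : V → ι}
    {J : Finset ι} {f g : ι → V} (hf : Valid H W c J f) (h : ∀ j ∈ J, f j = g j) :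
    Conn H W c J f g := by
  by_cases hι : Nonempty ι
  · apply Step.conn
    obtain ⟨h1, h2⟩ := hf
    refine ⟨⟨h1, h2⟩, ⟨?_, ?_⟩, ⟨hι.some, fun j hj _ => h j hj⟩, ?_⟩
    · intro j hj; rw [← h j hj]; exact h1 j hj
    · intro a ha b hb; rw [← h a ha, ← h b hb]; exact h2 a ha b hb
    · intro a ha b hb; rw [← h b hb]; exact h2 a ha b hb
  · have : f = g := by
      funext i
      exact absurd ⟨i⟩ hι
    subst this
    exact Relation.ReflTransGen.refl

theorem valid_lift {G H : V → V → Prop} (hGH : ∀ u v, H u v → G u v) {W W' : Finset V}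
    {c c' : V → ι} {J : Finset ι} {f : ι → V} {i : ι} {w : V} (hi : i ∉ J) (hw : w ∈ W)
    (hcw : c w = i) (hww : ¬ H w w) (hW : W' ⊆ W) (h1 : ∀ v ∈ W', ¬ H v w)
    (h2 : ∀ v ∈ W', ¬ H w v) (hcf : ∀ j ∈ J, c (f j) = j)
    (hs : Valid G W' c' J f) :
    Valid H W c (insert i J) (Function.update f i w) := by
  obtain ⟨ha, hb⟩ := hs
  constructor
  · intro j hj
    by_cases hji : j = i
    · subst hji; simp [hw, hcw]
    · have hjJ : j ∈ J := by simpa [hji] using hj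
      simp only [Function.update_of_ne hji]
      exact ⟨hW (ha j hjJ).1, hcf j hjJ⟩
  · intro a haa b hbb
    by_cases hai : a = i <;> by_cases hbi : b = i
    · subst hai; subst hbi; simpa using hww
    · have hbJ : b ∈ J := by simpa [hbi] using hbb
      subst hai
      simpa [Function.update_of_ne hbi] using h2 _ (ha b hbJ).1
    · have haJ : a ∈ J := by simpa [hai] using haa
      subst hbi
      simpa [Function.update_of_ne hai] using h1 _ (ha a haJ).1
    · have haJ : a ∈ J := by simpa [hai] using haa
      have hbJ : b ∈ J := by simpa [hbi] using hbb
      simp only [Function.update_of_ne hai, Function.update_of_ne hbi]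
      exact fun h => hb a haJ b hbJ (hGH _ _ h)

theorem step_lift {G H : V → V → Prop} (hGH : ∀ u v, H u v → G u v) {W W' : Finset V}
    {c c' : V → ι} {J : Finset ι} {f g : ι → V} {i : ι} {w : V} (hi : i ∉ J) (hw : w ∈ W)
    (hcw : c w = i) (hww : ¬ H w w) (hW : W' ⊆ W) (h1 : ∀ v ∈ W', ¬ H v w)
    (h2 : ∀ v ∈ W', ¬ H w v) (hcf : ∀ j ∈ J, c (f j) = j) (hcg : ∀ j ∈ J, c (g j) = j)
    (hs : Step G W' c' J f g) :
    Step H W c (insert i J) (Function.update f i w) (Function.update g i w) := by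
  obtain ⟨hf, hg, ⟨l, h3⟩, h4⟩ := hs
  refine ⟨valid_lift hGH hi hw hcw hww hW h1 h2 hcf hf,
    valid_lift hGH hi hw hcw hww hW h1 h2 hcg hg, ⟨l, ?_⟩, ?_⟩
  · intro j hj hjl
    by_cases hji : j = i
    · subst hji; simp
    · have hjJ : j ∈ J := by simpa [hji] using hj
      simp only [Function.update_of_ne hji]
      exact h3 j hjJ hjl
  · intro a haa b hbb
    by_cases hai : a = i <;> by_cases hbi : b = i
    · subst hai; subst hbi; simpa using hww
    · have hbJ : b ∈ J := by simpa [hbi] using hbb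
      subst hai
      simpa [Function.update_of_ne hbi] using h2 _ (hg.1 b hbJ).1
    · have haJ : a ∈ J := by simpa [hai] using haa
      subst hbi
      simpa [Function.update_of_ne hai] using h1 _ (hf.1 a haJ).1
    · have haJ : a ∈ J := by simpa [hai] using haa
      have hbJ : b ∈ J := by simpa [hbi] using hbb
      simp only [Function.update_of_ne hai, Function.update_of_ne hbi]
      exact fun h => h4 a haJ b hbJ (hGH _ _ h)

/-- recolouring: colour `j` is merged into colour `i` -/
def recol (c : V → ι) (i j : ι) (v : V) : ι := if c v = j then i else c v

/-- cardinality bookkeeping for removing `R` -/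
theorem card_remove (W R : Finset V) (c : V → ι) (I : Finset ι) (D m : ℕ) (hR : R.card ≤ D)
    (h : D * (m + 1) < (W.filter (fun v => c v ∈ I)).card) :
    D * m < ((W \ R).filter (fun v => c v ∈ I)).card := by
  have h1 : W.filter (fun v => c v ∈ I) ⊆ ((W \ R).filter (fun v => c v ∈ I)) ∪ R := by
    intro v; simp only [Finset.mem_filter, Finset.mem_union, Finset.mem_sdiff]; tauto
  have h2 := Finset.card_le_card h1
  have h3 := Finset.card_union_le ((W \ R).filter (fun v => c v ∈ I)) R
  have : D * (m + 1) = D * m + D := by ring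
  omega

theorem filter_recol (W : Finset V) (c : V → ι) (i j : ι) (I : Finset ι) (hj : j ∉ I)
    (hij : i ≠ j) :
    W.filter (fun v => recol c i j v ∈ insert i I) =
      W.filter (fun v => c v ∈ insert i (insert j I)) := by
  ext v
  simp only [Finset.mem_filter, recol, Finset.mem_insert]
  by_cases h : c v = j
  · simp [h]
  · simp [h]

/-- abstract form of the degree hypothesis -/
def Good (G : V → V → Prop) (D : ℕ) : Prop :=
  ∀ x, ∀ A : Finset V, (∀ a ∈ A, G x a) → A.Nonempty →
    ∃ y ∈ A, ∃ R : Finset V, R.card ≤ D ∧ ∀ v, v ∈ R ↔ v ∈ A ∨ G y v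

theorem relative {G : V → V → Prop} (hsym : ∀ u v, G u v → G v u) (hirr : ∀ v, ¬ G v v)
    {D : ℕ} (hD : Good G D) [Fintype V] (n : ℕ) : ∀ (J : Finset ι), J.card = n →
    ∀ (W : Finset V) (c : V → ι) (i : ι), i ∉ J → ∀ f : ι → V, Valid G W c J f →
    (∀ I ⊆ J, D * I.card < (W.filter (fun v => c v ∈ insert i I)).card) →
    ∃ f', Conn G W c J f f' ∧ Valid G W c (insert i J) f' := by
  classical
  induction n with
  | zero =>
    intro J hJ W c i hi f hf hI
    have h0 := hI ∅ (by simp)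
    obtain ⟨x, hx⟩ := Finset.card_pos.mp (lt_of_le_of_lt (Nat.zero_le _) h0)
    have hJ : J = ∅ := Finset.card_eq_zero.mp hJ
    subst hJ
    simp at hx
    refine ⟨fun _ => x, conn_of_agree hf (by simp), ⟨by simpa using hx, ?_⟩⟩
    intro a _ b _; exact hirr _
  | succ n ih =>
    intro J hJ W c i hi f hf hI
    have h0 := hI ∅ (by simp)
    obtain ⟨x, hx⟩ := Finset.card_pos.mp (lt_of_le_of_lt (Nat.zero_le _) h0)
    have hxW : x ∈ W := by simp at hx; exact hx.1
    have hxc : c x = i := by simp at hx; exact hx.2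
    by_contra hbad
    push Not at hbad
    have key : ∀ A : Finset V, (∀ a ∈ A, G x a) →
        (∀ T, Conn G W c J f T → ∃ j ∈ J, T j ∈ A) → False := by
      intro A
      induction A using Finset.strongInduction with
      | H A ihA =>
      intro hA hmeet
      obtain ⟨j0, hj0, hfj0⟩ := hmeet f Relation.ReflTransGen.refl
      obtain ⟨y, hyA, R, hRD, hR⟩ := hD x A hA ⟨_, hfj0⟩
      have h1 := ihA (A.erase y) (Finset.erase_ssubset hyA)
        (fun a ha => hA a (Finset.mem_of_mem_erase ha))
      have h2 : ∃ T, Conn G W c J f T ∧ ∀ j ∈ J, T j ∉ A.erase y := by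
        by_contra hcon
        push Not at hcon
        exact h1 hcon
      obtain ⟨T, hT, hTA⟩ := h2
      have hTval : Valid G W c J T := by
        rcases Relation.ReflTransGen.cases_tail hT with h | ⟨_, _, h⟩
        · rw [h]; exact hf
        · exact h.2.1
      obtain ⟨j, hj, hTj⟩ := hmeet T hT
      have hTy : T j = y := by
        by_contra hne
        exact hTA j hj (Finset.mem_erase.mpr ⟨hne, hTj⟩)
      have hij : i ≠ j := fun h => hi (h ▸ hj)
      have hyW : y ∈ W := hTy ▸ (hTval.1 j hj).1
      have hyc : c y = j := hTy ▸ (hTval.1 j hj).2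
      have hJins : insert j (J.erase j) = J := Finset.insert_erase hj
      have hval' : Valid G (W \ R) (recol c i j) (J.erase j) T := by
        constructor
        · intro l hl
          obtain ⟨hlj, hlJ⟩ := Finset.mem_erase.mp hl
          obtain ⟨hw, hc⟩ := hTval.1 l hlJ
          refine ⟨?_, by simp [recol, hc, hlj]⟩
          rw [Finset.mem_sdiff, hR]
          refine ⟨hw, ?_⟩
          rintro (h | h)
          · apply hTA l hlJ
            refine Finset.mem_erase.mpr ⟨?_, h⟩
            intro h'; rw [h', hyc] at hc; exact hlj hc.symm
          · rw [← hTy] at h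
            exact hTval.2 j hj l hlJ h
        · intro a ha b hb
          exact hTval.2 a (Finset.mem_of_mem_erase ha) b (Finset.mem_of_mem_erase hb)
      obtain ⟨f', hf'c, hf'v⟩ := ih (J.erase j) (by rw [Finset.card_erase_of_mem hj]; omega)
        (W \ R) (recol c i j) i (fun h => hi (Finset.mem_of_mem_erase h)) T hval' (by
          intro I hIJ
          have hjI : j ∉ I := fun h => by simpa using hIJ h
          apply card_remove W R _ _ D _ hRD
          rw [filter_recol _ _ _ _ _ hjI hij]
          have := hI (insert j I) (by
            rw [← hJins]; exact Finset.insert_subset_insert _ hIJ)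
          rwa [Finset.card_insert_of_notMem hjI] at this)
      have hcol : ∀ g, Valid G (W \ R) (recol c i j) (J.erase j) g →
          ∀ l ∈ J.erase j, c (g l) = l := by
        intro g hg l hl
        have := (hg.1 l hl).2
        obtain ⟨hlj, hlJ⟩ := Finset.mem_erase.mp hl
        unfold recol at this
        split_ifs at this with h
        · exact absurd (this ▸ hlJ) hi
        · exact this
      have hRy : ∀ v ∈ W \ R, ¬ G v y := by
        intro v hv h
        rw [Finset.mem_sdiff, hR] at hv
        exact hv.2 (Or.inr (hsym _ _ h))
      have hRy' : ∀ v ∈ W \ R, ¬ G y v := fun v hv h => hRy v hv (hsym _ _ h)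
      have hlift : Conn G W c J (Function.update T j y) (Function.update f' j y) := by
        refine conn_map (fun g => Function.update g j y) ?_ hf'c
        intro g h hgh
        apply Step.conn
        have := step_lift (G := G) (H := G) (fun _ _ h => h) (c := c) (W := W) (w := y)
          (Finset.notMem_erase j J)
          hyW hyc (hirr _) Finset.sdiff_subset hRy hRy' (hcol g hgh.1) (hcol h hgh.2.1) hgh
        rwa [hJins] at this
      have hTT : Function.update T j y = T := by rw [← hTy]; exact Function.update_eq_self j T
      rw [hTT] at hlift
      have hT1 := hT.trans hlift
      have hf'v' : Valid G (W \ R) (recol c i j) (J.erase j) f' :=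
        ⟨fun l hl => hf'v.1 l (Finset.mem_insert_of_mem hl), fun a ha b hb =>
          hf'v.2 a (Finset.mem_insert_of_mem ha) b (Finset.mem_insert_of_mem hb)⟩
      obtain ⟨hzW, hzc⟩ := hf'v.1 i (Finset.mem_insert_self _ _)
      by_cases hz : c (f' i) = j
      · have hs : Step G W c J (Function.update f' j y) (Function.update f' j (f' i)) := by
          have hzW' := hzW
          rw [Finset.mem_sdiff] at hzW'
          have v1 := valid_lift (G := G) (H := G) (fun _ _ h => h) (c := c) (W := W) (w := y)
            (Finset.notMem_erase j J) hyW hyc (hirr _) Finset.sdiff_subset hRy hRy'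
            (hcol f' hf'v') hf'v'
          rw [hJins] at v1
          have v2 : Valid G W c J (Function.update f' j (f' i)) := by
            constructor
            · intro l hl
              by_cases hlj : l = j
              · subst hlj; simp [hzW'.1, hz]
              · simp only [Function.update_of_ne hlj]
                have hle := Finset.mem_erase.mpr ⟨hlj, hl⟩
                exact ⟨(Finset.mem_sdiff.mp (hf'v'.1 l hle).1).1, hcol f' hf'v' l hle⟩
            · have hm : ∀ l ∈ J, ∃ l' ∈ insert i (J.erase j),
                  Function.update f' j (f' i) l = f' l' := by
                intro l hl
                by_cases hlj : l = j
                · exact ⟨i, Finset.mem_insert_self _ _, by simp [hlj]⟩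
                · exact ⟨l, Finset.mem_insert_of_mem (Finset.mem_erase.mpr ⟨hlj, hl⟩),
                    by simp [hlj]⟩
              intro a ha b hb
              obtain ⟨a', ha', ea⟩ := hm a ha
              obtain ⟨b', hb', eb⟩ := hm b hb
              rw [ea, eb]; exact hf'v.2 a' ha' b' hb'
          refine ⟨v1, v2, ⟨j, fun l _ hlj => by simp [hlj]⟩, ?_⟩
          intro a ha b hb
          by_cases haj : a = j
          · subst haj
            by_cases hba : b = a
            · subst hba; simpa using hRy' _ hzW
            · simp only [Function.update_self, Function.update_of_ne hba]
              exact hRy' _ (hf'v'.1 b (Finset.mem_erase.mpr ⟨hba, hb⟩)).1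
          · have := v2.2 a ha b hb
            simp only [Function.update_of_ne haj] at this ⊢
            exact this
        obtain ⟨l, hl, hlA⟩ := hmeet _ (hT1.trans hs.conn)
        have hno : ∀ v ∈ W \ R, v ∉ A := by
          intro v hv h
          rw [Finset.mem_sdiff, hR] at hv
          exact hv.2 (Or.inl h)
        by_cases hlj : l = j
        · subst hlj
          simp only [Function.update_self] at hlA
          exact hno _ hzW hlA
        · simp only [Function.update_of_ne hlj] at hlA
          exact hno _ (hf'v'.1 l (Finset.mem_erase.mpr ⟨hlj, hl⟩)).1 hlA
      · apply hbad _ hT1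
        have hzi : c (f' i) = i := by simpa [recol, hz] using hzc
        have := valid_lift (G := G) (H := G) (fun _ _ h => h) (c := c) (W := W) (w := y)
            (J := insert i (J.erase j)) (i := j) (by simp [hij.symm])
            hyW hyc (hirr _) Finset.sdiff_subset hRy hRy'
            (by
              intro l hl
              rcases Finset.mem_insert.mp hl with h | h
              · rw [h]; exact hzi
              · exact hcol f' hf'v' l h) hf'v
        rwa [Finset.insert_comm, hJins] at this
    refine key (Finset.univ.filter (fun v => G x v)) (by simp) ?_
    intro T hT
    have hTval : Valid G W c J T := by
      rcases Relation.ReflTransGen.cases_tail hT with h | ⟨_, _, h⟩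
      · rw [h]; exact hf
      · exact h.2.1
    by_contra hcon
    push Not at hcon
    simp only [Finset.mem_filter, Finset.mem_univ, true_and] at hcon
    have hupd : ∀ l ∈ J, Function.update T i x l = T l := by
      intro l hl
      have : l ≠ i := fun h => hi (h ▸ hl)
      simp [this]
    apply hbad (Function.update T i x)
      (hT.trans (conn_of_agree hTval (fun l hl => (hupd l hl).symm)))
    constructor
    · intro l hl
      rcases Finset.mem_insert.mp hl with h | h
      · subst h; simp [hxW, hxc]
      · rw [hupd l h]; exact hTval.1 l h
    · intro a ha b hb
      rcases Finset.mem_insert.mp ha with h | h <;> rcases Finset.mem_insert.mp hb with h' | h'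
      · subst h; subst h'; exact hirr _
      · rw [hupd b h', h, Function.update_self]; exact hcon b h'
      · rw [hupd a h, h', Function.update_self]; exact fun hh => hcon a h (hsym _ _ hh)
      · rw [hupd a h, hupd b h']
        have hab := hTval.2 a h b h'
        exact hab

/-- the graph `G` where only the neighbours of `x` in `A` are kept -/
def del (G : V → V → Prop) (x : V) (A : Finset V) (u v : V) : Prop :=
  G u v ∧ (u = x → v ∈ A) ∧ (v = x → u ∈ A)

theorem del_symm {G : V → V → Prop} (hsym : ∀ u v, G u v → G v u) (x : V) (A : Finset V) :
    ∀ u v, del G x A u v → del G x A v u := fun _ _ h => ⟨hsym _ _ h.1, h.2.2, h.2.1⟩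

theorem del_erase {G : V → V → Prop} {x y : V} {A : Finset V} {u v : V} (h : del G x A u v) :
    del G x (A.erase y) u v ∨ (u = x ∧ v = y) ∨ (u = y ∧ v = x) := by
  by_cases h1 : u = x ∧ v = y
  · exact Or.inr (Or.inl h1)
  by_cases h2 : u = y ∧ v = x
  · exact Or.inr (Or.inr h2)
  left
  refine ⟨h.1, fun hu => Finset.mem_erase.mpr ⟨fun hv => h1 ⟨hu, hv⟩, h.2.1 hu⟩,
    fun hv => Finset.mem_erase.mpr ⟨fun hu => h2 ⟨hu, hv⟩, h.2.2 hv⟩⟩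

/-- put `a` at `i`, `b` at `j` -/
def mk (i j : ι) (a b : V) (U : ι → V) : ι → V := Function.update (Function.update U j b) i a

theorem mk_i (i j : ι) (a b : V) (U : ι → V) : mk i j a b U i = a := by simp [mk]

theorem mk_j {i j : ι} (hij : i ≠ j) (a b : V) (U : ι → V) : mk i j a b U j = b := by
  simp [mk, hij.symm]

theorem mk_o {i j l : ι} (hi : l ≠ i) (hj : l ≠ j) (a b : V) (U : ι → V) :
    mk i j a b U l = U l := by
  simp [mk, hi, hj]

theorem step_mk {H : V → V → Prop} {W : Finset V} {c : V → ι} {J : Finset ι} {i j : ι}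
    (hij : i ≠ j) (X : V → Prop) (hX : ∀ p q, X p → X q → ¬ H p q)
    {a a' b b' : V} {U U' : ι → V}
    (ha : X a ∧ a ∈ W ∧ c a = i) (ha' : X a' ∧ a' ∈ W ∧ c a' = i)
    (hb : X b ∧ b ∈ W ∧ c b = j) (hb' : X b' ∧ b' ∈ W ∧ c b' = j)
    (hU : ∀ l ∈ J, l ≠ i → l ≠ j → X (U l) ∧ U l ∈ W ∧ c (U l) = l)
    (hU' : ∀ l ∈ J, l ≠ i → l ≠ j → X (U' l) ∧ U' l ∈ W ∧ c (U' l) = l)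
    (e : ι) (hei : e ≠ i → a = a') (hej : e ≠ j → b = b')
    (heo : ∀ l ∈ J, l ≠ i → l ≠ j → l ≠ e → U l = U' l) :
    Step H W c J (mk i j a b U) (mk i j a' b' U') := by
  have key : ∀ {a b : V} {U : ι → V}, (X a ∧ a ∈ W ∧ c a = i) → (X b ∧ b ∈ W ∧ c b = j) →
      (∀ l ∈ J, l ≠ i → l ≠ j → X (U l) ∧ U l ∈ W ∧ c (U l) = l) →
      ∀ l ∈ J, X (mk i j a b U l) ∧ mk i j a b U l ∈ W ∧ c (mk i j a b U l) = l := by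
    intro a b U ha hb hU l hl
    by_cases h1 : l = i
    · subst h1; rw [mk_i]; exact ha
    by_cases h2 : l = j
    · subst h2; rw [mk_j hij]; exact hb
    rw [mk_o h1 h2]; exact hU l hl h1 h2
  have k1 := key ha hb hU
  have k2 := key ha' hb' hU'
  refine ⟨⟨fun l hl => (k1 l hl).2, fun p hp q hq => hX _ _ (k1 p hp).1 (k1 q hq).1⟩,
    ⟨fun l hl => (k2 l hl).2, fun p hp q hq => hX _ _ (k2 p hp).1 (k2 q hq).1⟩,
    ⟨e, ?_⟩, fun p hp q hq => hX _ _ (k1 p hp).1 (k2 q hq).1⟩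
  intro l hl hle
  by_cases h1 : l = i
  · subst h1; rw [mk_i, mk_i]; exact hei hle.symm
  by_cases h2 : l = j
  · subst h2; rw [mk_j hij, mk_j hij]; exact hej hle.symm
  rw [mk_o h1 h2, mk_o h1 h2]; exact heo l hl h1 h2 hle

/-- un-merging a transversal of the merged instance -/
def phi (c : V → ι) (i j : ι) (x y : V) (w : ι → V) : ι → V :=
  if c (w i) = i then mk i j (w i) y w else mk i j x (w i) w

theorem phi_conn {G H : V → V → Prop} (hGH : ∀ u v, H u v → G u v)
    (hsymH : ∀ u v, H u v → H v u) (hirr : ∀ v, ¬ H v v)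
    {W W' : Finset V} (hW : W' ⊆ W) {c : V → ι} {i j : ι} {J : Finset ι} (hij : i ≠ j)
    (hi : i ∉ J) {x y : V}
    (hxW : x ∈ W) (hxc : c x = i) (hyW : y ∈ W) (hyc : c y = j)
    (hx : ∀ v ∈ W', ¬ H v x) (hy : ∀ v ∈ W', ¬ H v y) {w1 w2 : ι → V}
    (hs : Step G W' (recol c i j) (insert i (J.erase j)) w1 w2) :
    Conn H W c (insert i J) (phi c i j x y w1) (phi c i j x y w2) := by
  obtain ⟨⟨h1, h1'⟩, ⟨h2, h2'⟩, ⟨e, he⟩, h4⟩ := hs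
  set K' := insert i (J.erase j) with hK'
  have hiK : i ∈ K' := Finset.mem_insert_self _ _
  have hjK : j ∉ K' := by simp [hK', hij.symm]
  have hX : ∀ z, (∀ v ∈ W', ¬ H v z) → ∀ p q, (p = z ∨ ∃ l ∈ K', p = w1 l ∨ p = w2 l) →
      (q = z ∨ ∃ l ∈ K', q = w1 l ∨ q = w2 l) → ¬ H p q := by
    intro z hz p q hp hq
    have hmem : ∀ p, (∃ l ∈ K', p = w1 l ∨ p = w2 l) → p ∈ W' := by
      rintro p ⟨l, hl, rfl | rfl⟩
      · exact (h1 l hl).1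
      · exact (h2 l hl).1
    rcases hp with rfl | hp
    · rcases hq with rfl | hq
      · exact hirr _
      · exact fun h => hz q (hmem q hq) (hsymH _ _ h)
    · rcases hq with rfl | hq
      · exact hz p (hmem p hp)
      · obtain ⟨l, hl, rfl | rfl⟩ := hp <;> obtain ⟨m, hm, rfl | rfl⟩ := hq
        · exact fun h => h1' l hl m hm (hGH _ _ h)
        · exact fun h => h4 l hl m hm (hGH _ _ h)
        · exact fun h => h4 m hm l hl (hGH _ _ (hsymH _ _ h))
        · exact fun h => h2' l hl m hm (hGH _ _ h)
  have hoK : ∀ l ∈ insert i J, l ≠ i → l ≠ j → l ∈ K' := by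
    intro l hl hli hlj
    simp only [Finset.mem_insert, hli, false_or] at hl
    simp [hK', hl, hlj]
  have hcol : ∀ v l, l ≠ i → recol c i j v = l → c v = l := by
    intro v l hl h
    unfold recol at h
    split_ifs at h
    · exact absurd h.symm hl
    · exact h
  have hcoli : ∀ v, recol c i j v = i → c v ≠ i → c v = j := by
    intro v h h'
    unfold recol at h
    split_ifs at h with h3
    · exact h3
    · exact absurd h h'
  have hU1 : ∀ z, ∀ l ∈ insert i J, l ≠ i → l ≠ j →
      (w1 l = z ∨ ∃ m ∈ K', w1 l = w1 m ∨ w1 l = w2 m) ∧ w1 l ∈ W ∧ c (w1 l) = l := by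
    intro z l hl hli hlj
    have := hoK l hl hli hlj
    exact ⟨Or.inr ⟨l, this, Or.inl rfl⟩, hW (h1 l this).1, hcol _ _ hli (h1 l this).2⟩
  have hU2 : ∀ z, ∀ l ∈ insert i J, l ≠ i → l ≠ j →
      (w2 l = z ∨ ∃ m ∈ K', w2 l = w1 m ∨ w2 l = w2 m) ∧ w2 l ∈ W ∧ c (w2 l) = l := by
    intro z l hl hli hlj
    have := hoK l hl hli hlj
    exact ⟨Or.inr ⟨l, this, Or.inr rfl⟩, hW (h2 l this).1, hcol _ _ hli (h2 l this).2⟩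
  have hm1 : ∀ z, (w1 i = z ∨ ∃ m ∈ K', w1 i = w1 m ∨ w1 i = w2 m) :=
    fun z => Or.inr ⟨i, hiK, Or.inl rfl⟩
  have hm2 : ∀ z, (w2 i = z ∨ ∃ m ∈ K', w2 i = w1 m ∨ w2 i = w2 m) :=
    fun z => Or.inr ⟨i, hiK, Or.inr rfl⟩
  have hw1 := hW (h1 i hiK).1
  have hw2 := hW (h2 i hiK).1
  by_cases c1 : c (w1 i) = i <;> by_cases c2 : c (w2 i) = i
  · simp only [phi, c1, c2, if_true]
    apply Step.conn
    exact step_mk hij _ (hX y hy) ⟨hm1 y, hw1, c1⟩ ⟨hm2 y, hw2, c2⟩ ⟨Or.inl rfl, hyW, hyc⟩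
      ⟨Or.inl rfl, hyW, hyc⟩ (hU1 y) (hU2 y) e (fun h => he i hiK h.symm) (fun _ => rfl)
      (fun l hl hli hlj hle => he l (hoK l hl hli hlj) hle)
  · have c2' := hcoli _ (h2 i hiK).2 c2
    have hei : i = e := by
      by_contra h
      exact c2 (he i hiK h ▸ c1)
    subst hei
    simp only [phi, c1, c2, if_true, if_false]
    refine Conn.trans (g := mk i j (w1 i) (w2 i) w1) (Step.conn ?_) (Step.conn ?_)
    · exact step_mk hij _ (hX y hy) ⟨hm1 y, hw1, c1⟩ ⟨hm1 y, hw1, c1⟩ ⟨Or.inl rfl, hyW, hyc⟩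
        ⟨hm2 y, hw2, c2'⟩ (hU1 y) (hU1 y) j (fun _ => rfl) (fun h => absurd rfl h)
        (fun l hl hli hlj hle => rfl)
    · exact step_mk hij _ (hX x hx) ⟨hm1 x, hw1, c1⟩ ⟨Or.inl rfl, hxW, hxc⟩ ⟨hm2 x, hw2, c2'⟩
        ⟨hm2 x, hw2, c2'⟩ (hU1 x) (hU2 x) i (fun h => absurd rfl h) (fun _ => rfl)
        (fun l hl hli hlj hle => he l (hoK l hl hli hlj) hle)
  · have c1' := hcoli _ (h1 i hiK).2 c1
    have hei : i = e := by
      by_contra h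
      exact c1 (he i hiK h ▸ c2)
    subst hei
    simp only [phi, c1, c2, if_true, if_false]
    refine Conn.trans (g := mk i j (w2 i) (w1 i) w1) (Step.conn ?_) (Step.conn ?_)
    · exact step_mk hij _ (hX x hx) ⟨Or.inl rfl, hxW, hxc⟩ ⟨hm2 x, hw2, c2⟩ ⟨hm1 x, hw1, c1'⟩
        ⟨hm1 x, hw1, c1'⟩ (hU1 x) (hU1 x) i (fun h => absurd rfl h) (fun _ => rfl)
        (fun l hl hli hlj hle => rfl)
    · exact step_mk hij _ (hX y hy) ⟨hm2 y, hw2, c2⟩ ⟨hm2 y, hw2, c2⟩ ⟨hm1 y, hw1, c1'⟩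
        ⟨Or.inl rfl, hyW, hyc⟩ (hU1 y) (hU2 y) j (fun _ => rfl) (fun h => absurd rfl h)
        (fun l hl hli hlj hle => he l (hoK l hl hli hlj) (by exact hli))
  · have c1' := hcoli _ (h1 i hiK).2 c1
    have c2' := hcoli _ (h2 i hiK).2 c2
    simp only [phi, c1, c2, if_false]
    apply Step.conn
    by_cases hei : i = e
    · exact step_mk hij _ (hX x hx) ⟨Or.inl rfl, hxW, hxc⟩ ⟨Or.inl rfl, hxW, hxc⟩
        ⟨hm1 x, hw1, c1'⟩ ⟨hm2 x, hw2, c2'⟩ (hU1 x) (hU2 x) j (fun _ => rfl)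
        (fun h => absurd rfl h)
        (fun l hl hli hlj hle => he l (hoK l hl hli hlj) (hei ▸ hli))
    · exact step_mk hij _ (hX x hx) ⟨Or.inl rfl, hxW, hxc⟩ ⟨Or.inl rfl, hxW, hxc⟩
        ⟨hm1 x, hw1, c1'⟩ ⟨hm2 x, hw2, c2'⟩ (hU1 x) (hU2 x) e (fun _ => rfl)
        (fun _ => he i hiK hei)
        (fun l hl hli hlj hle => he l (hoK l hl hli hlj) hle)

theorem del_of_ne {G : V → V → Prop} {x : V} {A : Finset V} {u v : V} (h : G u v) (hu : u ≠ x)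
    (hv : v ≠ x) : del G x A u v := ⟨h, fun h => absurd h hu, fun h => absurd h hv⟩

theorem notMem_R {G : V → V → Prop} {x y : V} {A R : Finset V}
    (hA : ∀ a ∈ A, G x a) (hR : ∀ v, v ∈ R ↔ v ∈ A ∨ G y v) (hxy : y ≠ x) {v : V}
    (hvx : v ≠ x) (hvy : v ≠ y) (h1 : ¬ del G x (A.erase y) x v)
    (h2 : ¬ del G x (A.erase y) y v) : v ∉ R := by
  rw [hR]
  rintro (h | h)
  · exact h1 ⟨hA v h, fun _ => Finset.mem_erase.mpr ⟨hvy, h⟩, fun h' => absurd h' hvx⟩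
  · exact h2 (del_of_ne h hxy hvx)

/-- the case where `y` has the same colour as `x` -/
theorem same_case {G : V → V → Prop} (hsym : ∀ u v, G u v → G v u) (hirr : ∀ v, ¬ G v v)
    {W : Finset V} {c : V → ι} {i : ι} {J : Finset ι} (hi : i ∉ J) {x y : V}
    {A R : Finset V} (hA : ∀ a ∈ A, G x a) (hyA : y ∈ A)
    (hR : ∀ v, v ∈ R ↔ v ∈ A ∨ G y v)
    (hxW : x ∈ W) (hxc : c x = i) (hyW : y ∈ W) (hyc : c y = i)
    (hrel : ∀ f, Valid G (W \ R) c J f →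
      ∃ f', Conn G (W \ R) c J f f' ∧ Valid G (W \ R) c (insert i J) f')
    {f g : ι → V} (hs : Step (del G x (A.erase y)) W c (insert i J) f g) :
    Conn (del G x A) W c (insert i J) f g := by
  have hxy : y ≠ x := fun h => hirr x (h ▸ hA y hyA)
  have hsd := del_symm hsym x A
  have hval : ∀ f, Valid (del G x (A.erase y)) W c (insert i J) f →
      Valid (del G x A) W c (insert i J) f := by
    intro f hf
    refine ⟨hf.1, fun a ha b hb h => ?_⟩
    rcases del_erase (y := y) h with h | ⟨h1, h2⟩ | ⟨h1, h2⟩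
    · exact hf.2 a ha b hb h
    · have ea := (hf.1 a ha).2
      have eb := (hf.1 b hb).2
      rw [h1, hxc] at ea; rw [h2, hyc] at eb
      subst eb; subst ea
      exact hxy (h2.symm.trans h1)
    · have ea := (hf.1 a ha).2
      have eb := (hf.1 b hb).2
      rw [h1, hyc] at ea; rw [h2, hxc] at eb
      subst eb; subst ea
      exact hxy (h1.symm.trans h2)
  have hins : i ∈ insert i J := Finset.mem_insert_self _ _
  have main : ∀ f g, Step (del G x (A.erase y)) W c (insert i J) f g → f i = x → g i = y →
      Conn (del G x A) W c (insert i J) f g := by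
    intro f g hs hfi hgi
    obtain ⟨hf, hg, ⟨e, he⟩, hc⟩ := hs
    have hei : i = e := by
      by_contra h
      have := he i hins h
      rw [hfi, hgi] at this
      exact hxy this.symm
    subst hei
    have hne : ∀ l ∈ J, l ≠ i := fun l hl h => hi (h ▸ hl)
    have hl' : ∀ l ∈ J, f l ≠ x ∧ f l ≠ y := by
      intro l hl
      have := (hf.1 l (Finset.mem_insert_of_mem hl)).2
      constructor
      · intro h; rw [h, hxc] at this; exact hne l hl this.symm
      · intro h; rw [h, hyc] at this; exact hne l hl this.symm
    have hv : Valid G (W \ R) c J f := by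
      constructor
      · intro l hl
        have hlI := Finset.mem_insert_of_mem (a := l) (b := i) hl
        obtain ⟨h1, h2⟩ := hf.1 l hlI
        refine ⟨Finset.mem_sdiff.mpr ⟨h1, ?_⟩, h2⟩
        refine notMem_R hA hR hxy (hl' l hl).1 (hl' l hl).2 ?_ ?_
        · have := hf.2 i hins l hlI
          rwa [hfi] at this
        · have := hg.2 i hins l hlI
          rwa [hgi, ← he l hlI (hne l hl)] at this
      · intro a ha b hb h
        exact hf.2 a (Finset.mem_insert_of_mem ha) b (Finset.mem_insert_of_mem hb)
          (del_of_ne h (hl' a ha).1 (hl' b hb).1)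
    obtain ⟨f', hff', hf'⟩ := hrel f hv
    have hRx : ∀ v ∈ W \ R, ¬ del G x A v x := by
      intro v hv h
      rw [Finset.mem_sdiff, hR] at hv
      exact hv.2 (Or.inl (h.2.2 rfl))
    have hRy : ∀ v ∈ W \ R, ¬ del G x A v y := by
      intro v hv h
      rw [Finset.mem_sdiff, hR] at hv
      exact hv.2 (Or.inr (hsym _ _ h.1))
    have lift : ∀ z ∈ W, c z = i → (∀ v ∈ W \ R, ¬ del G x A v z) →
        Conn (del G x A) W c (insert i J) (Function.update f i z) (Function.update f' i z) := by
      intro z hz hzc hzR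
      refine conn_map (fun g => Function.update g i z) ?_ hff'
      intro p q hpq
      exact (step_lift (G := G) (H := del G x A) (fun _ _ h => h.1) hi hz hzc
        (fun h => hirr _ h.1) Finset.sdiff_subset hzR (fun v hv h => hzR v hv (hsd _ _ h))
        (fun l hl => (hpq.1.1 l hl).2) (fun l hl => (hpq.2.1.1 l hl).2) hpq).conn
    have hf'J : Valid G (W \ R) c J f' := hff'.valid hv
    have hf'H : Valid (del G x A) W c (insert i J) f' :=
      ⟨fun l hl => ⟨Finset.sdiff_subset (hf'.1 l hl).1, (hf'.1 l hl).2⟩,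
        fun a ha b hb h => hf'.2 a ha b hb h.1⟩
    have sw : ∀ z ∈ W, c z = i → (∀ v ∈ W \ R, ¬ del G x A v z) →
        Conn (del G x A) W c (insert i J) (Function.update f' i z) f' := by
      intro z hz hzc hzR
      apply Step.conn
      refine ⟨valid_lift (G := G) (fun _ _ h => h.1) hi hz hzc
        (fun h => hirr _ h.1) Finset.sdiff_subset hzR (fun v hv h => hzR v hv (hsd _ _ h))
        (fun l hl => (hf'J.1 l hl).2) hf'J, hf'H, ⟨i, fun l hl hli => by simp [hli]⟩, ?_⟩
      intro a ha b hb
      by_cases hai : a = i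
      · subst hai
        rw [Function.update_self]
        exact fun h => hzR _ (hf'.1 b hb).1 (hsd _ _ h)
      · rw [Function.update_of_ne hai]
        exact hf'H.2 a ha b hb
    have e1 : Function.update f i x = f := by rw [← hfi]; exact Function.update_eq_self i f
    have p1 := (lift x hxW hxc hRx).trans (sw x hxW hxc hRx)
    have p2 := ((lift y hyW hyc hRy).trans (sw y hyW hyc hRy)).symm hsd
    rw [e1] at p1
    refine (p1.trans p2).trans ((conn_of_agree (hval g hg) ?_).symm hsd)
    intro l hl
    by_cases hli : l = i
    · subst hli; simp [hgi]
    · rw [Function.update_of_ne hli]; exact (he l hl hli).symm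
  by_cases h1 : f i = x ∧ g i = y
  · exact main f g hs h1.1 h1.2
  by_cases h2 : f i = y ∧ g i = x
  · exact (main g f (hs.symm (del_symm hsym x _)) h2.2 h2.1).symm hsd
  apply Step.conn
  obtain ⟨hf, hg, he, hc⟩ := hs
  refine ⟨hval f hf, hval g hg, he, ?_⟩
  intro a ha b hb h
  have ea := (hf.1 a ha).2
  have eb := (hg.1 b hb).2
  rcases del_erase (y := y) h with h | ⟨h3, h4⟩ | ⟨h3, h4⟩
  · exact hc a ha b hb h
  · rw [h3, hxc] at ea; rw [h4, hyc] at eb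
    subst ea; subst eb
    exact h1 ⟨h3, h4⟩
  · rw [h3, hyc] at ea; rw [h4, hxc] at eb
    subst ea; subst eb
    exact h2 ⟨h3, h4⟩

theorem exit_case {G : V → V → Prop} (hsym : ∀ u v, G u v → G v u) (hirr : ∀ v, ¬ G v v)
    {W : Finset V} {c : V → ι} {i j : ι} {J : Finset ι} (hi : i ∉ J) (hj : j ∈ J) {x y : V}
    {A R : Finset V} (hA : ∀ a ∈ A, G x a) (hyA : y ∈ A)
    (hR : ∀ v, v ∈ R ↔ v ∈ A ∨ G y v)
    (hxc : c x = i) (hyc : c y = j)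
    (hval : ∀ f, Valid (del G x (A.erase y)) W c (insert i J) f → ¬ (f i = x ∧ f j = y) →
      Valid (del G x A) W c (insert i J) f)
    {T T' : ι → V} (hs : Step (del G x (A.erase y)) W c (insert i J) T T')
    (hT : T i = x ∧ T j = y) (hT' : ¬ (T' i = x ∧ T' j = y)) :
    ∃ w, Valid G (W \ R) (recol c i j) (insert i (J.erase j)) w ∧
      Conn (del G x A) W c (insert i J) T' (phi c i j x y w) ∧
      Conn G (W \ R) (recol c i j) (J.erase j) w T := by
  have hxy : y ≠ x := fun h => hirr x (h ▸ hA y hyA)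
  have hij : i ≠ j := fun h => hi (h ▸ hj)
  have hsd := del_symm hsym x (A.erase y)
  obtain ⟨hf, hg, ⟨e, he⟩, hc⟩ := hs
  have hiI : i ∈ insert i J := Finset.mem_insert_self _ _
  have hjI : j ∈ insert i J := Finset.mem_insert_of_mem hj
  have hJI : ∀ l ∈ J.erase j, l ∈ insert i J ∧ l ≠ i ∧ l ≠ j := by
    intro l hl
    obtain ⟨h1, h2⟩ := Finset.mem_erase.mp hl
    exact ⟨Finset.mem_insert_of_mem h2, fun h => hi (h ▸ h2), h1⟩
  have hT'v := hval T' hg hT'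
  have hnR : ∀ l ∈ insert i J, T' l ≠ x → T' l ≠ y → T' l ∈ W \ R := by
    intro l hl h1 h2
    refine Finset.mem_sdiff.mpr ⟨(hg.1 l hl).1, notMem_R hA hR hxy h1 h2 ?_ ?_⟩
    · have := hc i hiI l hl
      rwa [hT.1] at this
    · have := hc j hjI l hl
      rwa [hT.2] at this
  have hlne : ∀ l ∈ J.erase j, T' l ≠ x ∧ T' l ≠ y := by
    intro l hl
    obtain ⟨h1, h2, h3⟩ := hJI l hl
    have := (hg.1 l h1).2
    constructor
    · intro h; rw [h, hxc] at this; exact h2 this.symm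
    · intro h; rw [h, hyc] at this; exact h3 this.symm
  have hother : ∀ w : ι → V, (∀ l ∈ J.erase j, w l = T' l) →
      (∃ m ∈ insert i J, w i = T' m ∧ T' m ≠ x ∧ T' m ≠ y ∧ recol c i j (T' m) = i) →
      Valid G (W \ R) (recol c i j) (insert i (J.erase j)) w := by
    rintro w hw ⟨m, hm, hwm, hmx, hmy, hmc⟩
    have hmem : ∀ l ∈ insert i (J.erase j), ∃ l' ∈ insert i J, w l = T' l' ∧ T' l' ≠ x ∧
        T' l' ≠ y ∧ recol c i j (T' l') = l := by
      intro l hl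
      rcases Finset.mem_insert.mp hl with h | h
      · subst h; exact ⟨m, hm, hwm, hmx, hmy, hmc⟩
      · obtain ⟨h1, h2, h3⟩ := hJI l h
        exact ⟨l, h1, hw l h, (hlne l h).1, (hlne l h).2, by simp [recol, (hg.1 l h1).2, h3]⟩
    constructor
    · intro l hl
      obtain ⟨l', hl', e1, e2, e3, e4⟩ := hmem l hl
      rw [e1]; exact ⟨hnR l' hl' e2 e3, e4⟩
    · intro a ha b hb h
      obtain ⟨a', ha', a1, a2, -, -⟩ := hmem a ha
      obtain ⟨b', hb', b1, b2, -, -⟩ := hmem b hb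
      rw [a1, b1] at h
      exact hg.2 a' ha' b' hb' (del_of_ne h a2 b2)
  have hTJ : e = i ∨ e = j → ∀ l ∈ J.erase j, T l = T' l := by
    intro h l hl
    obtain ⟨h1, h2, h3⟩ := hJI l hl
    refine he l h1 ?_
    rcases h with h | h <;> rw [h] <;> assumption
  by_cases hei : e = i
  · have hT'j : T' j = y := by rw [← he j hjI (by rw [hei]; exact hij.symm)]; exact hT.2
    have hT'i : T' i ≠ x := fun h => hT' ⟨h, hT'j⟩
    have hci := (hg.1 i hiI).2
    have hT'iy : T' i ≠ y := by
      intro h; rw [h, hyc] at hci; exact hij hci.symm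
    have hw := hother T' (fun _ _ => rfl) ⟨i, hiI, rfl, hT'i, hT'iy, by simp [recol, hci]⟩
    refine ⟨T', hw, conn_of_agree hT'v ?_, conn_of_agree
      ⟨fun l hl => hw.1 l (Finset.mem_insert_of_mem hl), fun a ha b hb =>
        hw.2 a (Finset.mem_insert_of_mem ha) b (Finset.mem_insert_of_mem hb)⟩
      (fun l hl => (hTJ (Or.inl hei) l hl).symm)⟩
    intro l hl
    simp only [phi, hci, if_true]
    by_cases h1 : l = i
    · subst h1; rw [mk_i]
    by_cases h2 : l = j
    · subst h2; rw [mk_j hij, hT'j]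
    rw [mk_o h1 h2]
  · have hT'i : T' i = x := by rw [← he i hiI (Ne.symm hei)]; exact hT.1
    have hT'j : T' j ≠ y := fun h => hT' ⟨hT'i, h⟩
    have hej : e = j := by
      by_contra h
      apply hT'j
      rw [← he j hjI (Ne.symm h)]; exact hT.2
    have hcj := (hg.1 j hjI).2
    have hT'jx : T' j ≠ x := by
      intro h; rw [h, hxc] at hcj; exact hij hcj
    have hupd : ∀ l ∈ J.erase j, Function.update T' i (T' j) l = T' l := by
      intro l hl
      rw [Function.update_of_ne (hJI l hl).2.1]
    have hw := hother (Function.update T' i (T' j)) hupd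
      ⟨j, hjI, by simp, hT'jx, hT'j, by simp [recol, hcj]⟩
    refine ⟨_, hw, conn_of_agree hT'v ?_, conn_of_agree
      ⟨fun l hl => hw.1 l (Finset.mem_insert_of_mem hl), fun a ha b hb =>
        hw.2 a (Finset.mem_insert_of_mem ha) b (Finset.mem_insert_of_mem hb)⟩
      (fun l hl => (hupd l hl).trans (hTJ (Or.inr hej) l hl).symm)⟩
    intro l hl
    simp only [phi, Function.update_self, hcj, hij.symm, if_false]
    by_cases h1 : l = i
    · subst h1; rw [mk_i, hT'i]
    by_cases h2 : l = j
    · subst h2; rw [mk_j hij]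
    rw [mk_o h1 h2, Function.update_of_ne h1]

/-- the case where `y` has a different colour than `x` -/
theorem diff_case {G : V → V → Prop} (hsym : ∀ u v, G u v → G v u) (hirr : ∀ v, ¬ G v v)
    {W : Finset V} {c : V → ι} {i j : ι} {J : Finset ι} (hi : i ∉ J) (hj : j ∈ J) {x y : V}
    {A R : Finset V} (hA : ∀ a ∈ A, G x a) (hyA : y ∈ A)
    (hR : ∀ v, v ∈ R ↔ v ∈ A ∨ G y v)
    (hxW : x ∈ W) (hxc : c x = i) (hyW : y ∈ W) (hyc : c y = j)
    (hIH : ∀ w w', Valid G (W \ R) (recol c i j) (insert i (J.erase j)) w →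
      Valid G (W \ R) (recol c i j) (insert i (J.erase j)) w' →
      Conn G (W \ R) (recol c i j) (J.erase j) w w' →
      Conn G (W \ R) (recol c i j) (insert i (J.erase j)) w w')
    {f g : ι → V} (hf : Valid G W c (insert i J) f) (hg : Valid G W c (insert i J) g)
    (hc : Conn (del G x (A.erase y)) W c (insert i J) f g) :
    Conn (del G x A) W c (insert i J) f g := by
  have hxy : y ≠ x := fun h => hirr x (h ▸ hA y hyA)
  have hij : i ≠ j := fun h => hi (h ▸ hj)
  have hsd := del_symm hsym x A
  have hiI : i ∈ insert i J := Finset.mem_insert_self _ _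
  have hjI : j ∈ insert i J := Finset.mem_insert_of_mem hj
  have hval : ∀ f, Valid (del G x (A.erase y)) W c (insert i J) f → ¬ (f i = x ∧ f j = y) →
      Valid (del G x A) W c (insert i J) f := by
    intro f hf hn
    refine ⟨hf.1, fun a ha b hb h => ?_⟩
    have ea := (hf.1 a ha).2
    have eb := (hf.1 b hb).2
    rcases del_erase (y := y) h with h | ⟨h1, h2⟩ | ⟨h1, h2⟩
    · exact hf.2 a ha b hb h
    · rw [h1, hxc] at ea; rw [h2, hyc] at eb
      rw [← ea] at h1; rw [← eb] at h2
      exact hn ⟨h1, h2⟩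
    · rw [h1, hyc] at ea; rw [h2, hxc] at eb
      rw [← ea] at h1; rw [← eb] at h2
      exact hn ⟨h2, h1⟩
  have hRx : ∀ v ∈ W \ R, ¬ del G x A v x := by
    intro v hv h
    rw [Finset.mem_sdiff, hR] at hv
    exact hv.2 (Or.inl (h.2.2 rfl))
  have hRy : ∀ v ∈ W \ R, ¬ del G x A v y := by
    intro v hv h
    rw [Finset.mem_sdiff, hR] at hv
    exact hv.2 (Or.inr (hsym _ _ h.1))
  have hJI : ∀ l ∈ J.erase j, l ∈ insert i J ∧ l ≠ i ∧ l ≠ j := by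
    intro l hl
    obtain ⟨h1, h2⟩ := Finset.mem_erase.mp hl
    exact ⟨Finset.mem_insert_of_mem h2, fun h => hi (h ▸ h2), h1⟩
  have inv : ∀ T, Conn (del G x (A.erase y)) W c (insert i J) f T →
      (¬ (T i = x ∧ T j = y) → Conn (del G x A) W c (insert i J) f T) ∧
      ((T i = x ∧ T j = y) → ∃ w, Valid G (W \ R) (recol c i j) (insert i (J.erase j)) w ∧
        Conn (del G x A) W c (insert i J) f (phi c i j x y w) ∧
        Conn G (W \ R) (recol c i j) (J.erase j) w T) := by
    intro T hT
    induction hT with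
    | refl =>
      refine ⟨fun _ => Relation.ReflTransGen.refl, fun h => ?_⟩
      exfalso
      apply hf.2 i hiI j hjI
      rw [h.1, h.2]; exact hA y hyA
    | @tail T T' _ hs ih =>
      by_cases hb : T i = x ∧ T j = y <;> by_cases hb' : T' i = x ∧ T' j = y
      · refine ⟨fun h => absurd hb' h, fun _ => ?_⟩
        obtain ⟨w, hw1, hw2, hw3⟩ := ih.2 hb
        refine ⟨w, hw1, hw2, hw3.trans (Step.conn ?_)⟩
        obtain ⟨h1, h2, ⟨e, he⟩, h4⟩ := hs
        have hne : ∀ S, Valid (del G x (A.erase y)) W c (insert i J) S →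
            ∀ l ∈ J.erase j, S l ≠ x ∧ S l ≠ y := by
          intro S hS l hl
          obtain ⟨g1, g2, g3⟩ := hJI l hl
          have := (hS.1 l g1).2
          constructor
          · intro h; rw [h, hxc] at this; exact g2 this.symm
          · intro h; rw [h, hyc] at this; exact g3 this.symm
        have hv : ∀ S, Valid (del G x (A.erase y)) W c (insert i J) S → (S i = x ∧ S j = y) →
            Valid G (W \ R) (recol c i j) (J.erase j) S := by
          intro S hS hSb
          constructor
          · intro l hl
            obtain ⟨g1, g2, g3⟩ := hJI l hl
            refine ⟨Finset.mem_sdiff.mpr ⟨(hS.1 l g1).1, ?_⟩, by simp [recol, (hS.1 l g1).2, g3]⟩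
            refine notMem_R hA hR hxy (hne S hS l hl).1 (hne S hS l hl).2 ?_ ?_
            · have := hS.2 i hiI l g1
              rwa [hSb.1] at this
            · have := hS.2 j hjI l g1
              rwa [hSb.2] at this
          · intro a ha b hb h
            exact hS.2 a (hJI a ha).1 b (hJI b hb).1
              (del_of_ne h (hne S hS a ha).1 (hne S hS b hb).1)
        refine ⟨hv T h1 hb, hv T' h2 hb', ⟨e, fun l hl => he l (hJI l hl).1⟩, ?_⟩
        intro a ha b hb h
        exact h4 a (hJI a ha).1 b (hJI b hb).1
          (del_of_ne h (hne T h1 a ha).1 (hne T' h2 b hb).1)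
      · refine ⟨fun _ => ?_, fun h => absurd h hb'⟩
        obtain ⟨w, hw1, hw2, hw3⟩ := ih.2 hb
        obtain ⟨w', hw1', hw2', hw3'⟩ := exit_case hsym hirr hi hj hA hyA hR hxc hyc hval hs hb hb'
        have hww := hIH w w' hw1 hw1' (hw3.trans (hw3'.symm hsym))
        have := conn_map (phi c i j x y) (fun w1 w2 h12 =>
          phi_conn (H := del G x A) (fun _ _ h => h.1) hsd (fun v h => hirr v h.1)
            Finset.sdiff_subset hij hi hxW hxc hyW hyc hRx hRy h12) hww
        exact (hw2.trans this).trans (hw2'.symm hsd)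
      · refine ⟨fun h => absurd hb' h, fun _ => ?_⟩
        obtain ⟨w', hw1', hw2', hw3'⟩ := exit_case hsym hirr hi hj hA hyA hR hxc hyc hval
          (hs.symm (del_symm hsym x _)) hb' hb
        exact ⟨w', hw1', (ih.1 hb).trans hw2', hw3'⟩
      · refine ⟨fun _ => (ih.1 hb).trans (Step.conn ?_), fun h => absurd h hb'⟩
        obtain ⟨h1, h2, ⟨e, he⟩, h4⟩ := hs
        refine ⟨hval T h1 hb, hval T' h2 hb', ⟨e, he⟩, ?_⟩
        intro a haI b hbI h
        have ea := (h1.1 a haI).2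
        have eb := (h2.1 b hbI).2
        rcases del_erase (y := y) h with h | ⟨g1, g2⟩ | ⟨g1, g2⟩
        · exact h4 a haI b hbI h
        · rw [g1, hxc] at ea; rw [g2, hyc] at eb
          rw [← ea] at g1; rw [← eb] at g2
          by_cases hei : e = i
          · exact hb ⟨g1, by rw [he j hjI (by rw [hei]; exact hij.symm)]; exact g2⟩
          · exact hb' ⟨by rw [← he i hiI (Ne.symm hei)]; exact g1, g2⟩
        · rw [g1, hyc] at ea; rw [g2, hxc] at eb
          rw [← ea] at g1; rw [← eb] at g2
          by_cases hei : e = i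
          · exact hb' ⟨g2, by rw [← he j hjI (by rw [hei]; exact hij.symm)]; exact g1⟩
          · exact hb ⟨by rw [he i hiI (Ne.symm hei)]; exact g2, g1⟩
  refine (inv g hc).1 (fun h => hg.2 i hiI j hjI ?_)
  rw [h.1, h.2]; exact hA y hyA

theorem connect {G : V → V → Prop} (hsym : ∀ u v, G u v → G v u) (hirr : ∀ v, ¬ G v v)
    {D : ℕ} (hD : Good G D) [Fintype V] (n : ℕ) : ∀ (J : Finset ι), J.card = n →
    ∀ (W : Finset V) (c : V → ι) (i : ι), i ∉ J →
    (∀ I ⊆ J, D * (I.card + 1) < (W.filter (fun v => c v ∈ insert i I)).card) →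
    ∀ f g : ι → V, Valid G W c (insert i J) f → Valid G W c (insert i J) g →
    Conn G W c J f g → Conn G W c (insert i J) f g := by
  classical
  induction n using Nat.strong_induction_on with
  | _ n ih =>
  intro J hJ W c i hi hI f g hf hg hfg
  have h0 := hI ∅ (by simp)
  obtain ⟨x, hx⟩ := Finset.card_pos.mp (lt_of_le_of_lt (Nat.zero_le _) h0)
  have hxW : x ∈ W := by simp at hx; exact hx.1
  have hxc : c x = i := by simp at hx; exact hx.2
  have key : ∀ A : Finset V, (∀ a ∈ A, G x a) → Conn (del G x A) W c (insert i J) f g := by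
    intro A
    induction A using Finset.strongInduction with
    | H A ihA =>
    intro hA
    by_cases hne : A.Nonempty
    · obtain ⟨y, hyA, R, hRD, hR⟩ := hD x A hA hne
      have h1 := ihA (A.erase y) (Finset.erase_ssubset hyA)
        (fun a ha => hA a (Finset.mem_of_mem_erase ha))
      by_cases hy : y ∈ W ∧ c y ∈ insert i J
      · obtain ⟨hyW, hyc⟩ := hy
        rcases Finset.mem_insert.mp hyc with hyi | hyJ
        · refine conn_map id (fun p q hpq => ?_) h1
          refine same_case hsym hirr hi hA hyA hR hxW hxc hyW hyi ?_ hpq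
          intro f hf
          refine relative hsym hirr hD _ J rfl (W \ R) c i hi f hf ?_
          intro I hIJ
          exact card_remove W R c _ D _ hRD (hI I hIJ)
        · have hij : i ≠ c y := fun h => hi (h ▸ hyJ)
          refine diff_case hsym hirr hi hyJ hA hyA hR hxW hxc hyW rfl ?_ hf hg h1
          intro w w' hw hw' hww
          refine ih (J.erase (c y)).card ?_ (J.erase (c y)) rfl (W \ R) (recol c i (c y)) i
            (fun h => hi (Finset.mem_of_mem_erase h)) ?_ w w' hw hw' hww
          · rw [← hJ]; exact Finset.card_erase_lt_of_mem hyJ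
          · intro I hIJ
            have hjI : c y ∉ I := fun h => by simpa using hIJ h
            apply card_remove W R _ _ D _ hRD
            rw [filter_recol _ _ _ _ _ hjI hij]
            have := hI (insert (c y) I) (by
              rw [← Finset.insert_erase hyJ]; exact Finset.insert_subset_insert _ hIJ)
            rwa [Finset.card_insert_of_notMem hjI] at this
      · refine conn_map id (fun p q hpq => Step.conn ?_) h1
        have hno : ∀ S, Valid (del G x (A.erase y)) W c (insert i J) S →
            ∀ l ∈ insert i J, S l ≠ y := by
          intro S hS l hl h
          obtain ⟨h1, h2⟩ := hS.1 l hl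
          rw [h] at h1 h2
          exact hy ⟨h1, h2 ▸ hl⟩
        have hd : ∀ u v, u ≠ y → v ≠ y → del G x A u v → del G x (A.erase y) u v := by
          intro u v hu hv h
          rcases del_erase (y := y) h with h | h | h
          · exact h
          · exact absurd h.2 hv
          · exact absurd h.1 hu
        obtain ⟨h1, h2, h3, h4⟩ := hpq
        exact ⟨⟨h1.1, fun a ha b hb h =>
            h1.2 a ha b hb (hd _ _ (hno p h1 a ha) (hno p h1 b hb) h)⟩,
          ⟨h2.1, fun a ha b hb h => h2.2 a ha b hb (hd _ _ (hno q h2 a ha) (hno q h2 b hb) h)⟩,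
          h3, fun a ha b hb h => h4 a ha b hb (hd _ _ (hno p h1 a ha) (hno q h2 b hb) h)⟩
    · have hA0 : A = ∅ := Finset.not_nonempty_iff_eq_empty.mp hne
      subst hA0
      have hsd := del_symm hsym x ∅
      have hx1 : ∀ v, ¬ del G x ∅ v x := fun v h => by simpa using h.2.2 rfl
      have hx2 : ∀ v, ¬ del G x ∅ x v := fun v h => by simpa using h.2.1 rfl
      have sw : ∀ f, Valid G W c (insert i J) f →
          Conn (del G x ∅) W c (insert i J) f (Function.update f i x) := by
        intro f hf
        apply Step.conn
        have hfJ : Valid G W c J f := ⟨fun l hl => hf.1 l (Finset.mem_insert_of_mem hl),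
          fun a ha b hb => hf.2 a (Finset.mem_insert_of_mem ha) b (Finset.mem_insert_of_mem hb)⟩
        refine ⟨⟨hf.1, fun a ha b hb h => hf.2 a ha b hb h.1⟩,
          valid_lift (G := G) (fun _ _ h => h.1) hi hxW hxc (hx1 x) (Finset.Subset.refl W)
            (fun v _ => hx1 v) (fun v _ => hx2 v) (fun l hl => (hfJ.1 l hl).2) hfJ,
          ⟨i, fun l _ hli => by simp [hli]⟩, ?_⟩
        intro a ha b hb
        by_cases hbi : b = i
        · subst hbi; rw [Function.update_self]; exact hx1 _
        · rw [Function.update_of_ne hbi]; exact fun h => hf.2 a ha b hb h.1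
      refine ((sw f hf).trans ?_).trans ((sw g hg).symm hsd)
      refine conn_map (fun g => Function.update g i x) ?_ hfg
      intro p q hpq
      exact (step_lift (G := G) (fun _ _ h => h.1) hi hxW hxc (hx1 x) (Finset.Subset.refl W)
            (fun v _ => hx1 v) (fun v _ => hx2 v) (fun l hl => (hpq.1.1 l hl).2)
            (fun l hl => (hpq.2.1.1 l hl).2) hpq).conn
  have hfin := key (Finset.univ.filter (fun v => G x v)) (by simp)
  have heq : del G x (Finset.univ.filter (fun v => G x v)) = G := by
    funext u v
    simp only [del, Finset.mem_filter, Finset.mem_univ, true_and, eq_iff_iff]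
    constructor
    · exact fun h => h.1
    · exact fun h => ⟨h, fun e => e ▸ h, fun e => e ▸ hsym _ _ h⟩
  rwa [heq] at hfin

theorem total {G : V → V → Prop} (hsym : ∀ u v, G u v → G v u) (hirr : ∀ v, ¬ G v v)
    {D : ℕ} (hD : Good G D) [Fintype V] (W : Finset V) (c : V → ι) (J : Finset ι)
    (hI : ∀ I ⊆ J, I.Nonempty → D * I.card < (W.filter (fun v => c v ∈ I)).card) :
    ∀ f g : ι → V, Valid G W c J f → Valid G W c J g → Conn G W c J f g := by
  induction J using Finset.induction_on with
  | empty =>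
    intro f g hf hg
    exact conn_of_agree hf (by simp)
  | insert i J hi ih =>
    intro f g hf hg
    have hsub : ∀ f, Valid G W c (insert i J) f → Valid G W c J f := fun f hf =>
      ⟨fun l hl => hf.1 l (Finset.mem_insert_of_mem hl),
          fun a ha b hb => hf.2 a (Finset.mem_insert_of_mem ha) b (Finset.mem_insert_of_mem hb)⟩
    refine connect hsym hirr hD _ J rfl W c i hi ?_ f g hf hg
      (ih (fun I hIJ => hI I (hIJ.trans (Finset.subset_insert _ _))) f g (hsub f hf) (hsub g hg))
    intro I hIJ
    have := hI (insert i I) (Finset.insert_subset_insert _ hIJ) (Finset.insert_nonempty _ _)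
    rwa [Finset.card_insert_of_notMem (fun h => hi (hIJ h))] at this

theorem good_of_star [Fintype V] (G : SimpleGraph V) [DecidableRel G.Adj] (k Δ : ℕ) (hk : 1 ≤ k)
    (hΔ : ∀ v, G.degree v ≤ Δ)
    (hstar : ∀ v : V, ∀ S : Finset V, (∀ u ∈ S, G.Adj v u) →
      (∀ u ∈ S, ∀ w ∈ S, u ≠ w → ¬ G.Adj u w) → S.card ≤ k) :
    Good G.Adj (((2 * k - 1) * Δ + k) / k) := by
  classical
  intro x A hA hne
  obtain ⟨I, hImem, hImax⟩ := Finset.exists_max_image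
    (A.powerset.filter (fun S => ∀ u ∈ S, ∀ w ∈ S, u ≠ w → ¬ G.Adj u w)) Finset.card
    ⟨∅, by simp⟩
  simp only [Finset.mem_filter, Finset.mem_powerset] at hImem hImax
  obtain ⟨hIA, hIind⟩ := hImem
  have hIk : I.card ≤ k := hstar x I (fun u hu => hA u (hIA hu)) hIind
  have hdom : ∀ a ∈ A, ∃ y ∈ I, a = y ∨ G.Adj y a := by
    intro a ha
    by_contra hcon
    push Not at hcon
    have haI : a ∉ I := fun h => (hcon a h).1 rfl
    have := hImax (insert a I) ⟨Finset.insert_subset ha hIA, by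
      intro u hu w hw huw
      rcases Finset.mem_insert.mp hu with h | h <;> rcases Finset.mem_insert.mp hw with h' | h'
      · exact absurd (h.trans h'.symm) huw
      · rw [h]; exact fun hh => (hcon w h').2 hh.symm
      · rw [h']; exact (hcon u h).2
      · exact hIind u h w h' huw⟩
    rw [Finset.card_insert_of_notMem haI] at this
    omega
  have hIne : I.Nonempty := by
    obtain ⟨a, ha⟩ := hne
    obtain ⟨y, hy, _⟩ := hdom a ha
    exact ⟨y, hy⟩
  obtain ⟨y, hyI, hymax⟩ := Finset.exists_max_image I
    (fun y => (A ∩ G.neighborFinset y).card) hIne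
  have hcov : A ⊆ I.biUnion (fun y => insert y (A ∩ G.neighborFinset y)) := by
    intro a ha
    obtain ⟨z, hz, h⟩ := hdom a ha
    simp only [Finset.mem_biUnion, Finset.mem_insert, Finset.mem_inter,
      SimpleGraph.mem_neighborFinset]
    exact ⟨z, hz, h.imp id (fun h => ⟨ha, h⟩)⟩
  have hc1 := Finset.card_le_card hcov
  have hc2 := Finset.card_biUnion_le_card_mul I
    (fun y => insert y (A ∩ G.neighborFinset y)) ((A ∩ G.neighborFinset y).card + 1)
    (fun z hz => (Finset.card_insert_le _ _).trans (Nat.succ_le_succ (hymax z hz)))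
  refine ⟨y, hIA hyI, A ∪ G.neighborFinset y, ?_, by simp⟩
  rw [Nat.le_div_iff_mul_le (by omega)]
  have hc3 := Finset.card_union_add_card_inter A (G.neighborFinset y)
  have hdeg : (G.neighborFinset y).card ≤ Δ := by
    rw [SimpleGraph.card_neighborFinset_eq_degree]; exact hΔ y
  have hAd : A.card ≤ Δ := by
    refine le_trans ?_ (hΔ x)
    rw [← SimpleGraph.card_neighborFinset_eq_degree]
    exact Finset.card_le_card (fun a ha => by simpa using hA a ha)
  have hc4 : A.card ≤ k * ((A ∩ G.neighborFinset y).card + 1) :=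
    (hc1.trans hc2).trans (Nat.mul_le_mul_right _ hIk)
  obtain ⟨m, rfl⟩ : ∃ m, k = m + 1 := ⟨k - 1, by omega⟩
  have e : 2 * (m + 1) - 1 = 2 * m + 1 := by omega
  rw [e]
  generalize (A ∪ G.neighborFinset y).card = u at *
  generalize (A ∩ G.neighborFinset y).card = t at *
  generalize (G.neighborFinset y).card = d at *
  generalize A.card = a at *
  have h5 : (m + 1) * d ≤ (m + 1) * Δ := Nat.mul_le_mul_left _ hdeg
  have h6 : m * a ≤ m * Δ := Nat.mul_le_mul_left _ hAd
  have h7 : (m + 1) * (u + t) = (m + 1) * (a + d) := by rw [hc3]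
  nlinarith

end RGaux

/-- If `G` has maximum degree `Δ`, contains no induced star `K_{1,k+1}`, and every
class of the vertex partition has size greater than `((2k − 1)Δ + k)/k`, then the
reconfiguration graph on independent transversals is connected. -/
theorem stmt_15 {V : Type*} [Fintype V] [DecidableEq V]
    (G : SimpleGraph V) [DecidableRel G.Adj] (k Δ n : ℕ) (hk : 1 ≤ k)
    (hΔ : ∀ v, G.degree v ≤ Δ)
    (hstar : ∀ v : V, ∀ S : Finset V, (∀ u ∈ S, G.Adj v u) →
      (∀ u ∈ S, ∀ w ∈ S, u ≠ w → ¬ G.Adj u w) → S.card ≤ k)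
    (P : Fin n → Finset V)
    (hne : ∀ i, (P i).Nonempty)
    (hdisj : ∀ i j, i ≠ j → Disjoint (P i) (P j))
    (hcover : ∀ v, ∃ i, v ∈ P i)
    (hsize : ∀ i, ((2 * (k : ℚ) - 1) * Δ + k) / k < ((P i).card : ℚ))
    (S T : Finset V)
    (hS : IsIndepTransversal G P S) (hT : IsIndepTransversal G P T) :
    Relation.ReflTransGen (ITAdj G P) S T := by
  classical
  choose c hc using hcover
  have hcP : ∀ v i, v ∈ P i ↔ c v = i := by
    intro v i
    constructor
    · intro h
      by_contra hne
      exact Finset.disjoint_left.mp (hdisj _ _ hne) (hc v) h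
    · rintro rfl; exact hc v
  have hD := RGaux.good_of_star G k Δ hk hΔ hstar
  set D := ((2 * k - 1) * Δ + k) / k with hDdef
  have hcard : ∀ i, D + 1 ≤ (P i).card := by
    intro i
    have h := hsize i
    rw [Nat.succ_le_iff, hDdef, Nat.div_lt_iff_lt_mul (by omega)]
    have hk0 : (0 : ℚ) < k := by exact_mod_cast hk
    rw [div_lt_iff₀ hk0] at h
    obtain ⟨m, rfl⟩ : ∃ m, k = m + 1 := ⟨k - 1, by omega⟩
    have e : 2 * (m + 1) - 1 = 2 * m + 1 := by omega
    rw [e]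
    have : (((2 * m + 1) * Δ + (m + 1) : ℕ) : ℚ) < (((P i).card * (m + 1) : ℕ) : ℚ) := by
      push_cast at h ⊢
      linarith
    exact_mod_cast this
  have hI : ∀ I ⊆ (Finset.univ : Finset (Fin n)), I.Nonempty →
      D * I.card < ((Finset.univ : Finset V).filter (fun v => c v ∈ I)).card := by
    intro I _ hIne
    have e : (Finset.univ : Finset V).filter (fun v => c v ∈ I) = I.biUnion P := by
      ext v
      simp [hcP]
    rw [e, Finset.card_biUnion (fun i _ j _ hij => hdisj i j hij)]
    have h1 : I.card * (D + 1) ≤ ∑ i ∈ I, (P i).card := by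
      rw [← smul_eq_mul]
      exact Finset.card_nsmul_le_sum _ _ _ (fun i _ => hcard i)
    have h2 := hIne.card_pos
    nlinarith
  have htot := RGaux.total (fun u v (h : G.Adj u v) => h.symm) (fun v => SimpleGraph.irrefl G) hD Finset.univ c
    Finset.univ hI
  have hfun : ∀ S, IsIndepTransversal G P S → ∃ f : Fin n → V,
      RGaux.Valid G.Adj Finset.univ c Finset.univ f ∧ Finset.univ.image f = S := by
    intro S hS
    have h1 : ∀ i, ∃ v, S ∩ P i = {v} := fun i => Finset.card_eq_one.mp (hS.2 i)
    choose f hf using h1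
    have hfm : ∀ i, f i ∈ S ∧ f i ∈ P i := by
      intro i
      have : f i ∈ S ∩ P i := by rw [hf i]; simp
      simpa using this
    refine ⟨f, ⟨fun j _ => ⟨Finset.mem_univ _, (hcP _ _).mp (hfm j).2⟩,
      fun a _ b _ => hS.1 _ (hfm a).1 _ (hfm b).1⟩, ?_⟩
    ext v
    simp only [Finset.mem_image, Finset.mem_univ, true_and]
    constructor
    · rintro ⟨i, rfl⟩; exact (hfm i).1
    · intro hv
      refine ⟨c v, ?_⟩
      have : v ∈ S ∩ P (c v) := Finset.mem_inter.mpr ⟨hv, hc v⟩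
      rw [hf] at this
      exact (Finset.mem_singleton.mp this).symm
  have himg : ∀ f, RGaux.Valid G.Adj Finset.univ c Finset.univ f →
      IsIndepTransversal G P (Finset.univ.image f) := by
    intro f hf
    constructor
    · intro u hu v hv
      simp only [Finset.mem_image, Finset.mem_univ, true_and] at hu hv
      obtain ⟨a, rfl⟩ := hu
      obtain ⟨b, rfl⟩ := hv
      exact hf.2 a (Finset.mem_univ _) b (Finset.mem_univ _)
    · intro i
      rw [Finset.card_eq_one]
      refine ⟨f i, ?_⟩
      ext v
      simp only [Finset.mem_inter, Finset.mem_image, Finset.mem_univ, true_and,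
        Finset.mem_singleton]
      constructor
      · rintro ⟨⟨a, rfl⟩, h⟩
        have := (hf.1 a (Finset.mem_univ _)).2
        rw [hcP] at h
        rw [← this, h]
      · rintro rfl
        exact ⟨⟨i, rfl⟩, (hcP _ _).mpr (hf.1 i (Finset.mem_univ _)).2⟩
  have hinj : ∀ f, RGaux.Valid G.Adj Finset.univ c Finset.univ f → Function.Injective f := by
    intro f hf a b hab
    rw [← (hf.1 a (Finset.mem_univ _)).2, ← (hf.1 b (Finset.mem_univ _)).2, hab]
  have hstep : ∀ f g, RGaux.Step G.Adj Finset.univ c Finset.univ f g →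
      Relation.ReflTransGen (ITAdj G P) (Finset.univ.image f) (Finset.univ.image g) := by
    rintro f g ⟨hf, hg, ⟨e, he⟩, hcr⟩
    by_cases hfg : f e = g e
    · have : f = g := by
        funext l
        by_cases hl : l = e
        · rw [hl, hfg]
        · exact he l (Finset.mem_univ _) hl
      rw [this]
    · apply Relation.ReflTransGen.single
      refine ⟨himg f hf, himg g hg, ?_, ?_⟩
      · intro u hu v hv
        simp only [Finset.mem_union, Finset.mem_image, Finset.mem_univ, true_and] at hu hv
        rcases hu with ⟨a, rfl⟩ | ⟨a, rfl⟩ <;> rcases hv with ⟨b, rfl⟩ | ⟨b, rfl⟩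
        · exact hf.2 a (Finset.mem_univ _) b (Finset.mem_univ _)
        · exact hcr a (Finset.mem_univ _) b (Finset.mem_univ _)
        · exact fun h => hcr b (Finset.mem_univ _) a (Finset.mem_univ _) h.symm
        · exact hg.2 a (Finset.mem_univ _) b (Finset.mem_univ _)
      · have e1 : Finset.univ.image f ∪ Finset.univ.image g =
            insert (g e) (Finset.univ.image f) := by
          ext v
          simp only [Finset.mem_union, Finset.mem_image, Finset.mem_univ, true_and,
            Finset.mem_insert]
          constructor
          · rintro (h | ⟨a, rfl⟩)
            · exact Or.inr h
            · by_cases ha : a = e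
              · left; rw [ha]
              · right; exact ⟨a, he a (Finset.mem_univ _) ha⟩
          · rintro (rfl | h)
            · exact Or.inr ⟨e, rfl⟩
            · exact Or.inl h
        rw [e1, Finset.card_insert_of_notMem, Finset.card_image_of_injective _ (hinj f hf)]
        · simp
        · simp only [Finset.mem_image, Finset.mem_univ, true_and, not_exists]
          intro a ha
          have h1 := (hf.1 a (Finset.mem_univ _)).2
          have h2 := (hg.1 e (Finset.mem_univ _)).2
          rw [ha, h2] at h1
          subst h1
          exact hfg ha
  obtain ⟨f, hf, rfl⟩ := hfun S hS
  obtain ⟨g, hg, rfl⟩ := hfun T hT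
  have hconn := htot f g hf hg
  unfold RGaux.Conn at hconn
  clear hT hS hg
  induction hconn with
  | refl => exact Relation.ReflTransGen.refl
  | tail _ h2 ih => exact ih.trans (hstep _ _ h2)
end

section
/- Let G be a finite simple graph with maximum degree Δ ≥ 1 and maximum average degree a, where a is the maximum over all nonempty subgraphs H of G of the quantity 2·e(H)/v(H) (twice the number of edges divided by the number of vertices of H). If 𝒱 = {V_1, …, V_n} is a partition of V(G) with |V_i| > 2Δ²/(2Δ − a) for all i, then the reconfiguration graph RG(G, 𝒱) is connected. -/
open Finset

namespace ITReconf

variable {V : Type*} [Fintype V] [DecidableEq V]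

/-- boundary operator mod 2 -/
def bd (c : Finset V → ZMod 2) (X : Finset V) : ZMod 2 :=
  ∑ x ∈ Xᶜ, c (insert x X)

/-- support condition -/
def Supp (G : SimpleGraph V) (U : Finset V) (m : ℕ) (c : Finset V → ZMod 2) : Prop :=
  ∀ X, c X ≠ 0 → X ⊆ U ∧ X.card = m ∧ IndepSet G X

/-- every cycle on sets of size at most `k` is a boundary -/
def Acyc (G : SimpleGraph V) (U : Finset V) (k : ℕ) : Prop :=
  ∀ m ≤ k, ∀ z : Finset V → ZMod 2, Supp G U m z → bd z = 0 →
    ∃ c, Supp G U (m + 1) c ∧ bd c = z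

open Classical in
/-- degree inside `U` -/
noncomputable def dg (G : SimpleGraph V) (U : Finset V) (v : V) : ℕ :=
  (U.filter (G.Adj v)).card

theorem sum_symm_zero {ι : Type*} [DecidableEq ι] (I : Finset ι) (g : ι → ι → ZMod 2)
    (hg : ∀ i j, g i j = g j i) : ∑ i ∈ I, ∑ j ∈ I.erase i, g i j = 0 := by
  induction I using Finset.induction_on with
  | empty => simp
  | insert a s ha ih =>
    rw [Finset.sum_insert ha, Finset.erase_insert ha]
    have h : ∀ i ∈ s, ∑ j ∈ (insert a s).erase i, g i j = g a i + ∑ j ∈ s.erase i, g i j := by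
      intro i hi
      have hne : a ≠ i := fun h => ha (h ▸ hi)
      rw [Finset.erase_insert_of_ne hne, Finset.sum_insert (by simp [ha]), hg i a]
    rw [Finset.sum_congr rfl h, Finset.sum_add_distrib, ih, add_zero,
      CharTwo.add_self_eq_zero]

theorem bd_bd (c : Finset V → ZMod 2) : bd (bd c) = 0 := by
  funext X
  have h : bd (bd c) X = ∑ x ∈ Xᶜ, ∑ y ∈ Xᶜ.erase x, c (insert y (insert x X)) := by
    unfold bd
    refine Finset.sum_congr rfl fun x hx => ?_
    rw [Finset.compl_insert]
  rw [h]
  exact sum_symm_zero _ _ fun i j => by rw [Finset.insert_comm]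

theorem bd_add (c d : Finset V → ZMod 2) : bd (c + d) = bd c + bd d := by
  funext X
  simp [bd, Finset.sum_add_distrib]

theorem bd_sum {ι : Type*} (I : Finset ι) (f : ι → Finset V → ZMod 2) :
    bd (∑ i ∈ I, f i) = ∑ i ∈ I, bd (f i) := by
  funext X
  simp only [bd, Finset.sum_apply]
  rw [Finset.sum_comm]

theorem Supp.add {G : SimpleGraph V} {U : Finset V} {m : ℕ} {c d : Finset V → ZMod 2}
    (hc : Supp G U m c) (hd : Supp G U m d) : Supp G U m (c + d) := by
  intro X hX
  by_cases h : c X = 0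
  · refine hd X ?_
    intro h'
    exact hX (by simp [h, h'])
  · exact hc X h

theorem Supp.sum {ι : Type*} {G : SimpleGraph V} {U : Finset V} {m : ℕ} (I : Finset ι)
    (f : ι → Finset V → ZMod 2) (h : ∀ i ∈ I, Supp G U m (f i)) :
    Supp G U m (∑ i ∈ I, f i) := by
  intro X hX
  rw [Finset.sum_apply] at hX
  obtain ⟨i, hi, h'⟩ := Finset.exists_ne_zero_of_sum_ne_zero hX
  exact h i hi X h'

theorem Supp.bd {G : SimpleGraph V} {U : Finset V} {m : ℕ} {c : Finset V → ZMod 2}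
    (hc : Supp G U (m + 1) c) : Supp G U m (bd c) := by
  intro X hX
  obtain ⟨x, hx, h⟩ := Finset.exists_ne_zero_of_sum_ne_zero hX
  obtain ⟨h1, h2, h3⟩ := hc _ h
  rw [Finset.mem_compl] at hx
  rw [Finset.card_insert_of_notMem hx] at h2
  refine ⟨fun y hy => h1 (Finset.mem_insert_of_mem hy), by omega, ?_⟩
  intro a ha b hb
  exact h3 a (Finset.mem_insert_of_mem ha) b (Finset.mem_insert_of_mem hb)

theorem Supp.mono {G : SimpleGraph V} {U U' : Finset V} (hU : U ⊆ U') {m : ℕ}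
    {c : Finset V → ZMod 2} (hc : Supp G U m c) : Supp G U' m c :=
  fun X hX => ⟨(hc X hX).1.trans hU, (hc X hX).2⟩

/-- Cone over an isolated vertex. -/
theorem acyc_isolated (G : SimpleGraph V) (U : Finset V) (k : ℕ) (u : V) (hu : u ∈ U)
    (h : ∀ v ∈ U, ¬ G.Adj u v) : Acyc G U k := by
  intro m _ z hz hb
  refine ⟨fun X => if u ∈ X then z (X.erase u) else 0, ?_, ?_⟩
  · intro X hX
    by_cases hux : u ∈ X
    · simp only [hux, if_true] at hX
      obtain ⟨h1, h2, h3⟩ := hz _ hX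
      have hXU : X ⊆ U := by
        intro y hy
        by_cases hyu : y = u
        · exact hyu ▸ hu
        · exact h1 (Finset.mem_erase.2 ⟨hyu, hy⟩)
      refine ⟨hXU, ?_, ?_⟩
      · rw [Finset.card_erase_of_mem hux] at h2
        have := Finset.card_pos.2 ⟨u, hux⟩
        omega
      · intro a ha b hb hab
        by_cases hau : a = u
        · subst hau; exact h b (hXU hb) hab
        by_cases hbu : b = u
        · subst hbu; exact h a (hXU ha) hab.symm
        exact h3 a (Finset.mem_erase.2 ⟨hau, ha⟩) b (Finset.mem_erase.2 ⟨hbu, hb⟩) hab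
    · simp [hux] at hX
  · funext X
    unfold bd
    by_cases hux : u ∈ X
    · have hb' := congrFun hb (X.erase u)
      unfold bd at hb'
      rw [Finset.compl_erase, Finset.sum_insert (by simp [hux]), Finset.insert_erase hux] at hb'
      have : ∑ x ∈ Xᶜ, (if u ∈ insert x X then z ((insert x X).erase u) else 0)
          = ∑ x ∈ Xᶜ, z (insert x (X.erase u)) := by
        refine Finset.sum_congr rfl fun x hx => ?_
        have hxu : x ≠ u := by rintro rfl; simp [hux] at hx
        rw [if_pos (by simp [hux]), Finset.erase_insert_of_ne hxu]
      rw [this]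
      have h2 := CharTwo.add_self_eq_zero (z X)
      simp only [Pi.zero_apply] at hb'
      linear_combination hb' - h2
    · rw [Finset.sum_eq_single u]
      · simp [hux]
      · intro b _ hbu
        change (if u ∈ insert b X then z ((insert b X).erase u) else 0) = 0
        rw [if_neg]
        simp [hux, Ne.symm hbu]
      · simp [hux]

open Classical in
/-- Meshulam's edge deletion / explosion step. -/
theorem acyc_step (G : SimpleGraph V) (U : Finset V) (k : ℕ) (u v : V) (hu : u ∈ U)
    (hv : v ∈ U) (huv : G.Adj u v)
    (h1 : Acyc (G.deleteEdges {s(u, v)}) U (k + 1))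
    (h2 : Acyc G (U \ (U.filter (fun x => G.Adj u x ∨ G.Adj v x))) k) :
    Acyc G U (k + 1) := by
  have hne : u ≠ v := huv.ne
  intro m hm z hz hb
  have hle : ∀ X, IndepSet G X → IndepSet (G.deleteEdges {s(u, v)}) X := by
    intro X hX a ha b hb hab
    exact hX a ha b hb (SimpleGraph.deleteEdges_le _ hab)
  have hback : ∀ X, IndepSet (G.deleteEdges {s(u, v)}) X → ¬ (u ∈ X ∧ v ∈ X) →
      IndepSet G X := by
    intro X hX hn a ha b hb hab
    refine hX a ha b hb ?_
    rw [SimpleGraph.deleteEdges_adj]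
    refine ⟨hab, ?_⟩
    simp only [Set.mem_singleton_iff, Sym2.eq_iff]
    rintro (⟨rfl, rfl⟩ | ⟨rfl, rfl⟩)
    · exact hn ⟨ha, hb⟩
    · exact hn ⟨hb, ha⟩
  obtain ⟨c, hc, hcz⟩ := h1 m hm z (fun X hX => ⟨(hz X hX).1, (hz X hX).2.1,
    hle X (hz X hX).2.2⟩) hb
  rcases m with _ | m
  · refine ⟨c, fun X hX => ⟨(hc X hX).1, (hc X hX).2.1, hback X (hc X hX).2.2 ?_⟩, hcz⟩
    rintro ⟨hu', hv'⟩
    have := Finset.card_le_one.1 (by rw [(hc X hX).2.1]) u hu' v hv'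
    exact hne this
  set U' := U \ (U.filter (fun x => G.Adj u x ∨ G.Adj v x)) with hU'
  have huU' : u ∉ U' := by simp [hU', huv.symm]
  have hvU' : v ∉ U' := by simp [hU', huv]
  let d : Finset V → ZMod 2 := fun Y =>
    if u ∉ Y ∧ v ∉ Y then c (insert u (insert v Y)) else 0
  have hd : Supp G U' m d := by
    intro Y hY
    by_cases hYn : u ∉ Y ∧ v ∉ Y
    · have hY' : c (insert u (insert v Y)) ≠ 0 := by simpa [d, hYn] using hY
      obtain ⟨a1, a2, a3⟩ := hc _ hY'
      refine ⟨?_, ?_, ?_⟩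
      · intro y hy
        rw [hU', Finset.mem_sdiff, Finset.mem_filter]
        have hyU : y ∈ U := a1 (by simp [hy])
        have hyu : y ≠ u := by rintro rfl; exact hYn.1 hy
        have hyv : y ≠ v := by rintro rfl; exact hYn.2 hy
        refine ⟨hyU, ?_⟩
        rintro ⟨-, h | h⟩
        · refine a3 u (by simp) y (by simp [hy]) ?_
          rw [SimpleGraph.deleteEdges_adj]
          exact ⟨h, by simp [hyu, hyv]⟩
        · refine a3 v (by simp) y (by simp [hy]) ?_
          rw [SimpleGraph.deleteEdges_adj]
          exact ⟨h, by simp [hyu, hyv]⟩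
      · rw [Finset.card_insert_of_notMem (by simp [hne, hYn.1]),
          Finset.card_insert_of_notMem hYn.2] at a2
        omega
      · have : IndepSet (G.deleteEdges {s(u, v)}) Y :=
          fun a ha b hb => a3 a (by simp [ha]) b (by simp [hb])
        exact hback Y this (fun h => hYn.1 h.1)
    · simp [d, hYn] at hY
  have hbd : bd d = 0 := by
    funext Y
    by_cases hYn : u ∉ Y ∧ v ∉ Y
    · have e := congrFun hcz (insert u (insert v Y))
      have hz0 : z (insert u (insert v Y)) = 0 := by
        by_contra h
        exact (hz _ h).2.2 u (by simp) v (by simp) huv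
      rw [hz0] at e
      unfold bd at e ⊢
      simp only [Pi.zero_apply]
      rw [← e]
      symm
      apply Finset.sum_subset_zero_on_sdiff
      · intro x; simp
      · intro x hx
        have : x = u ∨ x = v := by
          simp at hx; tauto
        rcases this with rfl | rfl <;> simp [d]
      · intro x hx
        have hx' : x ≠ u ∧ x ≠ v ∧ x ∉ Y := by simpa using hx
        have : (u ∉ insert x Y ∧ v ∉ insert x Y) := by
          simp [hYn, Ne.symm hx'.1, Ne.symm hx'.2.1]
        simp only [d, this, not_false_eq_true, and_self, if_true]
        congr 1
        ext w; simp; tauto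
    · unfold bd
      refine Finset.sum_eq_zero fun x _ => ?_
      simp only [d]
      rw [if_neg]
      simp only [Finset.mem_insert]
      tauto
  obtain ⟨f, hf, hfd⟩ := h2 m (by omega) d hd hbd
  have hfu : ∀ X, u ∈ X ∨ v ∈ X → f X = 0 := by
    intro X hX
    by_contra h
    rcases hX with hX | hX
    · exact huU' ((hf X h).1 hX)
    · exact hvU' ((hf X h).1 hX)
  let g : Finset V → ZMod 2 := fun X =>
    if u ∈ X ∧ v ∈ X then f ((X.erase u).erase v) else 0
  have hg : Supp (G.deleteEdges {s(u, v)}) U (m + 1 + 1 + 1) g := by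
    intro X hX
    by_cases hXn : u ∈ X ∧ v ∈ X
    · have hX' : f ((X.erase u).erase v) ≠ 0 := by simpa [g, hXn] using hX
      obtain ⟨a1, a2, a3⟩ := hf _ hX'
      have hmem : ∀ x ∈ X, x = u ∨ x = v ∨ x ∈ (X.erase u).erase v := by
        intro x hx; simp [hx]; tauto
      have hnu : ∀ x ∈ (X.erase u).erase v, x ∈ U ∧ ¬ G.Adj u x ∧ ¬ G.Adj v x := by
        intro x hx
        have := a1 hx
        rw [hU', Finset.mem_sdiff, Finset.mem_filter] at this
        tauto
      refine ⟨?_, ?_, ?_⟩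
      · intro x hx
        rcases hmem x hx with rfl | rfl | h
        · exact hu
        · exact hv
        · exact (hnu x h).1
      · rw [Finset.card_erase_of_mem (by simp [hXn, hne.symm]),
          Finset.card_erase_of_mem hXn.1] at a2
        omega
      · intro a ha b hb hab
        rw [SimpleGraph.deleteEdges_adj] at hab
        obtain ⟨hab, hn⟩ := hab
        simp only [Set.mem_singleton_iff, Sym2.eq_iff] at hn
        have hirr := G.ne_of_adj hab
        rcases hmem a ha with rfl | rfl | h <;> rcases hmem b hb with rfl | rfl | h'
        · exact hirr rfl
        · simp at hn
        · exact (hnu b h').2.1 hab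
        · simp at hn
        · exact hirr rfl
        · exact (hnu b h').2.2 hab
        · exact (hnu a h).2.1 hab.symm
        · exact (hnu a h).2.2 hab.symm
        · exact a3 a h b h' hab
    · simp [g, hXn] at hX
  have hc' := hc.add hg.bd
  refine ⟨c + bd g, fun X hX => ?_, ?_⟩
  · obtain ⟨a1, a2, a3⟩ := hc' X hX
    refine ⟨a1, a2, hback X a3 ?_⟩
    rintro ⟨hu', hv'⟩
    apply hX
    set Y := (X.erase u).erase v with hY
    have hXY : X = insert u (insert v Y) := by
      ext w; simp [hY]
      by_cases h1 : w = u
      · subst h1; simp [hu']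
      by_cases h2 : w = v
      · subst h2; simp [hv']
      simp [h1, h2]
    have huY : u ∉ Y := by simp [hY]
    have hvY : v ∉ Y := by simp [hY]
    have e1 : d Y = c X := by simp [d, huY, hvY, ← hXY]
    have e2 : bd g X = bd f Y := by
      unfold bd
      apply Finset.sum_subset_zero_on_sdiff
      · intro x
        rw [hXY]; simp
      · intro x hx
        have : x = u ∨ x = v := by
          rw [hXY] at hx; simp at hx; tauto
        rcases this with rfl | rfl
        · exact hfu _ (by simp)
        · exact hfu _ (by simp)
      · intro x hx
        have hxX : x ∉ X := by simpa using hx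
        have hxu : x ≠ u := by rintro rfl; exact hxX hu'
        have hxv : x ≠ v := by rintro rfl; exact hxX hv'
        simp only [g]
        rw [if_pos (by simp [hu', hv']), Finset.erase_insert_of_ne hxu,
          Finset.erase_insert_of_ne hxv]
    rw [Pi.add_apply, e2, hfd, e1, CharTwo.add_self_eq_zero]
  · rw [bd_add, bd_bd, add_zero, hcz]

theorem dg_mono {G G' : SimpleGraph V} (h : G ≤ G') {U U' : Finset V} (hU : U ⊆ U') (v : V) :
    dg G U v ≤ dg G' U' v := by
  classical
  unfold dg
  apply Finset.card_le_card
  intro x hx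
  rw [Finset.mem_filter] at hx ⊢
  exact ⟨hU hx.1, h hx.2⟩

theorem dg_lt {G G' : SimpleGraph V} (h : G ≤ G') {U : Finset V} {u v : V} (hv : v ∈ U)
    (h1 : G'.Adj u v) (h2 : ¬ G.Adj u v) : dg G U u < dg G' U u := by
  classical
  unfold dg
  apply Finset.card_lt_card
  refine (Finset.ssubset_iff_of_subset ?_).2 ⟨v, ?_, ?_⟩
  · intro x hx
    rw [Finset.mem_filter] at hx ⊢
    exact ⟨hx.1, h hx.2⟩
  · rw [Finset.mem_filter]
    exact ⟨hv, h1⟩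
  · rw [Finset.mem_filter]
    exact fun h => h2 h.2

open Classical in
/-- counting inequality for the explosion. -/
theorem explosion (G : SimpleGraph V) (U : Finset V) (Δ : ℕ) (hΔ : ∀ v ∈ U, dg G U v ≤ Δ)
    (u v : V) (hu : u ∈ U) (hv : v ∈ U)
    (hmin : ∀ x ∈ U, dg G U u ≤ dg G U x)
    (hmin' : ∀ x ∈ U, G.Adj u x → dg G U v ≤ dg G U x)
    (R : Finset V) (hR : R = U.filter (fun x => G.Adj u x ∨ G.Adj v x)) :
    2 * (Δ : ℤ) * R.card ≤ 2 * (Δ : ℤ) ^ 2 + ∑ x ∈ R, (dg G U x : ℤ) := by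
  set A := U.filter (G.Adj u) with hA
  set B := U.filter (G.Adj v) with hB
  have hRu : R = B ∪ (A \ B) := by
    ext x; simp [hR, hA, hB]; tauto
  have hdis : Disjoint B (A \ B) := Finset.disjoint_sdiff
  have hj : (dg G U u : ℤ) = A.card := rfl
  have hD : (dg G U v : ℤ) = B.card := rfl
  have hc : (A \ B).card + (A ∩ B).card = A.card := Finset.card_sdiff_add_card_inter A B
  have hRc : R.card = B.card + (A \ B).card := by
    rw [hRu, Finset.card_union_of_disjoint hdis]
  have s1 : (B.card : ℤ) * dg G U u ≤ ∑ x ∈ B, (dg G U x : ℤ) := by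
    rw [← nsmul_eq_mul]
    refine Finset.card_nsmul_le_sum _ _ _ fun x hx => ?_
    exact_mod_cast hmin x (Finset.mem_filter.1 hx).1
  have s2 : ((A \ B).card : ℤ) * dg G U v ≤ ∑ x ∈ A \ B, (dg G U x : ℤ) := by
    rw [← nsmul_eq_mul]
    refine Finset.card_nsmul_le_sum _ _ _ fun x hx => ?_
    have := Finset.mem_filter.1 (Finset.mem_sdiff.1 hx).1
    exact_mod_cast hmin' x this.1 this.2
  have hsum : ∑ x ∈ R, (dg G U x : ℤ) = ∑ x ∈ B, (dg G U x : ℤ) +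
      ∑ x ∈ A \ B, (dg G U x : ℤ) := by
    rw [hRu, Finset.sum_union hdis]
  have b1 : (A.card : ℤ) ≤ Δ := by rw [← hj]; exact_mod_cast hΔ u hu
  have b2 : (B.card : ℤ) ≤ Δ := by rw [← hD]; exact_mod_cast hΔ v hv
  rw [hj] at s1
  rw [hD] at s2
  rw [hsum, hRc]
  have hc' : ((A \ B).card : ℤ) = A.card - (A ∩ B).card := by
    have : ((A \ B).card : ℤ) + (A ∩ B).card = A.card := by exact_mod_cast hc
    linarith
  push_cast
  rw [hc'] at s2 ⊢
  have hcn : (0 : ℤ) ≤ (A ∩ B).card := by positivity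
  have hBn : (0 : ℤ) ≤ B.card := by positivity
  nlinarith [mul_nonneg (sub_nonneg.2 b1) (sub_nonneg.2 b2),
    mul_nonneg hcn (by linarith : (0 : ℤ) ≤ 2 * Δ - B.card)]

/-- Main connectivity bound. -/
theorem acyc_main (Δ : ℕ) : ∀ (N : ℕ) (G : SimpleGraph V) (U : Finset V) (k : ℕ),
    U.card + ∑ x ∈ U, dg G U x ≤ N → (∀ v ∈ U, dg G U v ≤ Δ) →
    2 * (Δ : ℤ) ^ 2 * k + ∑ x ∈ U, (dg G U x : ℤ) < 2 * Δ * U.card → Acyc G U k := by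
  classical
  intro N
  induction N with
  | zero =>
    intro G U k hN _ h
    have : U.card = 0 := by omega
    rw [this] at h
    have h1 : (0 : ℤ) ≤ 2 * (Δ : ℤ) ^ 2 * k := by positivity
    have h2 : (0 : ℤ) ≤ ∑ x ∈ U, (dg G U x : ℤ) := by positivity
    simp at h
    linarith
  | succ N ih =>
    intro G U k hN hΔ h
    have hUne : U.Nonempty := by
      rw [Finset.nonempty_iff_ne_empty]
      rintro rfl
      have h1 : (0 : ℤ) ≤ 2 * (Δ : ℤ) ^ 2 * k := by positivity
      simp at h
      linarith
    obtain ⟨u, hu, hmin⟩ := Finset.exists_min_image U (dg G U) hUne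
    by_cases hz : dg G U u = 0
    · refine acyc_isolated G U k u hu fun v hv hadj => ?_
      unfold dg at hz
      rw [Finset.card_eq_zero, Finset.filter_eq_empty_iff] at hz
      exact hz hv hadj
    have hAne : (U.filter (G.Adj u)).Nonempty := Finset.card_pos.1 (Nat.pos_of_ne_zero hz)
    obtain ⟨v, hv, hmin'⟩ := Finset.exists_min_image _ (dg G U) hAne
    rw [Finset.mem_filter] at hv
    obtain ⟨hvU, huv⟩ := hv
    rcases k with _ | k
    · -- only the empty simplex matters
      intro m hm z hz hb
      obtain rfl : m = 0 := by omega
      refine ⟨fun X => if X = {u} then z ∅ else 0, ?_, ?_⟩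
      · intro X hX
        by_cases hXu : X = {u}
        · subst hXu
          refine ⟨by simpa using hu, by simp, ?_⟩
          intro a ha b hb
          simp at ha hb
          subst ha; subst hb
          exact G.irrefl
        · simp [hXu] at hX
      · funext X
        unfold bd
        by_cases hX : X = ∅
        · subst hX
          rw [Finset.sum_eq_single u]
          · simp
          · intro b _ hb
            simp [hb]
          · simp
        · have : z X = 0 := by
            by_contra h'
            exact hX (Finset.card_eq_zero.1 (hz X h').2.1)
          rw [this]
          refine Finset.sum_eq_zero fun x hx => ?_
          change (if insert x X = {u} then z ∅ else 0) = 0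
          rw [if_neg]
          intro h'
          have h3 := congrArg Finset.card h'
          rw [Finset.card_insert_of_notMem (by simpa using hx), Finset.card_singleton] at h3
          have h4 := Finset.card_pos.2 (Finset.nonempty_iff_ne_empty.2 hX)
          omega
    · have hdel : G.deleteEdges {s(u, v)} ≤ G := SimpleGraph.deleteEdges_le _
      have hlt : ∑ x ∈ U, dg (G.deleteEdges {s(u, v)}) U x < ∑ x ∈ U, dg G U x := by
        refine Finset.sum_lt_sum (fun x _ => dg_mono hdel subset_rfl x) ⟨u, hu, ?_⟩
        exact dg_lt hdel hvU huv (by simp)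
      apply acyc_step G U k u v hu hvU huv
      · apply ih
        · omega
        · intro x hx
          exact (dg_mono hdel subset_rfl x).trans (hΔ x hx)
        · have : (∑ x ∈ U, (dg (G.deleteEdges {s(u, v)}) U x : ℤ)) ≤ ∑ x ∈ U, (dg G U x : ℤ) := by
            exact_mod_cast hlt.le
          linarith
      · have hex := explosion G U Δ hΔ u v hu hvU hmin
          (fun x hx hx' => hmin' x (by simp [hx, hx'])) _ rfl
        set R := U.filter (fun x => G.Adj u x ∨ G.Adj v x) with hR
        have hRU : R ⊆ U := Finset.filter_subset _ _
        have hsub : U \ R ⊆ U := Finset.sdiff_subset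
        have hcard : (U \ R).card + R.card = U.card := Finset.card_sdiff_add_card_eq_card hRU
        have hvR : 0 < R.card := Finset.card_pos.2 ⟨v, by simp [hR, hvU, huv]⟩
        have hs : ∑ x ∈ U \ R, dg G (U \ R) x + ∑ x ∈ R, dg G U x ≤ ∑ x ∈ U, dg G U x := by
          rw [← Finset.sum_sdiff hRU]
          gcongr with x hx
          exact dg_mono le_rfl hsub x
        apply ih
        · omega
        · intro x hx
          exact (dg_mono le_rfl hsub x).trans (hΔ x (hsub hx))
        · have hs' : (∑ x ∈ U \ R, (dg G (U \ R) x : ℤ)) + ∑ x ∈ R, (dg G U x : ℤ) ≤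
              ∑ x ∈ U, (dg G U x : ℤ) := by exact_mod_cast hs
          have hcard' : ((U \ R).card : ℤ) = U.card - R.card := by
            rw [← hcard]; push_cast; ring
          rw [hcard']
          push_cast at h
          linarith

/-- indicator chain -/
def ind (X : Finset V) : Finset V → ZMod 2 := fun Y => if Y = X then 1 else 0

theorem bd_ind {ι : Type*} [DecidableEq ι] (s : ι → V) (hs : Function.Injective s)
    (I : Finset ι) :
    bd (ind (I.image s)) = ∑ i ∈ I, ind ((I.erase i).image s) := by
  funext Y
  rw [Finset.sum_apply]
  unfold bd ind
  rw [← Finset.sum_filter_ne_zero, ← Finset.sum_filter_ne_zero (s := I)]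
  symm
  refine Finset.sum_bij (fun i _ => s i) ?_ ?_ ?_ ?_
  · intro i hi
    simp only [Finset.mem_filter, ne_eq, ite_eq_right_iff, one_ne_zero, imp_false,
      not_not] at hi ⊢
    obtain ⟨hi, rfl⟩ := hi
    refine ⟨?_, ?_⟩
    · simp only [Finset.mem_compl, Finset.mem_image, Finset.mem_erase, not_exists, not_and]
      intro j hj h
      exact hj.1 (hs h)
    · rw [← Finset.image_insert, Finset.insert_erase hi]
  · intro i _ j _ h
    exact hs h
  · intro x hx
    simp only [Finset.mem_filter, ne_eq, ite_eq_right_iff, one_ne_zero, imp_false,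
      not_not] at hx
    obtain ⟨hx, h⟩ := hx
    have hxI : x ∈ I.image s := h ▸ Finset.mem_insert_self x Y
    obtain ⟨i, hi, rfl⟩ := Finset.mem_image.1 hxI
    refine ⟨i, ?_, rfl⟩
    simp only [Finset.mem_filter, ne_eq, ite_eq_right_iff, one_ne_zero, imp_false, not_not]
    refine ⟨hi, ?_⟩
    rw [Finset.image_erase hs, ← h, Finset.erase_insert (by simpa using hx)]
  · intro i hi
    simp only [Finset.mem_filter, ne_eq, ite_eq_right_iff, one_ne_zero, imp_false,
      not_not] at hi
    obtain ⟨hi, rfl⟩ := hi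
    rw [if_pos rfl, if_pos]
    rw [← Finset.image_insert, Finset.insert_erase hi]

/-- Existence of a family of chains. -/
theorem exists_chains {n : ℕ} (G : SimpleGraph V) (P : Fin n → Finset V)
    (hac : ∀ I : Finset (Fin n), I.Nonempty → Acyc G (I.biUnion P) I.card)
    (s t : Fin n → V) (hs : Function.Injective s) (ht : Function.Injective t)
    (hsP : ∀ i, s i ∈ P i) (htP : ∀ i, t i ∈ P i)
    (hsI : ∀ i j, ¬ G.Adj (s i) (s j)) (htI : ∀ i j, ¬ G.Adj (t i) (t j)) (m : ℕ) :
    ∃ c : Finset (Fin n) → Finset V → ZMod 2, ∀ I, I.card ≤ m →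
      Supp G (I.biUnion P) (I.card + 1) (c I) ∧
      bd (c I) = ind (I.image s) + ind (I.image t) + ∑ i ∈ I, c (I.erase i) := by
  classical
  induction m with
  | zero =>
    refine ⟨fun _ => 0, fun I hI => ?_⟩
    obtain rfl : I = ∅ := Finset.card_eq_zero.1 (by omega)
    refine ⟨fun X hX => absurd rfl hX, ?_⟩
    funext X
    simp [bd, ind, CharTwo.add_self_eq_zero]
  | succ m ih =>
    obtain ⟨c, hc⟩ := ih
    have key : ∀ I : Finset (Fin n), I.card = m + 1 → ∃ d : Finset V → ZMod 2,
        Supp G (I.biUnion P) (I.card + 1) d ∧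
        bd d = ind (I.image s) + ind (I.image t) + ∑ i ∈ I, c (I.erase i) := by
      intro I hI
      have hIne : I.Nonempty := Finset.card_pos.1 (by omega)
      have hce : ∀ i ∈ I, (I.erase i).card = m := by
        intro i hi; rw [Finset.card_erase_of_mem hi]; omega
      have hsup : ∀ r : Fin n → V, Function.Injective r → (∀ i, r i ∈ P i) →
          (∀ i j, ¬ G.Adj (r i) (r j)) → Supp G (I.biUnion P) I.card (ind (I.image r)) := by
        intro r hr hrP hrI X hX
        have : X = I.image r := by
          by_contra h
          simp [ind, h] at hX
        subst this
        refine ⟨?_, Finset.card_image_of_injective _ hr, ?_⟩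
        · intro x hx
          obtain ⟨i, hi, rfl⟩ := Finset.mem_image.1 hx
          exact Finset.mem_biUnion.2 ⟨i, hi, hrP i⟩
        · intro a ha b hb
          obtain ⟨i, hi, rfl⟩ := Finset.mem_image.1 ha
          obtain ⟨j, hj, rfl⟩ := Finset.mem_image.1 hb
          exact hrI i j
      refine hac I hIne I.card le_rfl _ ?_ ?_
      · refine ((hsup s hs hsP hsI).add (hsup t ht htP htI)).add (Supp.sum _ _ ?_)
        intro i hi
        have := (hc (I.erase i) (hce i hi).le).1
        rw [hce i hi, ← hI] at this
        exact this.mono (Finset.biUnion_subset_biUnion_of_subset_left _ (Finset.erase_subset _ _))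
      · rw [bd_add, bd_add, bd_ind s hs, bd_ind t ht, bd_sum]
        rw [Finset.sum_congr rfl fun i hi => (hc (I.erase i) (hce i hi).le).2]
        rw [Finset.sum_add_distrib, Finset.sum_add_distrib]
        funext X
        have h0 : (∑ i ∈ I, ∑ j ∈ I.erase i, c ((I.erase i).erase j)) X = 0 := by
          simp only [Finset.sum_apply]
          exact sum_symm_zero I (fun i j => c ((I.erase i).erase j) X) fun i j => by
            rw [Finset.erase_right_comm]
        simp only [Pi.add_apply, Pi.zero_apply] at h0 ⊢
        rw [h0, add_zero, CharTwo.add_self_eq_zero]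
    choose! d hd using key
    refine ⟨fun I => if I.card = m + 1 then d I else c I, fun I hI => ?_⟩
    have hsm : ∀ i ∈ I, (if (I.erase i).card = m + 1 then d (I.erase i) else c (I.erase i))
        = c (I.erase i) := by
      intro i hi
      have h1 := Finset.card_erase_of_mem hi
      have h2 := Finset.card_pos.2 ⟨i, hi⟩
      rw [if_neg (by omega)]
    rw [Finset.sum_congr rfl hsm]
    by_cases h : I.card = m + 1
    · simp only [h, if_true]
      have := hd I h
      rw [h] at this
      exact this
    · simp only [h, if_false]
      exact hc I (by omega)

theorem it_repr {n : ℕ} (G : SimpleGraph V) (P : Fin n → Finset V)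
    (hdisj : ∀ i j, i ≠ j → Disjoint (P i) (P j)) (hcover : ∀ v, ∃ i, v ∈ P i)
    (S : Finset V) (hS : IsIndepTransversal G P S) :
    ∃ s : Fin n → V, Function.Injective s ∧ (∀ i, s i ∈ P i) ∧
      (∀ i j, ¬ G.Adj (s i) (s j)) ∧ Finset.univ.image s = S := by
  have h := fun i => Finset.card_eq_one.1 (hS.2 i)
  choose s hs using h
  have hm : ∀ i, s i ∈ S ∧ s i ∈ P i := by
    intro i
    rw [← Finset.mem_inter, hs]; simp
  refine ⟨s, ?_, fun i => (hm i).2, fun i j => hS.1 _ (hm i).1 _ (hm j).1, ?_⟩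
  · intro i j hij
    by_contra hne
    exact Finset.disjoint_left.1 (hdisj i j hne) (hm i).2 (hij ▸ (hm j).2)
  · ext x
    simp only [Finset.mem_image, Finset.mem_univ, true_and]
    constructor
    · rintro ⟨i, rfl⟩; exact (hm i).1
    · intro hx
      obtain ⟨i, hi⟩ := hcover x
      have : x ∈ S ∩ P i := Finset.mem_inter.2 ⟨hx, hi⟩
      rw [hs] at this
      exact ⟨i, (Finset.mem_singleton.1 this).symm⟩

theorem connected_of_acyc {n : ℕ} (G : SimpleGraph V) (P : Fin n → Finset V)
    (hdisj : ∀ i j, i ≠ j → Disjoint (P i) (P j)) (hcover : ∀ v, ∃ i, v ∈ P i)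
    (hac : ∀ I : Finset (Fin n), I.Nonempty → Acyc G (I.biUnion P) I.card)
    (S T : Finset V)
    (hS : IsIndepTransversal G P S) (hT : IsIndepTransversal G P T) :
    Relation.ReflTransGen (ITAdj G P) S T := by
  classical
  obtain ⟨s, hs, hsP, hsI, hsS⟩ := it_repr G P hdisj hcover S hS
  obtain ⟨t, ht, htP, htI, htT⟩ := it_repr G P hdisj hcover T hT
  obtain ⟨C, hC⟩ := exists_chains G P hac s t hs ht hsP htP hsI htI n
  obtain ⟨hc, hbd⟩ := hC Finset.univ (by simp)
  rw [hsS, htT] at hbd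
  set c := C Finset.univ with hcdef
  by_contra hnot
  set K : Finset (Finset V) :=
    Finset.univ.filter fun X => Relation.ReflTransGen (ITAdj G P) S X with hK
  have hKmem : ∀ X, X ∈ K ↔ Relation.ReflTransGen (ITAdj G P) S X := by
    intro X; simp [hK]
  have hKIT : ∀ X ∈ K, IsIndepTransversal G P X := by
    intro X hX
    rw [hKmem] at hX
    rcases Relation.ReflTransGen.cases_tail hX with h | ⟨Y, _, h⟩
    · exact h ▸ hS
    · exact h.2.1
  have sum1 : ∑ X ∈ K, bd c X = 1 := by
    have : ∀ X ∈ K, bd c X = if X = S then 1 else 0 := by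
      intro X hX
      rw [hbd]
      have hXT : X ≠ T := by
        rintro rfl; exact hnot ((hKmem _).1 hX)
      have h0 : (∑ i, C (Finset.univ.erase i)) X = 0 := by
        rw [Finset.sum_apply]
        refine Finset.sum_eq_zero fun i _ => ?_
        by_contra h
        have hsub := ((hC (Finset.univ.erase i)
          ((Finset.card_le_univ _).trans (by simp))).1 X h).1
        obtain ⟨y, hy⟩ := Finset.card_eq_one.1 ((hKIT X hX).2 i)
        have hy' : y ∈ X ∩ P i := by rw [hy]; simp
        rw [Finset.mem_inter] at hy'
        obtain ⟨j, hj, hyj⟩ := Finset.mem_biUnion.1 (hsub hy'.1)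
        exact Finset.disjoint_left.1 (hdisj j i (Finset.ne_of_mem_erase hj)) hyj hy'.2
      rw [Pi.add_apply, Pi.add_apply, h0]
      simp [ind, hXT]
    rw [Finset.sum_congr rfl this]
    have hSK : S ∈ K := (hKmem S).2 Relation.ReflTransGen.refl
    simp [hSK]
  have sum2 : ∑ X ∈ K, bd c X = ∑ Z, ∑ x ∈ Z.filter (fun x => Z.erase x ∈ K), c Z := by
    unfold bd
    rw [Finset.sum_sigma', Finset.sum_sigma']
    refine Finset.sum_bij' (fun p _ => ⟨insert p.2 p.1, p.2⟩) (fun p _ => ⟨p.1.erase p.2, p.2⟩)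
      ?_ ?_ ?_ ?_ ?_
    · rintro ⟨X, x⟩ h
      simp only [Finset.mem_sigma, Finset.mem_compl] at h
      simp [h, Finset.erase_insert h.2]
    · rintro ⟨Z, x⟩ h
      simp only [Finset.mem_sigma, Finset.mem_filter] at h
      simp [h]
    · rintro ⟨X, x⟩ h
      simp only [Finset.mem_sigma, Finset.mem_compl] at h
      simp [Finset.erase_insert h.2]
    · rintro ⟨Z, x⟩ h
      simp only [Finset.mem_sigma, Finset.mem_filter] at h
      simp [Finset.insert_erase h.2.1]
    · rintro ⟨X, x⟩ h
      rfl
  have sum3 : ∑ Z, ∑ x ∈ Z.filter (fun x => Z.erase x ∈ K), c Z = 0 := by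
    refine Finset.sum_eq_zero fun Z _ => ?_
    by_cases hZ : c Z = 0
    · simp [hZ]
    obtain ⟨-, hZc, hZI⟩ := hc Z hZ
    simp only [Finset.card_univ, Fintype.card_fin] at hZc
    rcases Finset.eq_empty_or_nonempty (Z.filter (fun x => Z.erase x ∈ K)) with he | ⟨x, hx⟩
    · rw [he]; simp
    rw [Finset.mem_filter] at hx
    obtain ⟨hxZ, hxK⟩ := hx
    obtain ⟨i, hxi⟩ := hcover x
    have hIT := hKIT _ hxK
    obtain ⟨y, hy⟩ := Finset.card_eq_one.1 (hIT.2 i)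
    have hy' : y ∈ Z.erase x ∩ P i := by rw [hy]; simp
    rw [Finset.mem_inter, Finset.mem_erase] at hy'
    obtain ⟨⟨hyx, hyZ⟩, hyi⟩ := hy'
    have hother : ∀ j, j ≠ i → ∀ w ∈ P i, Z.erase w ∩ P j = Z ∩ P j := by
      intro j hj w hw
      ext a
      simp only [Finset.mem_inter, Finset.mem_erase]
      constructor
      · tauto
      · rintro ⟨h1, h2⟩
        refine ⟨⟨?_, h1⟩, h2⟩
        rintro rfl
        exact Finset.disjoint_left.1 (hdisj j i hj) h2 hw
    have hZi : Z ∩ P i = {x, y} := by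
      ext a
      have ha := Finset.ext_iff.1 hy a
      simp only [Finset.mem_inter, Finset.mem_erase, Finset.mem_singleton,
        Finset.mem_insert] at ha ⊢
      by_cases hax : a = x
      · subst hax; simp [hxZ, hxi]
      · simp only [hax, false_or]
        rw [← ha]; tauto
    have hyIT : IsIndepTransversal G P (Z.erase y) := by
      refine ⟨fun a ha b hb => hZI a (Finset.mem_of_mem_erase ha) b (Finset.mem_of_mem_erase hb),
        fun j => ?_⟩
      by_cases hj : j = i
      · subst hj
        rw [Finset.erase_inter, hZi, Finset.card_erase_of_mem (by simp),
          Finset.card_pair hyx.symm]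
      · rw [hother j hj y hyi, ← hother j hj x hxi]
        exact hIT.2 j
    have hun : Z.erase x ∪ Z.erase y = Z := by
      ext a
      simp only [Finset.mem_union, Finset.mem_erase]
      constructor
      · tauto
      · intro ha
        by_cases hax : a = x
        · subst hax; exact Or.inr ⟨hyx.symm, ha⟩
        · exact Or.inl ⟨hax, ha⟩
    have hyK : Z.erase y ∈ K := by
      rw [hKmem] at hxK ⊢
      refine hxK.tail ⟨hIT, hyIT, ?_, ?_⟩
      · rw [hun]; exact hZI
      · rw [hun]; exact hZc
    have hfil : Z.filter (fun x => Z.erase x ∈ K) = {x, y} := by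
      ext w
      simp only [Finset.mem_filter, Finset.mem_insert, Finset.mem_singleton]
      constructor
      · rintro ⟨hwZ, hwK⟩
        by_contra hw
        have hwi : w ∉ P i := by
          intro h
          have : w ∈ Z ∩ P i := Finset.mem_inter.2 ⟨hwZ, h⟩
          rw [hZi] at this
          simp at this
          exact hw this
        have h1 := (hKIT _ hwK).2 i
        have h2 : Z.erase w ∩ P i = {x, y} := by
          rw [Finset.erase_inter, hZi, Finset.erase_eq_of_notMem (by simpa using hw)]
        rw [h2, Finset.card_pair hyx.symm] at h1
        omega
      · rintro (rfl | rfl)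
        · exact ⟨hxZ, hxK⟩
        · exact ⟨hyZ, hyK⟩
    rw [hfil, Finset.sum_pair hyx.symm, CharTwo.add_self_eq_zero]
  rw [sum2, sum3] at sum1
  exact zero_ne_one sum1

end ITReconf

/-- If `G` has maximum degree `Δ ≥ 1` and maximum average degree `a` (the maximum over
nonempty vertex subsets `s` of `2·e(G[s]) / |s|`, where `2·e(G[s])` is computed as the
sum over `v ∈ s` of the number of neighbors of `v` inside `s`), and every class of the
vertex partition has size greater than `2Δ²/(2Δ − a)`, then the reconfiguration graph
on independent transversals is connected. -/
theorem stmt_16 {V : Type*} [Fintype V] [DecidableEq V]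
    (G : SimpleGraph V) [DecidableRel G.Adj] (Δ : ℕ) (a : ℝ) (n : ℕ) (hΔ1 : 1 ≤ Δ)
    (hΔ : ∀ v, G.degree v ≤ Δ)
    (ha : IsGreatest {x : ℝ | ∃ s : Finset V, s.Nonempty ∧
      x = (∑ v ∈ s, ((G.neighborFinset v ∩ s).card : ℝ)) / s.card} a)
    (P : Fin n → Finset V)
    (hne : ∀ i, (P i).Nonempty)
    (hdisj : ∀ i j, i ≠ j → Disjoint (P i) (P j))
    (hcover : ∀ v, ∃ i, v ∈ P i)
    (hsize : ∀ i, 2 * (Δ : ℝ) ^ 2 / (2 * Δ - a) < ((P i).card : ℝ))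
    (S T : Finset V)
    (hS : IsIndepTransversal G P S) (hT : IsIndepTransversal G P T) :
    Relation.ReflTransGen (ITAdj G P) S T := by
  classical
  refine ITReconf.connected_of_acyc G P hdisj hcover (fun I hI => ?_) S T hS hT
  set W := I.biUnion P with hW
  have hdg : ∀ U v, ITReconf.dg G U v = (G.neighborFinset v ∩ U).card := by
    intro U v
    unfold ITReconf.dg
    congr 1
    ext x
    simp [and_comm]
  have hle : ∀ U v, ITReconf.dg G U v ≤ Δ := by
    intro U v
    rw [hdg]
    refine (Finset.card_le_card Finset.inter_subset_left).trans ?_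
    rw [SimpleGraph.card_neighborFinset_eq_degree]
    exact hΔ v
  have hΔ0 : (1 : ℝ) ≤ Δ := by exact_mod_cast hΔ1
  have haΔ : a ≤ Δ := by
    obtain ⟨s, hs, rfl⟩ := ha.1
    have hs' : (0 : ℝ) < s.card := by exact_mod_cast Finset.card_pos.2 hs
    rw [div_le_iff₀ hs', mul_comm, ← nsmul_eq_mul]
    refine Finset.sum_le_card_nsmul _ _ _ fun x _ => ?_
    rw [← hdg]
    exact_mod_cast hle s x
  have hpos : 0 < 2 * (Δ : ℝ) - a := by linarith
  have hWne : W.Nonempty := by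
    obtain ⟨i, hi⟩ := hI
    obtain ⟨x, hx⟩ := hne i
    exact ⟨x, Finset.mem_biUnion.2 ⟨i, hi, hx⟩⟩
  have hWpos : (0 : ℝ) < W.card := by exact_mod_cast Finset.card_pos.2 hWne
  have hsum : ∑ v ∈ W, (ITReconf.dg G W v : ℝ) ≤ a * W.card := by
    rw [← div_le_iff₀ hWpos]
    refine ha.2 ⟨W, hWne, ?_⟩
    simp only [hdg]
  have hWc : (W.card : ℝ) = ∑ i ∈ I, ((P i).card : ℝ) := by
    rw [hW, Finset.card_biUnion fun i _ j _ h => hdisj i j h]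
    push_cast; rfl
  have hbig : 2 * (Δ : ℝ) ^ 2 * I.card < (2 * Δ - a) * W.card := by
    rw [hWc, Finset.mul_sum]
    have : 2 * (Δ : ℝ) ^ 2 * I.card = ∑ i ∈ I, 2 * (Δ : ℝ) ^ 2 := by
      rw [Finset.sum_const, nsmul_eq_mul, mul_comm]
    rw [this]
    refine Finset.sum_lt_sum_of_nonempty hI fun i _ => ?_
    have := hsize i
    rwa [div_lt_iff₀ hpos, mul_comm _ (2 * (Δ : ℝ) - a)] at this
  refine ITReconf.acyc_main Δ _ G W I.card le_rfl (fun v _ => hle W v) ?_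
  have hfin : 2 * (Δ : ℝ) ^ 2 * I.card + ∑ v ∈ W, (ITReconf.dg G W v : ℝ) < 2 * Δ * W.card := by
    linarith
  exact_mod_cast hfin
end

section
/- Let H be a finite simple graph and let L be a list assignment giving each vertex v a finite set L(v) of colors, such that (H, L) has maximum vertex-color degree Δ. If |L(v)| ≥ 2Δ + 1 for every vertex v, then the reconfiguration graph RG_VLC(H, L) of proper L-colorings is connected. -/
/-- `c` is a proper `L`-coloring of the graph `H`: each vertex gets a color from its
list, and adjacent vertices get distinct colors. -/
def ProperLColoring {V C : Type*} (H : SimpleGraph V) (L : V → Finset C)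
    (c : V → C) : Prop :=
  (∀ v, c v ∈ L v) ∧ ∀ u v, H.Adj u v → c u ≠ c v

/-- Adjacency in the reconfiguration graph `RG_VLC(H, L)`: two proper `L`-colorings are
adjacent if they differ at exactly one vertex. -/
def VLCAdj {V C : Type*} (H : SimpleGraph V) (L : V → Finset C) (c c' : V → C) : Prop :=
  ProperLColoring H L c ∧ ProperLColoring H L c' ∧
    ∃ v, c v ≠ c' v ∧ ∀ u, u ≠ v → c u = c' u

set_option linter.unusedSectionVars false

/-- Mod 2 simplicial boundary (augmented). -/
noncomputable def rgBd {α : Type*} [DecidableEq α] :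
    (Finset α →₀ ZMod 2) →ₗ[ZMod 2] (Finset α →₀ ZMod 2) :=
  Finsupp.linearCombination (ZMod 2) (fun σ => ∑ v ∈ σ, Finsupp.single (σ.erase v) 1)

/-- Cone operator. -/
noncomputable def rgJ {α : Type*} [DecidableEq α] (x : α) :
    (Finset α →₀ ZMod 2) →ₗ[ZMod 2] (Finset α →₀ ZMod 2) :=
  Finsupp.linearCombination (ZMod 2)
    (fun σ => if x ∈ σ then 0 else Finsupp.single (insert x σ) 1)

/-- Link of the edge `{x, y}`. -/
noncomputable def rgPi {α : Type*} [DecidableEq α] (x y : α) :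
    (Finset α →₀ ZMod 2) →ₗ[ZMod 2] (Finset α →₀ ZMod 2) :=
  Finsupp.linearCombination (ZMod 2)
    (fun σ => if x ∈ σ ∧ y ∈ σ then Finsupp.single ((σ.erase x).erase y) 1 else 0)

section
variable {α : Type*} [DecidableEq α]

lemma rgBd_single (σ : Finset α) :
    rgBd (Finsupp.single σ 1) = ∑ v ∈ σ, Finsupp.single (σ.erase v) (1 : ZMod 2) := by
  simp [rgBd]

lemma rgJ_single (x : α) (σ : Finset α) :
    rgJ x (Finsupp.single σ 1) = if x ∈ σ then 0 else Finsupp.single (insert x σ) (1 : ZMod 2) := by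
  simp [rgJ]

lemma rgPi_single (x y : α) (σ : Finset α) :
    rgPi x y (Finsupp.single σ 1) =
      if x ∈ σ ∧ y ∈ σ then Finsupp.single ((σ.erase x).erase y) (1 : ZMod 2) else 0 := by
  simp [rgPi]

lemma rg_ext {M : Type*} [AddCommGroup M] [Module (ZMod 2) M]
    (F G : (Finset α →₀ ZMod 2) →ₗ[ZMod 2] M)
    (h : ∀ σ, F (Finsupp.single σ 1) = G (Finsupp.single σ 1)) (z) : F z = G z := by
  have : F = G := by
    apply Finsupp.lhom_ext'
    intro σ
    ext
    simpa using h σ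
  rw [this]

lemma rg_two {M : Type*} [AddCommGroup M] [Module (ZMod 2) M] (m : M) : m + m = 0 :=
  ZModModule.add_self m

lemma rg_move {M : Type*} [AddCommGroup M] [Module (ZMod 2) M] {a b c : M} (h : a + b = c) :
    a = c + b := by
  rw [← h, add_assoc, rg_two, add_zero]

lemma rg_cone (x : α) (z : Finset α →₀ ZMod 2) : rgBd (rgJ x z) + rgJ x (rgBd z) = z := by
  refine rg_ext (rgBd ∘ₗ rgJ x + rgJ x ∘ₗ rgBd) LinearMap.id ?_ z
  intro σ
  simp only [LinearMap.add_apply, LinearMap.comp_apply, LinearMap.id_apply, rgJ_single,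
    rgBd_single, map_sum]
  by_cases hx : x ∈ σ
  · rw [if_pos hx, map_zero, zero_add, Finset.sum_eq_single x]
    · simp [Finset.insert_erase hx]
    · intro b hb hbx
      simp [hx, Ne.symm hbx]
    · intro h; exact absurd hx h
  · rw [if_neg hx, rgBd_single, Finset.sum_insert hx, Finset.erase_insert hx, add_assoc,
      ← Finset.sum_add_distrib]
    rw [Finset.sum_eq_zero, add_zero]
    intro v hv
    have hvx : v ≠ x := fun h => hx (h ▸ hv)
    have : x ∉ σ.erase v := fun h => hx (Finset.mem_of_mem_erase h)
    rw [if_neg this, Finset.erase_insert_of_ne hvx.symm]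
    exact rg_two _

lemma rg_bdbd (z : Finset α →₀ ZMod 2) : rgBd (rgBd z) = 0 := by
  refine rg_ext (M := Finset α →₀ ZMod 2) (rgBd ∘ₗ rgBd)
    (0 : (Finset α →₀ ZMod 2) →ₗ[ZMod 2] (Finset α →₀ ZMod 2)) ?_ z
  intro σ
  simp only [LinearMap.comp_apply, LinearMap.zero_apply]
  induction σ using Finset.induction_on with
  | empty => simp [rgBd_single]
  | insert a τ ha ih =>
    have h1 : Finsupp.single (insert a τ) (1 : ZMod 2) = rgJ a (Finsupp.single τ 1) := by
      rw [rgJ_single, if_neg ha]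
    have h2 := rg_cone a (Finsupp.single τ (1 : ZMod 2))
    have h3 := rg_cone a (rgBd (Finsupp.single τ (1 : ZMod 2)))
    have h4 := congrArg rgBd h2
    rw [ih, map_zero, add_zero] at h3
    rw [map_add, h3] at h4
    rw [h1]
    simpa using h4

lemma rg_pi_bd (x y : α) (z : Finset α →₀ ZMod 2) :
    rgPi x y (rgBd z) = rgBd (rgPi x y z) := by
  refine rg_ext (rgPi x y ∘ₗ rgBd) (rgBd ∘ₗ rgPi x y) ?_ z
  intro σ
  simp only [LinearMap.comp_apply, rgPi_single, rgBd_single, map_sum]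
  by_cases h : x ∈ σ ∧ y ∈ σ
  · rw [if_pos h, rgBd_single]
    symm
    apply Finset.sum_subset_zero_on_sdiff
    · intro v hv
      simp at hv ⊢
      exact hv.2.2
    · intro v hv
      rw [if_neg]
      simp at hv ⊢
      grind
    · intro v hv
      simp at hv
      rw [if_pos]
      · congr 1
        ext a
        simp
        tauto
      · simp; grind
  · rw [if_neg h, map_zero]
    apply Finset.sum_eq_zero
    intro v hv
    rw [if_neg]
    simp
    tauto

/-- Independent sets in `W` of size `s`. -/
def rgX (G : SimpleGraph α) (W : Finset α) (s : ℕ) : Set (Finset α) :=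
  {σ | σ ⊆ W ∧ (∀ a ∈ σ, ∀ b ∈ σ, ¬ G.Adj a b) ∧ σ.card = s}

/-- Chains supported on `X`. -/
noncomputable abbrev rgC (X : Set (Finset α)) : Submodule (ZMod 2) (Finset α →₀ ZMod 2) :=
  Finsupp.supported (ZMod 2) (ZMod 2) X

lemma rg_map {M : Type*} [AddCommGroup M] [Module (ZMod 2) M] {X : Set (Finset α)}
    (F : (Finset α →₀ ZMod 2) →ₗ[ZMod 2] M) (N : Submodule (ZMod 2) M)
    (h : ∀ σ ∈ X, F (Finsupp.single σ 1) ∈ N) {z} (hz : z ∈ rgC X) : F z ∈ N := by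
  have : rgC X ≤ N.comap F := by
    rw [rgC, Finsupp.supported_eq_span_single, Submodule.span_le]
    rintro _ ⟨σ, hσ, rfl⟩
    exact h σ hσ
  exact this hz

lemma rg_single_mem {X : Set (Finset α)} {σ : Finset α} (h : σ ∈ X) :
    Finsupp.single σ (1 : ZMod 2) ∈ rgC X :=
  Finsupp.single_mem_supported _ _ h

lemma rg_acyclic (Δ n : ℕ) : ∀ (G : SimpleGraph α) [DecidableRel G.Adj] (W : Finset α) (k s : ℕ)
    (_ : ∀ v ∈ W, (W.filter (G.Adj v)).card ≤ Δ)
    (_ : 2 * k * Δ < W.card) (_ : s ≤ k)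
    (_ : ((W ×ˢ W).filter (fun p => G.Adj p.1 p.2)).card ≤ n)
    (z : Finset α →₀ ZMod 2) (_ : z ∈ rgC (rgX G W s)) (_ : rgBd z = 0),
    ∃ w ∈ rgC (rgX G W (s + 1)), rgBd w = z := by
  induction n with
  | zero =>
    intro G _ W k s hdeg hW hs hn z hz hbz
    obtain ⟨v, hv⟩ : W.Nonempty := Finset.card_pos.1 (by omega)
    have hno : ∀ a ∈ W, ∀ b ∈ W, ¬ G.Adj a b := by
      intro a ha b hb hab
      have : ((W ×ˢ W).filter (fun p => G.Adj p.1 p.2)) = ∅ :=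
        Finset.card_eq_zero.1 (by omega)
      have h2 : (a, b) ∈ ((W ×ˢ W).filter (fun p => G.Adj p.1 p.2)) := by simp [ha, hb, hab]
      rw [this] at h2
      simp at h2
    refine ⟨rgJ v z, ?_, ?_⟩
    · refine rg_map _ _ ?_ hz
      rintro σ ⟨h1, h2, h3⟩
      rw [rgJ_single]
      split_ifs with h
      · exact Submodule.zero_mem _
      · apply rg_single_mem
        have h4 : insert v σ ⊆ W := Finset.insert_subset hv h1
        refine ⟨h4, fun a ha b hb => hno a (h4 ha) b (h4 hb), ?_⟩
        rw [Finset.card_insert_of_notMem h, h3]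
    · have := rg_cone v z
      rwa [hbz, map_zero, add_zero] at this
  | succ n ih =>
    intro G _ W k s hdeg hW hs hn z hz hbz
    by_cases hn' : ((W ×ˢ W).filter (fun p => G.Adj p.1 p.2)).card ≤ n
    · exact ih G W k s hdeg hW hs hn' z hz hbz
    obtain ⟨⟨x, y⟩, hxy⟩ : ((W ×ˢ W).filter (fun p => G.Adj p.1 p.2)).Nonempty :=
      Finset.card_pos.1 (by omega)
    simp only [Finset.mem_filter, Finset.mem_product] at hxy
    obtain ⟨⟨hx, hy⟩, hxy⟩ := hxy
    have hne : x ≠ y := hxy.ne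
    classical
    let G' : SimpleGraph α := G.deleteEdges {s(x, y)}
    have hG' : ∀ a b, G'.Adj a b ↔ G.Adj a b ∧ ¬ ((a = x ∧ b = y) ∨ (a = y ∧ b = x)) := by
      intro a b
      simp [G', SimpleGraph.deleteEdges_adj]
    have hlt : ((W ×ˢ W).filter (fun p => G'.Adj p.1 p.2)).card ≤ n := by
      have : ((W ×ˢ W).filter (fun p => G'.Adj p.1 p.2)).card <
          ((W ×ˢ W).filter (fun p => G.Adj p.1 p.2)).card := by
        apply Finset.card_lt_card
        rw [Finset.ssubset_iff_of_subset]
        · refine ⟨(x, y), ?_, ?_⟩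
          · simp [*]
          · simp [hG']
        · intro p hp
          simp [hG'] at hp ⊢
          tauto
      omega
    obtain ⟨w, hw, hwz⟩ := ih G' W k s (by
        intro v hv
        refine le_trans (Finset.card_le_card ?_) (hdeg v hv)
        intro p hp
        simp [hG'] at hp ⊢
        tauto) hW hs hlt z (by
        refine Finsupp.supported_mono ?_ hz
        rintro σ ⟨h1, h2, h3⟩
        exact ⟨h1, fun a ha b hb h => h2 a ha b hb ((hG' a b).1 h).1, h3⟩) hbz
    have hpiz : rgPi x y z = 0 := by
      have : rgPi x y z ∈ (⊥ : Submodule (ZMod 2) (Finset α →₀ ZMod 2)) := by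
        refine rg_map _ _ ?_ hz
        rintro σ ⟨h1, h2, h3⟩
        rw [rgPi_single, if_neg]
        · exact Submodule.zero_mem _
        · rintro ⟨ha, hb⟩
          exact h2 x ha y hb hxy
      simpa using this
    have hu0 : rgBd (rgPi x y w) = 0 := by rw [← rg_pi_bd, hwz, hpiz]
    let W' : Finset α := W.filter (fun v => ¬ G.Adj x v ∧ ¬ G.Adj y v)
    have hW'W : W' ⊆ W := Finset.filter_subset _ _
    have hxW' : x ∉ W' := by simp [W', hxy.symm]
    have hyW' : y ∉ W' := by simp [W', hxy]
    obtain ⟨t, ht, htu⟩ : ∃ t ∈ rgC (rgX G W' s), rgBd t = rgPi x y w := by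
      rcases s with _ | s
      · refine ⟨0, Submodule.zero_mem _, ?_⟩
        have : rgPi x y w ∈ (⊥ : Submodule (ZMod 2) (Finset α →₀ ZMod 2)) := by
          refine rg_map _ _ ?_ hw
          rintro σ ⟨h1, h2, h3⟩
          rw [rgPi_single, if_neg]
          · exact Submodule.zero_mem _
          · rintro ⟨ha, hb⟩
            exact hne (Finset.card_le_one.1 (by omega) x ha y hb)
        rw [map_zero]
        exact ((Submodule.mem_bot _).1 this).symm
      · obtain ⟨k, rfl⟩ : ∃ k', k = k' + 1 := ⟨k - 1, by omega⟩
        refine ih G W' k s ?_ ?_ (by omega) ?_ (rgPi x y w) ?_ hu0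
        · intro v hv
          refine le_trans (Finset.card_le_card ?_) (hdeg v (hW'W hv))
          exact Finset.filter_subset_filter _ hW'W
        · have h1 : W ⊆ W' ∪ (W.filter (G.Adj x) ∪ W.filter (G.Adj y)) := by
            intro v hv
            simp [W', hv]
            tauto
          have h2 := Finset.card_le_card h1
          have h3 := Finset.card_union_le W' (W.filter (G.Adj x) ∪ W.filter (G.Adj y))
          have h4 := Finset.card_union_le (W.filter (G.Adj x)) (W.filter (G.Adj y))
          have h5 := hdeg x hx
          have h6 := hdeg y hy
          have h7 : 2 * (k + 1) * Δ = 2 * k * Δ + 2 * Δ := by ring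
          omega
        · have : ((W' ×ˢ W').filter (fun p => G.Adj p.1 p.2)).card <
              ((W ×ˢ W).filter (fun p => G.Adj p.1 p.2)).card := by
            apply Finset.card_lt_card
            rw [Finset.ssubset_iff_of_subset]
            · refine ⟨(x, y), ?_, ?_⟩
              · simp [*]
              · simp [hxW']
            · exact Finset.filter_subset_filter _ (Finset.product_subset_product hW'W hW'W)
          omega
        · refine rg_map _ _ ?_ hw
          rintro σ ⟨h1, h2, h3⟩
          rw [rgPi_single]
          split_ifs with h
          · apply rg_single_mem
            refine ⟨?_, ?_, ?_⟩
            · intro v hv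
              simp only [Finset.mem_erase] at hv
              have hx' := h2 x h.1 v hv.2.2
              have hy' := h2 y h.2 v hv.2.2
              rw [hG'] at hx' hy'
              simp only [W', Finset.mem_filter]
              refine ⟨h1 hv.2.2, ?_, ?_⟩ <;> grind
            · intro a ha b hb hab
              simp only [Finset.mem_erase] at ha hb
              have := h2 a ha.2.2 b hb.2.2
              rw [hG'] at this
              grind
            · rw [Finset.card_erase_of_mem, Finset.card_erase_of_mem h.1]
              · omega
              · simp [h.2, hne.symm]
          · exact Submodule.zero_mem _
    have hJ : ∀ v ∈ W, (∀ a ∈ W', ¬ G.Adj v a) → rgJ v t ∈ rgC (rgX G W (s + 1)) := by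
      intro v hv hva
      refine rg_map _ _ ?_ ht
      rintro σ ⟨h1, h2, h3⟩
      rw [rgJ_single]
      split_ifs with h
      · exact Submodule.zero_mem _
      · apply rg_single_mem
        refine ⟨Finset.insert_subset hv (h1.trans hW'W), ?_, ?_⟩
        · intro a ha b hb hab
          rw [Finset.mem_insert] at ha hb
          rcases ha with rfl | ha <;> rcases hb with rfl | hb
          · exact G.irrefl hab
          · exact hva b (h1 hb) hab
          · exact hva a (h1 ha) hab.symm
          · exact h2 a ha b hb hab
        · rw [Finset.card_insert_of_notMem h, h3]
    have hA : w + rgJ x (rgJ y (rgPi x y w)) ∈ rgC (rgX G W (s + 1)) := by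
      refine rg_map (LinearMap.id + rgJ x ∘ₗ rgJ y ∘ₗ rgPi x y) _ ?_ hw
      rintro σ ⟨h1, h2, h3⟩
      simp only [LinearMap.add_apply, LinearMap.comp_apply, LinearMap.id_apply, rgPi_single]
      split_ifs with h
      · rw [rgJ_single, if_neg (by simp), Finset.insert_erase (by simp [h.2, hne.symm]),
          rgJ_single, if_neg (by simp), Finset.insert_erase h.1, rg_two]
        exact Submodule.zero_mem _
      · rw [map_zero, map_zero, add_zero]
        apply rg_single_mem
        refine ⟨h1, ?_, h3⟩
        intro a ha b hb hab
        have := h2 a ha b hb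
        rw [hG'] at this
        grind
    refine ⟨w + rgBd (rgJ x (rgJ y t)), ?_, ?_⟩
    · have e1 := rg_cone x (rgJ y t)
      have e2 := rg_cone y t
      rw [htu] at e2
      have e3 : rgBd (rgJ y t) = t + rgJ y (rgPi x y w) := rg_move e2
      rw [e3, map_add] at e1
      have e4 : rgBd (rgJ x (rgJ y t)) =
          rgJ y t + (rgJ x t + rgJ x (rgJ y (rgPi x y w))) := rg_move e1
      have e5 : w + rgBd (rgJ x (rgJ y t)) =
          (w + rgJ x (rgJ y (rgPi x y w))) + (rgJ y t + rgJ x t) := by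
        rw [e4]; abel
      rw [e5]
      refine Submodule.add_mem _ hA (Submodule.add_mem _ (hJ y hy ?_) (hJ x hx ?_))
      · intro a ha; simp [W'] at ha; tauto
      · intro a ha; simp [W'] at ha; tauto
    · rw [map_add, rg_bdbd, add_zero, hwz]

end

section
variable {V C : Type*} [DecidableEq V] [DecidableEq C]

/-- The cover graph. -/
def rgG (C : Type*) (H : SimpleGraph V) : SimpleGraph (Σ _ : V, C) where
  Adj p q := H.Adj p.1 q.1 ∧ p.2 = q.2
  symm := ⟨fun _ _ h => ⟨h.1.symm, h.2.symm⟩⟩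
  loopless := ⟨fun _ h => H.irrefl h.1⟩

/-- The graph of a coloring over `S`. -/
def rgT (c : V → C) (S : Finset V) : Finset (Σ _ : V, C) :=
  S.image (fun v => ⟨v, c v⟩)

lemma rg_mem_T (c : V → C) (S : Finset V) (p : Σ _ : V, C) :
    p ∈ rgT c S ↔ p.1 ∈ S ∧ p.2 = c p.1 := by
  obtain ⟨a, b⟩ := p
  simp only [rgT, Finset.mem_image]
  constructor
  · rintro ⟨v, hv, h⟩
    cases h
    exact ⟨hv, rfl⟩
  · rintro ⟨h1, h2⟩
    exact ⟨a, h1, by rw [h2]⟩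

lemma rg_inj (c : V → C) : Function.Injective (fun v => (⟨v, c v⟩ : Σ _ : V, C)) := by
  intro a b h
  exact congrArg Sigma.fst h

lemma rg_bd_T (c : V → C) (S : Finset V) :
    rgBd (Finsupp.single (rgT c S) 1) =
      ∑ v ∈ S, Finsupp.single (rgT c (S.erase v)) (1 : ZMod 2) := by
  rw [rgBd_single]
  conv_lhs => rw [rgT]
  rw [Finset.sum_image (fun a _ b _ h => rg_inj c h)]
  refine Finset.sum_congr rfl fun v _ => ?_
  rw [rgT, Finset.image_erase (rg_inj c)]

lemma rg_T_mem (H : SimpleGraph V) (L : V → Finset C) (c : V → C) (hc : ProperLColoring H L c)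
    (S : Finset V) : rgT c S ∈ rgX (rgG C H) (S.sigma fun v => L v) S.card := by
  refine ⟨?_, ?_, ?_⟩
  · intro p hp
    rw [rg_mem_T] at hp
    rw [Finset.mem_sigma, hp.2]
    exact ⟨hp.1, hc.1 _⟩
  · intro p hp q hq h
    rw [rg_mem_T] at hp hq
    apply hc.2 _ _ h.1
    rw [← hp.2, ← hq.2, h.2]
  · exact Finset.card_image_of_injective _ (rg_inj c)

lemma rg_double {M : Type*} [AddCommGroup M] [Module (ZMod 2) M] (w : Finset V → M)
    (S : Finset V) : ∑ v ∈ S, ∑ u ∈ S.erase v, w ((S.erase v).erase u) = 0 := by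
  have h := congrArg (Finsupp.linearCombination (ZMod 2) w)
    (rg_bdbd (Finsupp.single S (1 : ZMod 2)))
  simpa [rgBd_single] using h

lemma rg_prism [Fintype V] (H : SimpleGraph V) [DecidableRel H.Adj] (L : V → Finset C) (Δ : ℕ)
    (hΔ : ∀ (col : C) (v : V), col ∈ L v →
      ((H.neighborFinset v).filter fun u => col ∈ L u).card ≤ Δ)
    (hL : ∀ v, 2 * Δ + 1 ≤ (L v).card)
    (c c' : V → C)
    (hc : ProperLColoring H L c) (hc' : ProperLColoring H L c') (n : ℕ) :
    ∃ w : Finset V → (Finset (Σ _ : V, C) →₀ ZMod 2), ∀ S : Finset V, S.card < n →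
      w S ∈ rgC (rgX (rgG C H) (S.sigma fun v => L v) (S.card + 1)) ∧
      rgBd (w S) = Finsupp.single (rgT c S) 1 + Finsupp.single (rgT c' S) 1 +
        ∑ v ∈ S, w (S.erase v) := by
  classical
  induction n with
  | zero => exact ⟨0, fun S h => absurd h (Nat.not_lt_zero _)⟩
  | succ n ih =>
    obtain ⟨w, hw⟩ := ih
    have key : ∀ S : Finset V, S.card = n → ∃ x,
        x ∈ rgC (rgX (rgG C H) (S.sigma fun v => L v) (S.card + 1)) ∧
        rgBd x = Finsupp.single (rgT c S) 1 + Finsupp.single (rgT c' S) 1 +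
          ∑ v ∈ S, w (S.erase v) := by
      intro S hS
      rcases S.eq_empty_or_nonempty with rfl | hne
      · refine ⟨0, Submodule.zero_mem _, ?_⟩
        simp [rgT, rg_two]
      have hlt : ∀ v ∈ S, (S.erase v).card < n := fun v hv => by
        rw [← hS]; exact Finset.card_erase_lt_of_mem hv
      refine rg_acyclic Δ _ (rgG C H) (S.sigma fun v => L v) S.card S.card ?_ ?_ le_rfl le_rfl
        _ ?_ ?_
      · rintro ⟨v, k⟩ hvk
        rw [Finset.mem_sigma] at hvk
        refine le_trans ?_ (hΔ k v hvk.2)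
        apply Finset.card_le_card_of_injOn Sigma.fst
        · rintro ⟨u, l⟩ h
          rw [Finset.mem_coe, Finset.mem_filter] at h
          rw [Finset.mem_coe]
          simp [rgG] at h ⊢
          obtain ⟨⟨_, h2⟩, h3, rfl⟩ := h
          exact ⟨h3, h2⟩
        · rintro ⟨u, l⟩ h ⟨u', l'⟩ h' e
          rw [Finset.mem_coe, Finset.mem_filter] at h h'
          simp [rgG] at h h' e
          obtain ⟨_, _, rfl⟩ := h
          obtain ⟨_, _, rfl⟩ := h'
          subst e
          rfl
      · rw [Finset.card_sigma]
        have h1 : ∑ v ∈ S, (2 * Δ + 1) ≤ ∑ v ∈ S, (L v).card :=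
          Finset.sum_le_sum fun v _ => hL v
        rw [Finset.sum_const, smul_eq_mul] at h1
        have h2 : 0 < S.card := Finset.card_pos.2 hne
        nlinarith
      · refine Submodule.add_mem _ (Submodule.add_mem _ (rg_single_mem (rg_T_mem H L c hc S))
          (rg_single_mem (rg_T_mem H L c' hc' S))) (Submodule.sum_mem _ fun v hv => ?_)
        refine Finsupp.supported_mono ?_ (hw (S.erase v) (hlt v hv)).1
        rintro σ ⟨h1, h2, h3⟩
        refine ⟨h1.trans (Finset.sigma_mono (Finset.erase_subset _ _) fun _ => le_rfl), h2, ?_⟩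
        rw [h3, Finset.card_erase_add_one hv]
      · rw [map_add, map_add, map_sum, rg_bd_T, rg_bd_T,
          Finset.sum_congr rfl fun v hv => (hw (S.erase v) (hlt v hv)).2,
          Finset.sum_add_distrib, Finset.sum_add_distrib, rg_double, add_zero, rg_two]
    choose! x hx using key
    refine ⟨fun S => if S.card = n then x S else w S, ?_⟩
    intro S hS
    have hsum : ∑ v ∈ S, (fun S => if S.card = n then x S else w S) (S.erase v) =
        ∑ v ∈ S, w (S.erase v) := by
      refine Finset.sum_congr rfl fun v hv => ?_
      have := Finset.card_erase_lt_of_mem hv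
      exact if_neg (by omega)
    rw [hsum]
    by_cases h : S.card = n
    · simp only [if_pos h]
      exact hx S h
    · simp only [if_neg h]
      exact hw S (by omega)

/-- Full colorings reachable from `c`. -/
def rgR [Fintype V] (H : SimpleGraph V) (L : V → Finset C) (c : V → C) :
    Set (Finset (Σ _ : V, C)) :=
  {σ | ∃ d, ProperLColoring H L d ∧ Relation.ReflTransGen (VLCAdj H L) c d ∧
    σ = rgT d Finset.univ}

lemma rg_sperner [Fintype V] (H : SimpleGraph V) (L : V → Finset C) (c : V → C)
    (σ : Finset (Σ _ : V, C)) [DecidablePred (· ∈ rgR H L c)]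
    (hσ : σ ∈ rgX (rgG C H) (Finset.univ.sigma fun v => L v)
      ((Finset.univ : Finset V).card + 1)) :
    ∑ p ∈ σ, (if σ.erase p ∈ rgR H L c then (1 : ZMod 2) else 0) = 0 := by
  obtain ⟨h1, h2, h3⟩ := hσ
  by_cases hex : ∃ p ∈ σ, σ.erase p ∈ rgR H L c
  swap
  · push Not at hex
    exact Finset.sum_eq_zero fun p hp => if_neg (hex p hp)
  obtain ⟨⟨a, k⟩, hp, d, hd, hcd, hpd⟩ := hex
  have hmem : ∀ q : (Σ _ : V, C), q ∈ σ ↔ q = ⟨a, k⟩ ∨ q.2 = d q.1 := by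
    intro q
    have : q ∈ σ.erase ⟨a, k⟩ ↔ q.2 = d q.1 := by
      rw [hpd, rg_mem_T]; simp
    rw [Finset.mem_erase] at this
    by_cases hq : q = ⟨a, k⟩
    · subst hq; simp [hp]
    · simpa [hq] using this
  have hk : k ≠ d a := by
    intro h
    have : (⟨a, k⟩ : Σ _ : V, C) ∈ σ.erase ⟨a, k⟩ := by
      rw [hpd, rg_mem_T]; simp [h]
    simp at this
  have hda : (⟨a, d a⟩ : Σ _ : V, C) ∈ σ := (hmem _).2 (Or.inr rfl)
  have hne : (⟨a, k⟩ : Σ _ : V, C) ≠ ⟨a, d a⟩ := by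
    intro h; cases h; exact hk rfl
  have hprop : ProperLColoring H L (Function.update d a k) := by
    have hin : ∀ v, (⟨v, Function.update d a k v⟩ : Σ _ : V, C) ∈ σ := by
      intro v
      rw [hmem]
      by_cases hv : v = a
      · subst hv; simp
      · right; simp [hv]
    constructor
    · intro v
      exact (Finset.mem_sigma.1 (h1 (hin v))).2
    · intro u v huv he
      exact h2 _ (hin u) _ (hin v) ⟨huv, he⟩
  have hR1 : σ.erase ⟨a, k⟩ ∈ rgR H L c := ⟨d, hd, hcd, hpd⟩
  have hR2 : σ.erase ⟨a, d a⟩ ∈ rgR H L c := by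
    refine ⟨Function.update d a k, hprop, hcd.tail ⟨hd, hprop, a, ?_, ?_⟩, ?_⟩
    · simpa using hk.symm
    · intro u hu; simp [hu]
    · ext ⟨v, l⟩
      rw [Finset.mem_erase, hmem, rg_mem_T]
      by_cases hv : v = a
      · subst hv
        simp
        grind
      · simp [hv]
  rw [← Finset.sum_subset (s₁ := {⟨a, k⟩, ⟨a, d a⟩})]
  · rw [Finset.sum_pair hne, if_pos hR1, if_pos hR2]
    exact rg_two _
  · intro q hq
    simp only [Finset.mem_insert, Finset.mem_singleton] at hq
    rcases hq with rfl | rfl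
    · exact hp
    · exact hda
  · intro q hq hq'
    simp only [Finset.mem_insert, Finset.mem_singleton, not_or] at hq'
    rw [if_neg]
    rintro ⟨d', -, -, h⟩
    have m1 : (⟨a, k⟩ : Σ _ : V, C) ∈ σ.erase q := Finset.mem_erase.2 ⟨Ne.symm hq'.1, hp⟩
    have m2 : (⟨a, d a⟩ : Σ _ : V, C) ∈ σ.erase q := Finset.mem_erase.2 ⟨Ne.symm hq'.2, hda⟩
    rw [h, rg_mem_T] at m1 m2
    exact hk (m1.2.trans m2.2.symm)

end

theorem stmt_17 {V C : Type*} [Fintype V] [DecidableEq V] [DecidableEq C]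
    (H : SimpleGraph V) [DecidableRel H.Adj] (L : V → Finset C) (Δ : ℕ)
    (hΔ : ∀ (col : C) (v : V), col ∈ L v →
      ((H.neighborFinset v).filter fun u => col ∈ L u).card ≤ Δ)
    (hL : ∀ v, 2 * Δ + 1 ≤ (L v).card)
    (c c' : V → C)
    (hc : ProperLColoring H L c) (hc' : ProperLColoring H L c') :
    Relation.ReflTransGen (VLCAdj H L) c c' := by
  classical
  obtain ⟨w, hw⟩ := rg_prism H L Δ hΔ hL c c' hc hc' ((Finset.univ : Finset V).card + 1)
  let f : (Finset (Σ _ : V, C) →₀ ZMod 2) →ₗ[ZMod 2] ZMod 2 :=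
    Finsupp.linearCombination (ZMod 2) (fun σ => if σ ∈ rgR H L c then 1 else 0)
  have hf : ∀ σ, f (Finsupp.single σ 1) = if σ ∈ rgR H L c then 1 else 0 := by
    intro σ; simp [f]
  obtain ⟨hw1, hw2⟩ := hw Finset.univ (Nat.lt_succ_self _)
  have e0 : f (rgBd (w Finset.univ)) = 0 := by
    have : (f ∘ₗ rgBd) (w Finset.univ) ∈ (⊥ : Submodule (ZMod 2) (ZMod 2)) := by
      refine rg_map _ _ ?_ hw1
      intro σ hσ
      rw [Submodule.mem_bot, LinearMap.comp_apply, rgBd_single, map_sum]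
      simp only [hf]
      exact rg_sperner H L c σ hσ
    exact (Submodule.mem_bot _).1 this
  have e1 : ∀ v, f (w (Finset.univ.erase v)) = 0 := by
    intro v
    have hlt : (Finset.univ.erase v).card < (Finset.univ : Finset V).card + 1 :=
      Nat.lt_succ_of_le (Finset.card_le_card (Finset.erase_subset _ _))
    have : f (w (Finset.univ.erase v)) ∈ (⊥ : Submodule (ZMod 2) (ZMod 2)) := by
      refine rg_map _ _ ?_ (hw (Finset.univ.erase v) hlt).1
      rintro σ ⟨h1, -, -⟩
      rw [Submodule.mem_bot, hf, if_neg]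
      rintro ⟨d, -, -, rfl⟩
      have := h1 ((rg_mem_T d Finset.univ ⟨v, d v⟩).2 (by simp))
      simp at this
    exact (Submodule.mem_bot _).1 this
  have hT : f (Finsupp.single (rgT c Finset.univ) 1) = 1 := by
    rw [hf, if_pos]
    exact ⟨c, hc, Relation.ReflTransGen.refl, rfl⟩
  rw [hw2, map_add, map_add, map_sum, Finset.sum_eq_zero fun v _ => e1 v, hT, hf] at e0
  by_cases h : rgT c' Finset.univ ∈ rgR H L c
  · obtain ⟨d, -, hcd, he⟩ := h
    have : c' = d := by
      funext v
      have hm := (rg_mem_T c' Finset.univ ⟨v, c' v⟩).2 (by simp)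
      rw [he, rg_mem_T] at hm
      exact hm.2
    rwa [this]
  · rw [if_neg h] at e0
    simp at e0
end
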